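/- Let G be a finite solvable group, K an abelian normal subgroup of G of prime-power order r^a, and suppose every irreducible character of G not containing K in its kernel is faithful and has codegree different from a fixed value n for which m'_G(n) > 1, and G is a T'_k-group. Then every Sylow r-subgroup of G/K has order an even power of r, and every Hall r'-subgroup of G/K acts Frobeniusly (fixed-point-freely) on K. -/

import Mathlib

open CategoryTheory

def Irr (G : Type) [Group G] [Fintype G] : Set (G → ℂ) :=
  {χ | ∃ V : FDRep ℂ G, Simple V ∧ χ = V.character}

noncomputable def charDeg (G : Type) [Group G] (χ : G → ℂ) : ℕ := Nat.floor (χ 1).re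

def kerSet (G : Type) [Group G] (χ : G → ℂ) : Set G := {g | χ g = χ 1}

noncomputable def cod (G : Type) [Group G] [Fintype G] (χ : G → ℂ) : ℕ :=
  Fintype.card G / (kerSet G χ).ncard / charDeg G χ

def codSet (G : Type) [Group G] [Fintype G] : Set ℕ := {d | ∃ χ ∈ Irr G, cod G χ = d}

noncomputable def codMult (G : Type) [Group G] [Fintype G] (d : ℕ) : ℕ :=
  {χ ∈ Irr G | cod G χ = d}.ncard

def IsTk' (G : Type) [Group G] [Fintype G] (k : ℕ) : Prop :=
  ∃ d₀ ∈ codSet G, codMult G d₀ = k ∧ ∀ d ∈ codSet G, d ≠ d₀ → codMult G d = 1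

namespace TwistedRep

open Module

/-- Irreducibility, phrased through invariant submodules. -/
def Irred {Γ : Type} [Group Γ] {V : Type} [AddCommGroup V] [Module ℂ V]
    (ρ : Representation ℂ Γ V) : Prop :=
  Nontrivial V ∧ ∀ U : Submodule ℂ V, (∀ g, ∀ u ∈ U, ρ g u ∈ U) → U = ⊥ ∨ U = ⊤

/-- Equivalence of representations. -/
def Isom {Γ : Type} [Group Γ] {V W : Type} [AddCommGroup V] [Module ℂ V]
    [AddCommGroup W] [Module ℂ W]
    (ρ : Representation ℂ Γ V) (σ : Representation ℂ Γ W) : Prop :=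
  ∃ e : V ≃ₗ[ℂ] W, ∀ g v, e (ρ g v) = σ g (e v)

/-- `N` acts through the scalars `μ`. -/
def Over {Γ : Type} [Group Γ] (N : Subgroup Γ) (μ : Γ → ℂ) {V : Type} [AddCommGroup V]
    [Module ℂ V] (ρ : Representation ℂ Γ V) : Prop :=
  ∀ n ∈ N, ∀ v, ρ n v = μ n • v

/-- `μ` restricts to a linear character of `N`. -/
structure LinChar {Γ : Type} [Group Γ] (N : Subgroup Γ) (μ : Γ → ℂ) : Prop where
  one : μ 1 = 1
  mul : ∀ a ∈ N, ∀ b ∈ N, μ (a * b) = μ a * μ b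

/-- `μ` restricts to a `Γ`-invariant linear character of `N`. -/
structure InvChar {Γ : Type} [Group Γ] (N : Subgroup Γ) (μ : Γ → ℂ) : Prop
    extends LinChar N μ where
  conj : ∀ g, ∀ a ∈ N, μ (g * a * g⁻¹) = μ a

/-- Irreducible representations over `μ` are determined by their dimension. -/
def DegreesDistinct (Γ : Type) [Group Γ] (N : Subgroup Γ) (μ : Γ → ℂ) : Prop :=
  ∀ (V W : Type) [AddCommGroup V] [Module ℂ V] [FiniteDimensional ℂ V]
    [AddCommGroup W] [Module ℂ W] [FiniteDimensional ℂ W]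
    (ρ : Representation ℂ Γ V) (σ : Representation ℂ Γ W),
    Irred ρ → Irred σ → Over N μ ρ → Over N μ σ → finrank ℂ V = finrank ℂ W → Isom ρ σ

section Basic

variable {Γ : Type} [Group Γ] {V W : Type} [AddCommGroup V] [Module ℂ V]
    [AddCommGroup W] [Module ℂ W]

theorem LinChar.ne_zero {N : Subgroup Γ} {μ : Γ → ℂ} (h : LinChar N μ) {n : Γ} (hn : n ∈ N) :
    μ n ≠ 0 := by
  intro h0
  have := h.mul n hn n⁻¹ (N.inv_mem hn)
  rw [mul_inv_cancel, h.one, h0, zero_mul] at this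
  exact one_ne_zero this

theorem LinChar.inv {N : Subgroup Γ} {μ : Γ → ℂ} (h : LinChar N μ) {n : Γ} (hn : n ∈ N) :
    μ n⁻¹ = (μ n)⁻¹ := by
  have := h.mul n hn n⁻¹ (N.inv_mem hn)
  rw [mul_inv_cancel, h.one] at this
  exact eq_inv_of_mul_eq_one_right this.symm

theorem LinChar.pow {N : Subgroup Γ} {μ : Γ → ℂ} (h : LinChar N μ) {n : Γ} (hn : n ∈ N) (k : ℕ) :
    μ (n ^ k) = μ n ^ k := by
  induction k with
  | zero => simp [h.one]
  | succ k ih => rw [pow_succ, h.mul _ (N.pow_mem hn k) _ hn, ih, pow_succ]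

theorem rep_mul_apply (ρ : Representation ℂ Γ V) (g h : Γ) (v : V) :
    ρ (g * h) v = ρ g (ρ h v) := by
  rw [map_mul]; rfl

theorem Isom.symm {ρ : Representation ℂ Γ V} {σ : Representation ℂ Γ W} (h : Isom ρ σ) :
    Isom σ ρ := by
  obtain ⟨e, he⟩ := h
  exact ⟨e.symm, fun g w => by rw [LinearEquiv.symm_apply_eq, he]; simp⟩

/-- Restriction of a representation to an invariant submodule. -/
def subRep (ρ : Representation ℂ Γ V) (U : Submodule ℂ V) (h : ∀ g, ∀ u ∈ U, ρ g u ∈ U) :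
    Representation ℂ Γ U where
  toFun g := (ρ g).restrict (h g)
  map_one' := by ext; simp
  map_mul' g g' := by ext; simp

theorem Irred.bijective_of_ne_zero {ρ : Representation ℂ Γ V} {σ : Representation ℂ Γ W}
    (hρ : Irred ρ) (hσ : Irred σ) (f : V →ₗ[ℂ] W) (hf : ∀ g v, f (ρ g v) = σ g (f v))
    (h0 : f ≠ 0) : Function.Bijective f := by
  constructor
  · rw [← LinearMap.ker_eq_bot]
    refine (hρ.2 (LinearMap.ker f) fun g u hu => ?_).resolve_right fun h => h0 ?_
    · rw [LinearMap.mem_ker] at *; rw [hf, hu, map_zero]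
    · exact LinearMap.ker_eq_top.1 h
  · rw [← LinearMap.range_eq_top]
    refine (hσ.2 (LinearMap.range f) fun g u hu => ?_).resolve_left fun h => h0 ?_
    · obtain ⟨v, rfl⟩ := hu
      exact ⟨ρ g v, hf g v⟩
    · exact LinearMap.range_eq_bot.1 h

theorem Irred.isom_of_ne_zero {ρ : Representation ℂ Γ V} {σ : Representation ℂ Γ W}
    (hρ : Irred ρ) (hσ : Irred σ) (f : V →ₗ[ℂ] W) (hf : ∀ g v, f (ρ g v) = σ g (f v))
    (h0 : f ≠ 0) : Isom ρ σ :=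
  ⟨LinearEquiv.ofBijective f (hρ.bijective_of_ne_zero hσ f hf h0), fun g v => hf g v⟩

/-- Schur's lemma. -/
theorem Irred.scalar_of_commute [FiniteDimensional ℂ V] {ρ : Representation ℂ Γ V}
    (hρ : Irred ρ) (f : V →ₗ[ℂ] V) (hf : ∀ g v, f (ρ g v) = ρ g (f v)) :
    ∃ c : ℂ, ∀ v, f v = c • v := by
  have := hρ.1
  obtain ⟨c, hc⟩ := Module.End.exists_eigenvalue f
  refine ⟨c, ?_⟩
  have := (hρ.2 (Module.End.eigenspace f c) fun g u hu => ?_).resolve_left hc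
  · intro v
    have hv : v ∈ Module.End.eigenspace f c := this ▸ Submodule.mem_top
    exact Module.End.mem_eigenspace_iff.1 hv
  · rw [Module.End.mem_eigenspace_iff] at *
    rw [hf, hu, map_smul]

theorem exists_irred_sub [FiniteDimensional ℂ V] (ρ : Representation ℂ Γ V)
    (U : Submodule ℂ V) (hU : ∀ g, ∀ u ∈ U, ρ g u ∈ U) (h0 : U ≠ ⊥) :
    ∃ (U' : Submodule ℂ V) (h : ∀ g, ∀ u ∈ U', ρ g u ∈ U'), U' ≤ U ∧ Irred (subRep ρ U' h) := by
  induction hd : finrank ℂ U using Nat.strong_induction_on generalizing U with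
  | _ d ih =>
  subst hd
  by_cases hirr : Irred (subRep ρ U hU)
  · exact ⟨U, hU, le_rfl, hirr⟩
  · have hnt : Nontrivial U := Submodule.nontrivial_iff_ne_bot.2 h0
    simp only [Irred, hnt, true_and, not_forall, not_or] at hirr
    obtain ⟨X, hX, hXb, hXt⟩ := hirr
    have hlt : X.map U.subtype < U := by
      refine lt_of_le_of_ne (Submodule.map_subtype_le U X) fun h => hXt ?_
      apply Submodule.map_injective_of_injective U.injective_subtype
      rw [h, Submodule.map_top, Submodule.range_subtype]
    obtain ⟨U', h', hle, hi⟩ := ih _ (Submodule.finrank_lt_finrank_of_lt hlt) (X.map U.subtype)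
      (by
        rintro g _ ⟨x, hx, rfl⟩
        exact ⟨_, hX g x hx, rfl⟩)
      (by
        intro h
        refine hXb (Submodule.map_injective_of_injective U.injective_subtype ?_)
        rw [h, Submodule.map_bot]) rfl
    exact ⟨U', h', hle.trans hlt.le, hi⟩

/-- Orbits of a nonzero vector span an irreducible representation. -/
theorem Irred.span_orbit {ρ : Representation ℂ Γ V} (hρ : Irred ρ) {v : V} (hv : v ≠ 0) :
    Submodule.span ℂ (Set.range fun g => ρ g v) = ⊤ := by
  refine (hρ.2 _ fun g u hu => ?_).resolve_left fun h => hv ?_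
  · have : Submodule.span ℂ (Set.range fun g => ρ g v) ≤
        (Submodule.span ℂ (Set.range fun g => ρ g v)).comap (ρ g) := by
      rw [Submodule.span_le]
      rintro _ ⟨x, rfl⟩
      exact Submodule.subset_span ⟨g * x, by simp⟩
    exact this hu
  · have : ρ 1 v ∈ Submodule.span ℂ (Set.range fun g => ρ g v) := Submodule.subset_span ⟨1, rfl⟩
    rw [h] at this
    simpa using this

theorem Irred.toIsIrreducible {ρ : Representation ℂ Γ V} (hρ : Irred ρ) : ρ.IsIrreducible := by
  have := hρ.1
  refine { exists_pair_ne := ⟨⊥, ⊤, fun h => ?_⟩, eq_bot_or_eq_top := fun U => ?_ }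
  · have := congrArg Subrepresentation.toSubmodule h
    exact bot_ne_top this
  · rcases hρ.2 U.toSubmodule (fun g u hu => U.apply_mem_toSubmodule g hu) with h | h
    · left; exact Subrepresentation.toSubmodule_injective h
    · right; exact Subrepresentation.toSubmodule_injective h

theorem isom_iff_nonempty_equiv {ρ : Representation ℂ Γ V} {σ : Representation ℂ Γ W} :
    Isom ρ σ ↔ Nonempty (ρ.Equiv σ) := by
  constructor
  · rintro ⟨e, he⟩
    exact ⟨Representation.Equiv.mk e (fun g => by ext v; exact he g v)⟩
  · rintro ⟨e⟩
    exact ⟨e.toLinearEquiv, fun g v => e.toIntertwiningMap.isIntertwining _ _ g v⟩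

open scoped Classical in
theorem Irred.char_orthonormal [Fintype Γ] [FiniteDimensional ℂ V] [FiniteDimensional ℂ W]
    {ρ : Representation ℂ Γ V} {σ : Representation ℂ Γ W} (hρ : Irred ρ) (hσ : Irred σ) :
    ∑ g : Γ, ρ.character g * σ.character g⁻¹ =
      if Isom ρ σ then (Nat.card Γ : ℂ) else 0 := by
  have := hρ.toIsIrreducible
  have := hσ.toIsIrreducible
  have hc : (Nat.card Γ : ℂ) ≠ 0 := by simp
  have : Invertible (Nat.card Γ : ℂ) := invertibleOfNonzero hc
  have h := Representation.char_orthonormal ρ σ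
  have h2 : Isom ρ σ ↔ Nonempty (σ.Equiv ρ) := by
    rw [← isom_iff_nonempty_equiv]; exact ⟨Isom.symm, Isom.symm⟩
  simp only [h2]
  rw [inv_mul_eq_iff_eq_mul₀ hc] at h
  rw [h]; split_ifs <;> simp

theorem Irred.isom_of_character_eq [Finite Γ] [FiniteDimensional ℂ V] [FiniteDimensional ℂ W]
    {ρ : Representation ℂ Γ V} {σ : Representation ℂ Γ W} (hρ : Irred ρ) (hσ : Irred σ)
    (h : ρ.character = σ.character) : Isom ρ σ := by
  classical
  have := Fintype.ofFinite Γ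
  have h1 := hρ.char_orthonormal hσ
  have h2 := hσ.char_orthonormal hσ
  rw [h, h2, if_pos ⟨LinearEquiv.refl _ _, fun _ _ => rfl⟩] at h1
  by_contra hn
  rw [if_neg hn] at h1
  simp at h1

end Basic

section Induced

variable {Γ : Type} [Group Γ] {S : Subgroup Γ} {U : Type} [AddCommGroup U] [Module ℂ U]

/-- The space of functions carrying the representation induced from `S`. -/
def indSpace (σ : Representation ℂ S U) : Submodule ℂ (Γ → U) where
  carrier := {f | ∀ (s : S) (g : Γ), f (s * g) = σ s (f g)}
  add_mem' hf hg s g := by simp [hf s g, hg s g]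
  zero_mem' s g := by simp
  smul_mem' c f hf s g := by simp [hf s g]

/-- The representation induced from `S`, by right translation. -/
def indRep (σ : Representation ℂ S U) : Representation ℂ Γ (indSpace σ) where
  toFun x :=
    { toFun f := ⟨fun g => f.1 (g * x), fun s g => by
        simpa [mul_assoc] using f.2 s (g * x)⟩
      map_add' _ _ := rfl
      map_smul' _ _ := rfl }
  map_one' := by ext f g; simp
  map_mul' x y := by ext f g; simp [mul_assoc]

@[simp] theorem indRep_apply (σ : Representation ℂ S U) (x : Γ) (f : indSpace σ) (g : Γ) :
    (indRep σ x f).1 g = f.1 (g * x) := rfl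

open scoped Classical in
/-- The functions in the induced space supported on `S`. -/
noncomputable def indDelta (σ : Representation ℂ S U) : U →ₗ[ℂ] indSpace σ where
  toFun u := ⟨fun g => if h : g ∈ S then σ ⟨g, h⟩ u else 0, fun s g => by
    beta_reduce
    by_cases h : g ∈ S
    · have h' : (s : Γ) * g ∈ S := S.mul_mem s.2 h
      rw [dif_pos h, dif_pos h', ← rep_mul_apply]; rfl
    · have h' : (s : Γ) * g ∉ S := fun h' => h ((S.mul_mem_cancel_left s.2).1 h')
      rw [dif_neg h, dif_neg h', map_zero]⟩
  map_add' u v := by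
    ext g; by_cases h : g ∈ S <;> simp [h]
  map_smul' c v := by
    ext g; by_cases h : g ∈ S <;> simp [h]

theorem indDelta_of_mem (σ : Representation ℂ S U) (u : U) {g : Γ} (h : g ∈ S) :
    (indDelta σ u).1 g = σ ⟨g, h⟩ u := dif_pos h

theorem indDelta_of_not_mem (σ : Representation ℂ S U) (u : U) {g : Γ} (h : g ∉ S) :
    (indDelta σ u).1 g = 0 := dif_neg h

theorem indDelta_one (σ : Representation ℂ S U) (u : U) : (indDelta σ u).1 1 = u := by
  rw [indDelta_of_mem σ u S.one_mem]
  exact LinearMap.congr_fun (map_one σ) u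

theorem indDelta_equivariant (σ : Representation ℂ S U) (s : S) (u : U) :
    indDelta σ (σ s u) = indRep σ s (indDelta σ u) := by
  ext g
  rw [indRep_apply]
  by_cases h : g ∈ S
  · rw [indDelta_of_mem _ _ h, indDelta_of_mem _ _ (S.mul_mem h s.2), ← rep_mul_apply]; rfl
  · rw [indDelta_of_not_mem _ _ h,
      indDelta_of_not_mem _ _ fun h' => h ((S.mul_mem_cancel_right s.2).1 h')]

theorem finrank_indSpace [Finite Γ] [FiniteDimensional ℂ U] (σ : Representation ℂ S U) :
    finrank ℂ (indSpace σ) = S.index * finrank ℂ U := by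
  classical
  have := Fintype.ofFinite (Γ ⧸ S)
  have hmem : ∀ g : Γ, g * (QuotientGroup.mk g⁻¹ : Γ ⧸ S).out ∈ S := fun g => by
    have h := QuotientGroup.eq.1 (QuotientGroup.out_eq' (QuotientGroup.mk g⁻¹ : Γ ⧸ S)).symm
    simpa using h
  let e : indSpace σ ≃ₗ[ℂ] (Γ ⧸ S → U) :=
    { toFun f q := f.1 q.out⁻¹
      map_add' _ _ := rfl
      map_smul' _ _ := rfl
      invFun u := ⟨fun g => σ ⟨_, hmem g⟩ (u (QuotientGroup.mk g⁻¹)), fun s g => by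
        have hq : (QuotientGroup.mk ((s : Γ) * g)⁻¹ : Γ ⧸ S) = QuotientGroup.mk g⁻¹ := by
          rw [QuotientGroup.eq]; simp
        beta_reduce
        rw [← rep_mul_apply]
        have : (⟨_, hmem (s * g)⟩ : S) = s * ⟨_, hmem g⟩ := by
          ext; simp [mul_assoc]
        rw [this, hq]⟩
      left_inv f := by
        ext g
        simp only
        rw [← f.2]
        simp
      right_inv u := by
        ext q
        simp only
        have hq : (QuotientGroup.mk (q.out⁻¹)⁻¹ : Γ ⧸ S) = q := by simp
        have h1 : (⟨_, hmem q.out⁻¹⟩ : S) = 1 := by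
          ext; simp
        rw [h1, hq]; simp }
  rw [e.finrank_eq, Module.finrank_pi_fintype, Finset.sum_const, Subgroup.index,
    Nat.card_eq_fintype_card, Finset.card_univ, smul_eq_mul]

instance [Finite Γ] [FiniteDimensional ℂ U] (σ : Representation ℂ S U) :
    FiniteDimensional ℂ (indSpace σ) := by
  have := Fintype.ofFinite Γ
  infer_instance

end Induced

section Clifford

variable {Γ : Type} [Group Γ] {S : Subgroup Γ} {U : Type} [AddCommGroup U] [Module ℂ U]
  {M : Subgroup Γ} [hMn : M.Normal] {μ : Γ → ℂ}

theorem indSpace_apply_mul (hMS : M ≤ S) {σ : Representation ℂ S U}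
    (hσ : Over (M.subgroupOf S) (fun s => μ s) σ) (f : indSpace σ) (g : Γ) {m : Γ} (hm : m ∈ M) :
    f.1 (g * m) = μ (g * m * g⁻¹) • f.1 g := by
  have h : g * m * g⁻¹ ∈ M := hMn.conj_mem m hm g
  have h2 := f.2 ⟨_, hMS h⟩ g
  rw [hσ _ (by simpa [Subgroup.mem_subgroupOf] using h)] at h2
  simpa using h2

theorem eq_conj_of_eigenvector (hMS : M ≤ S) {σ : Representation ℂ S U}
    (hσ : Over (M.subgroupOf S) (fun s => μ s) σ) {ν : Γ → ℂ} {f : indSpace σ}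
    (hf : ∀ m ∈ M, indRep σ m f = ν m • f) {x : Γ} (hx : f.1 x ≠ 0) {m : Γ} (hm : m ∈ M) :
    ν m = μ (x * m * x⁻¹) := by
  have h1 := indSpace_apply_mul hMS hσ f x hm
  have h2 := congrArg (fun f => f.1 x) (hf m hm)
  simp only [indRep_apply, h1] at h2
  exact (smul_left_injective ℂ hx h2).symm

theorem indRep_indDelta (hMS : M ≤ S) {σ : Representation ℂ S U}
    (hinv : ∀ s ∈ S, ∀ m ∈ M, μ (s * m * s⁻¹) = μ m)
    (hσ : Over (M.subgroupOf S) (fun s => μ s) σ) (u : U) {m : Γ} (hm : m ∈ M) :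
    indRep σ m (indDelta σ u) = μ m • indDelta σ u := by
  ext g
  rw [indRep_apply, indSpace_apply_mul hMS hσ _ g hm]
  by_cases h : g ∈ S
  · rw [hinv g h m hm]; rfl
  · change _ = μ m • (indDelta σ u).1 g
    rw [indDelta_of_not_mem _ _ h, smul_zero, smul_zero]

theorem sum_linChar_conj [Fintype M] (hμ : LinChar M μ) {g : Γ}
    (hg : ¬ ∀ m ∈ M, μ (g * m * g⁻¹) = μ m) :
    ∑ m : M, (μ m)⁻¹ * μ (g * m * g⁻¹) = 0 := by
  let θ : M →* ℂ :=
    { toFun m := (μ m)⁻¹ * μ (g * m * g⁻¹)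
      map_one' := by simp [hμ.one]
      map_mul' a b := by
        have h1 := hμ.mul a a.2 b b.2
        have h2 := hμ.mul _ (hMn.conj_mem a a.2 g) _ (hMn.conj_mem b b.2 g)
        have h3 : g * (a * b : M) * g⁻¹ = g * a * g⁻¹ * (g * b * g⁻¹) := by simp
        rw [h3, h2, Subgroup.coe_mul, h1, mul_inv]; ring }
  refine sum_hom_units_eq_zero θ fun h => hg fun m hm => ?_
  have h2 : (μ m)⁻¹ * μ (g * m * g⁻¹) = 1 := DFunLike.congr_fun h (⟨m, hm⟩ : M)
  rwa [inv_mul_eq_one₀ (hμ.ne_zero hm), eq_comm] at h2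

theorem irred_indRep [Finite Γ] (hμ : LinChar M μ) (hMS : M ≤ S)
    (hS : ∀ g, g ∈ S ↔ ∀ m ∈ M, μ (g * m * g⁻¹) = μ m)
    {σ : Representation ℂ S U} (hirr : Irred σ)
    (hσ : Over (M.subgroupOf S) (fun s => μ s) σ) : Irred (indRep σ) := by
  classical
  have := Fintype.ofFinite Γ
  have := hirr.1
  constructor
  · obtain ⟨u, hu⟩ := exists_ne (0 : U)
    refine ⟨indDelta σ u, 0, fun h => hu ?_⟩
    rw [← indDelta_one σ u, h]; rfl
  · intro X hX
    by_cases hb : X = ⊥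
    · exact Or.inl hb
    right
    obtain ⟨f, hf, hf0⟩ := Submodule.exists_mem_ne_zero_of_ne_bot hb
    obtain ⟨g₀, hg₀⟩ : ∃ g, f.1 g ≠ 0 := by
      by_contra! h
      exact hf0 (Subtype.ext (funext h))
    have key : ∀ u, indDelta σ u ∈ X := by
      have hY := hirr.2 (X.comap (indDelta σ)) fun s u hu => by
        rw [Submodule.mem_comap] at *
        rw [indDelta_equivariant]
        exact hX _ _ hu
      have htop := hY.resolve_left fun h => ?_
      · intro u
        have : u ∈ X.comap (indDelta σ) := htop ▸ Submodule.mem_top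
        exact this
      · let h₁ := indRep σ g₀ f
        let e := ∑ m : M, (μ m)⁻¹ • indRep σ m h₁
        have he : e ∈ X := Submodule.sum_mem _ fun m _ =>
          X.smul_mem _ (hX _ _ (hX _ _ hf))
        have hev : ∀ g, e.1 g = (∑ m : M, (μ m)⁻¹ * μ (g * m * g⁻¹)) • h₁.1 g := fun g => by
          simp only [e, Finset.sum_smul]
          rw [Submodule.coe_sum, Finset.sum_apply]
          refine Finset.sum_congr rfl fun m _ => ?_
          change (μ m)⁻¹ • (indRep σ m h₁).1 g = _
          rw [indRep_apply, indSpace_apply_mul hMS hσ _ g m.2, smul_smul]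
        have he1 : e.1 1 ≠ 0 := by
          rw [hev]
          have : ∑ m : M, (μ m)⁻¹ * μ (1 * m * 1⁻¹) = (Fintype.card M : ℂ) := by
            rw [← Finset.card_univ, Finset.card_eq_sum_ones, Nat.cast_sum]
            refine Finset.sum_congr rfl fun m _ => ?_
            simp [hμ.ne_zero m.2]
          rw [this]
          refine smul_ne_zero (by simp) ?_
          simpa [h₁] using hg₀
        have hed : e = indDelta σ (e.1 1) := by
          ext g
          by_cases hg : g ∈ S
          · rw [indDelta_of_mem _ _ hg, ← e.2 ⟨g, hg⟩ 1]; simp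
          · rw [indDelta_of_not_mem _ _ hg, hev, sum_linChar_conj hμ (fun h => hg ((hS g).2 h)),
              zero_smul]
        have : e.1 1 ∈ X.comap (indDelta σ) := by
          rw [Submodule.mem_comap, ← hed]; exact he
        rw [h] at this
        exact he1 (by simpa using this)
    rw [eq_top_iff]
    intro f _
    have hsum : ∑ g : Γ, indRep σ g⁻¹ (indDelta σ (f.1 g)) = (Fintype.card S : ℂ) • f := by
      ext x
      rw [Submodule.coe_sum, Finset.sum_apply]
      change ∑ g : Γ, (indRep σ g⁻¹ (indDelta σ (f.1 g))).1 x = (Fintype.card S : ℂ) • f.1 x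
      have h1 : ∀ g : Γ, (indRep σ g⁻¹ (indDelta σ (f.1 g))).1 x =
          if x * g⁻¹ ∈ S then f.1 x else 0 := fun g => by
        rw [indRep_apply]
        split_ifs with h
        · rw [indDelta_of_mem _ _ h, ← f.2]; simp
        · rw [indDelta_of_not_mem _ _ h]
      simp only [h1]
      rw [← Finset.sum_filter, Finset.sum_const, ← Nat.cast_smul_eq_nsmul ℂ]
      congr 2
      rw [← Fintype.card_subtype]
      refine Fintype.card_congr
        { toFun g := ⟨x * g.1⁻¹, g.2⟩
          invFun s := ⟨s.1⁻¹ * x, by simp⟩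
          left_inv g := by ext; simp
          right_inv s := by ext; simp }
    have hc : (Fintype.card S : ℂ) ≠ 0 := by simp
    have h2 : (Fintype.card S : ℂ) • f ∈ X := by
      rw [← hsum]
      exact Submodule.sum_mem _ fun g _ => hX _ _ (key _)
    exact (X.smul_mem_iff hc).1 h2

theorem isom_of_isom_indRep (hMS : M ≤ S)
    (hS : ∀ g, g ∈ S ↔ ∀ m ∈ M, μ (g * m * g⁻¹) = μ m)
    {U' : Type} [AddCommGroup U'] [Module ℂ U']
    {σ : Representation ℂ S U} {σ' : Representation ℂ S U'} (hirr : Irred σ) (hirr' : Irred σ')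
    (hσ : Over (M.subgroupOf S) (fun s => μ s) σ) (hσ' : Over (M.subgroupOf S) (fun s => μ s) σ')
    (h : Isom (indRep σ) (indRep σ')) : Isom σ σ' := by
  obtain ⟨e, he⟩ := h
  have hinv : ∀ s ∈ S, ∀ m ∈ M, μ (s * m * s⁻¹) = μ m := fun s hs => (hS s).1 hs
  let φ : U →ₗ[ℂ] U' :=
    (LinearMap.proj 1 ∘ₗ (indSpace σ').subtype) ∘ₗ e.toLinearMap ∘ₗ indDelta σ
  have hφ : ∀ u, φ u = (e (indDelta σ u)).1 1 := fun u => rfl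
  refine hirr.isom_of_ne_zero hirr' φ (fun s u => ?_) fun h0 => ?_
  · rw [hφ, hφ, indDelta_equivariant, he, indRep_apply, ← (e (indDelta σ u)).2 s 1]
    simp
  · have := hirr.1
    obtain ⟨u, hu⟩ := exists_ne (0 : U)
    set f := e (indDelta σ u) with hf
    have hf0 : f ≠ 0 := fun h => hu (by
      rw [← indDelta_one σ u, (LinearEquiv.map_eq_zero_iff e).1 h]; rfl)
    obtain ⟨x, hx⟩ : ∃ g, f.1 g ≠ 0 := by
      by_contra! h
      exact hf0 (Subtype.ext (funext h))
    have heig : ∀ m ∈ M, indRep σ' m f = μ m • f := fun m hm => by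
      rw [hf, ← he, indRep_indDelta hMS hinv hσ u hm, map_smul]
    have hxS : x ∈ S := (hS x).2 fun m hm => (eq_conj_of_eigenvector hMS hσ' heig hx hm).symm
    apply hx
    have h1 := f.2 ⟨x, hxS⟩ 1
    have h2 : f.1 1 = 0 := LinearMap.congr_fun h0 u
    rw [h2, map_zero] at h1
    simpa using h1

theorem conj_of_isom_indRep {S' : Subgroup Γ} {ν : Γ → ℂ} (hMS : M ≤ S) (hMS' : M ≤ S')
    (hS : ∀ g, g ∈ S ↔ ∀ m ∈ M, μ (g * m * g⁻¹) = μ m)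
    {U' : Type} [AddCommGroup U'] [Module ℂ U']
    {σ : Representation ℂ S U} {σ' : Representation ℂ S' U'} [Nontrivial U]
    (hσ : Over (M.subgroupOf S) (fun s => μ s) σ) (hσ' : Over (M.subgroupOf S') (fun s => ν s) σ')
    (h : Isom (indRep σ) (indRep σ')) : ∃ x, ∀ m ∈ M, μ m = ν (x * m * x⁻¹) := by
  obtain ⟨e, he⟩ := h
  have hinv : ∀ s ∈ S, ∀ m ∈ M, μ (s * m * s⁻¹) = μ m := fun s hs => (hS s).1 hs
  obtain ⟨u, hu⟩ := exists_ne (0 : U)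
  set f := e (indDelta σ u) with hf
  have hf0 : f ≠ 0 := fun h => hu (by
    rw [← indDelta_one σ u, (LinearEquiv.map_eq_zero_iff e).1 h]; rfl)
  obtain ⟨x, hx⟩ : ∃ g, f.1 g ≠ 0 := by
    by_contra! h
    exact hf0 (Subtype.ext (funext h))
  have heig : ∀ m ∈ M, indRep σ' m f = μ m • f := fun m hm => by
    rw [hf, ← he, indRep_indDelta hMS hinv hσ u hm, map_smul]
  exact ⟨x, fun m hm => eq_conj_of_eigenvector hMS' hσ' heig hx hm⟩

theorem over_indRep (hMS : M ≤ S) {N : Subgroup Γ} (hNM : N ≤ M) {μ₀ : Γ → ℂ} (hμ₀ : InvChar N μ₀)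
    (hext : ∀ n ∈ N, μ n = μ₀ n) [hN : N.Normal] {σ : Representation ℂ S U}
    (hσ : Over (M.subgroupOf S) (fun s => μ s) σ) : Over N μ₀ (indRep σ) := by
  intro n hn f
  ext g
  rw [indRep_apply, indSpace_apply_mul hMS hσ _ g (hNM hn), hext _ (hN.conj_mem n hn g),
    hμ₀.conj g n hn]
  rfl

/-- Degree-distinctness passes to the stabilizer of an extension of the character. -/
theorem DegreesDistinct.stabilizer [Finite Γ] {N : Subgroup Γ} [N.Normal] {μ₀ : Γ → ℂ}
    (hD : DegreesDistinct Γ N μ₀) (hμ₀ : InvChar N μ₀) (hNM : N ≤ M) (hμ : LinChar M μ)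
    (hext : ∀ n ∈ N, μ n = μ₀ n) (hMS : M ≤ S)
    (hS : ∀ g, g ∈ S ↔ ∀ m ∈ M, μ (g * m * g⁻¹) = μ m) :
    DegreesDistinct S (M.subgroupOf S) (fun s => μ s) := by
  intro U U' _ _ _ _ _ _ σ σ' hirr hirr' hσ hσ' hdim
  refine isom_of_isom_indRep hMS hS hirr hirr' hσ hσ' ?_
  refine hD _ _ _ _ (irred_indRep hμ hMS hS hirr hσ) (irred_indRep hμ hMS hS hirr' hσ')
    (over_indRep hMS hNM hμ₀ hext hσ) (over_indRep hMS hNM hμ₀ hext hσ') ?_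
  rw [finrank_indSpace, finrank_indSpace, hdim]

end Clifford

theorem linChar_subgroupOf {Γ : Type} [Group Γ] {N S : Subgroup Γ} {μ : Γ → ℂ}
    (h : LinChar N μ) : LinChar (N.subgroupOf S) (fun s => μ s) where
  one := h.one
  mul a ha b hb := h.mul a ha b hb

theorem InvChar.subgroupOf {Γ : Type} [Group Γ] {N S : Subgroup Γ} {μ : Γ → ℂ}
    (h : LinChar N μ) (hS : ∀ s ∈ S, ∀ n ∈ N, μ (s * n * s⁻¹) = μ n) :
    InvChar (N.subgroupOf S) (fun s => μ s) where
  toLinChar := linChar_subgroupOf h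
  conj s n hn := hS s s.2 n hn

theorem over_subRep {Γ : Type} [Group Γ] {N : Subgroup Γ} {μ : Γ → ℂ} {V : Type}
    [AddCommGroup V] [Module ℂ V] {ρ : Representation ℂ Γ V} (h : Over N μ ρ)
    (U : Submodule ℂ V) (hU : ∀ g, ∀ u ∈ U, ρ g u ∈ U) : Over N μ (subRep ρ U hU) :=
  fun n hn v => Subtype.ext (h n hn v)

/-- Every invariant linear character of a normal subgroup lies under an irreducible
representation. -/
theorem exists_irred_over {Γ : Type} [Group Γ] [Finite Γ] {N : Subgroup Γ} [N.Normal]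
    {μ : Γ → ℂ} (hμ : InvChar N μ) :
    ∃ (V : Type) (_ : AddCommGroup V) (_ : Module ℂ V) (_ : FiniteDimensional ℂ V)
      (ρ : Representation ℂ Γ V), Irred ρ ∧ Over N μ ρ := by
  let σ : Representation ℂ N ℂ :=
    { toFun n := μ n • LinearMap.id
      map_one' := by ext; simp [hμ.one]
      map_mul' a b := by ext; simp [hμ.mul a a.2 b b.2, mul_comm] }
  have hσ : Over (N.subgroupOf N) (fun s => μ s) σ := fun n _ v => rfl
  have hover : Over N μ (indRep σ) := over_indRep le_rfl le_rfl hμ (fun _ _ => rfl) hσ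
  have h0 : (⊤ : Submodule ℂ (indSpace σ)) ≠ ⊥ := by
    intro h
    have h1 : indDelta σ 1 ∈ (⊤ : Submodule ℂ (indSpace σ)) := Submodule.mem_top
    rw [h, Submodule.mem_bot] at h1
    have h2 := indDelta_one σ 1
    rw [h1] at h2
    exact zero_ne_one h2
  obtain ⟨U, hU, -, hirr⟩ := exists_irred_sub (indRep σ) ⊤ (fun _ _ _ => Submodule.mem_top) h0
  exact ⟨U, inferInstance, inferInstance, inferInstance, _, hirr, over_subRep hover U hU⟩

theorem Irred.exists_scalars {Γ : Type} [Group Γ] {V : Type} [AddCommGroup V] [Module ℂ V]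
    [FiniteDimensional ℂ V] {ρ : Representation ℂ Γ V} (hρ : Irred ρ)
    (hc : ∀ g h, ρ (g * h) = ρ (h * g)) :
    ∃ c : Γ → ℂ, (∀ g v, ρ g v = c g • v) ∧ c 1 = 1 ∧ ∀ g h, c (g * h) = c g * c h := by
  choose c hc' using fun g => hρ.scalar_of_commute (ρ g) fun h v => by
    rw [← rep_mul_apply, ← rep_mul_apply, hc]
  have := hρ.1
  obtain ⟨v, hv⟩ := exists_ne (0 : V)
  refine ⟨c, hc', smul_left_injective ℂ hv ?_, fun g h => smul_left_injective ℂ hv ?_⟩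
  · simp [← hc']
  · simp only [mul_smul]
    rw [← hc', rep_mul_apply, hc', hc', smul_comm]

/-- A linear character extends to `M` when the representations of `M` over it are
commutative. -/
theorem exists_extension {Γ : Type} [Group Γ] [Finite Γ] {N M : Subgroup Γ} [hN : N.Normal]
    {μ : Γ → ℂ} (hμ : InvChar N μ) (hNM : N ≤ M)
    (hcomm : ∀ (V : Type) [AddCommGroup V] [Module ℂ V] (ρ : Representation ℂ M V),
      Over (N.subgroupOf M) (fun m => μ m) ρ → ∀ g h, ρ (g * h) = ρ (h * g)) :
    ∃ ν : Γ → ℂ, LinChar M ν ∧ ∀ n ∈ N, ν n = μ n := by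
  classical
  obtain ⟨V, _, _, _, ρ, hirr, hover⟩ := exists_irred_over (N := N.subgroupOf M)
    (InvChar.subgroupOf (S := M) hμ.toLinChar fun s _ n hn => hμ.conj s n hn)
  obtain ⟨c, hc, h1, hmul⟩ := hirr.exists_scalars (hcomm V ρ hover)
  refine ⟨fun g => if h : g ∈ M then c ⟨g, h⟩ else 0, ⟨?_, ?_⟩, ?_⟩
  · rw [dif_pos M.one_mem]; exact h1
  · intro a ha b hb
    rw [dif_pos ha, dif_pos hb, dif_pos (M.mul_mem ha hb)]
    exact hmul ⟨a, ha⟩ ⟨b, hb⟩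
  · intro n hn
    beta_reduce
    rw [dif_pos (hNM hn)]
    have := hirr.1
    obtain ⟨v, hv⟩ := exists_ne (0 : V)
    refine smul_left_injective ℂ hv ?_
    simp only
    rw [← hc]
    exact hover ⟨n, hNM hn⟩ hn v

theorem commute_of_commutator {Γ : Type} [Group Γ] {N M : Subgroup Γ} {μ : Γ → ℂ}
    (hcomm : ∀ a ∈ M, ∀ b ∈ M, a * b * a⁻¹ * b⁻¹ ∈ N ∧ μ (a * b * a⁻¹ * b⁻¹) = 1)
    (V : Type) [AddCommGroup V] [Module ℂ V] (ρ : Representation ℂ M V)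
    (hρ : Over (N.subgroupOf M) (fun m => μ m) ρ) (g h : M) : ρ (g * h) = ρ (h * g) := by
  have h1 := hcomm g g.2 h h.2
  have h2 : g * h = (g * h * g⁻¹ * h⁻¹) * (h * g) := by group
  have h3 : g * h * g⁻¹ * h⁻¹ ∈ N.subgroupOf M := h1.1
  ext v
  rw [h2, rep_mul_apply, hρ _ h3]
  have : μ ((g * h * g⁻¹ * h⁻¹ : M) : Γ) = 1 := h1.2
  beta_reduce
  rw [this, one_smul]

/-- A subgroup acting by commuting operators bounds the degree by its index. -/
theorem Irred.finrank_le_index {Γ : Type} [Group Γ] [Finite Γ] {V : Type} [AddCommGroup V]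
    [Module ℂ V] [FiniteDimensional ℂ V] {ρ : Representation ℂ Γ V} (hρ : Irred ρ)
    (B : Subgroup Γ) (hB : ∀ a ∈ B, ∀ b ∈ B, ρ (a * b) = ρ (b * a)) :
    finrank ℂ V ≤ B.index := by
  classical
  have := hρ.1
  let ρB : Representation ℂ B V := ρ.comp B.subtype
  obtain ⟨U, hU, -, hirr⟩ := exists_irred_sub ρB ⊤ (fun _ _ _ => Submodule.mem_top) top_ne_bot
  obtain ⟨c, hc, -, -⟩ := hirr.exists_scalars (fun g h => by
    ext u
    exact LinearMap.congr_fun (hB g g.2 h h.2) u)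
  have := hirr.1
  obtain ⟨u, hu⟩ := exists_ne (0 : U)
  have hu' : (u : V) ≠ 0 := fun h => hu (Subtype.ext h)
  have hcu : ∀ b : B, ρ b u = c b • (u : V) := fun b => congrArg Subtype.val (hc b u)
  have := Fintype.ofFinite (Γ ⧸ B)
  have hspan : Submodule.span ℂ (Set.range fun q : Γ ⧸ B => ρ q.out u) = ⊤ := by
    rw [eq_top_iff, ← hρ.span_orbit hu', Submodule.span_le]
    rintro _ ⟨g, rfl⟩
    obtain ⟨b, hb⟩ := QuotientGroup.mk_out_eq_mul B g
    have : g = (QuotientGroup.mk g : Γ ⧸ B).out * (b⁻¹ : B) := by rw [hb]; simp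
    have h2 : ρ g u = c b⁻¹ • ρ (QuotientGroup.mk g : Γ ⧸ B).out u := by
      conv_lhs => rw [this]
      rw [rep_mul_apply, hcu, map_smul]
    simp only [SetLike.mem_coe]
    rw [h2]
    exact Submodule.smul_mem _ _ (Submodule.subset_span ⟨_, rfl⟩)
  have := finrank_range_le_card (R := ℂ) (fun q : Γ ⧸ B => ρ q.out u)
  rwa [Set.finrank, hspan, finrank_top, ← Nat.card_eq_fintype_card] at this

/-- The stabilizer of a linear character of a normal subgroup. -/
def stab {Γ : Type} [Group Γ] (M : Subgroup Γ) [hM : M.Normal] (μ : Γ → ℂ) : Subgroup Γ where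
  carrier := {g | ∀ m ∈ M, μ (g * m * g⁻¹) = μ m}
  one_mem' m _ := by simp
  mul_mem' {a b} ha hb m hm := by
    have h : a * b * m * (a * b)⁻¹ = a * (b * m * b⁻¹) * a⁻¹ := by group
    rw [h, ha _ (hM.conj_mem m hm b), hb m hm]
  inv_mem' {a} ha m hm := by
    have h := ha _ (hM.conj_mem m hm a⁻¹)
    rw [← h]; congr 1; group

theorem mem_stab {Γ : Type} [Group Γ] {M : Subgroup Γ} [M.Normal] {μ : Γ → ℂ} {g : Γ} :
    g ∈ stab M μ ↔ ∀ m ∈ M, μ (g * m * g⁻¹) = μ m := Iff.rfl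

theorem le_stab {Γ : Type} [Group Γ] {M : Subgroup Γ} [M.Normal] {μ : Γ → ℂ}
    (hμ : LinChar M μ) : M ≤ stab M μ := by
  intro g hg m hm
  have := hμ.ne_zero hg
  rw [hμ.mul _ (M.mul_mem hg hm) _ (M.inv_mem hg), hμ.mul _ hg _ hm, hμ.inv hg]
  field_simp

theorem invChar_stab {Γ : Type} [Group Γ] {M : Subgroup Γ} [M.Normal] {μ : Γ → ℂ}
    (hμ : LinChar M μ) : InvChar (M.subgroupOf (stab M μ)) (fun s => μ s) :=
  InvChar.subgroupOf hμ fun _ hs => hs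

theorem DegreesDistinct.of_stab {Γ : Type} [Group Γ] [Finite Γ] {N M : Subgroup Γ}
    [N.Normal] [M.Normal] {μ₀ μ : Γ → ℂ}
    (hD : DegreesDistinct Γ N μ₀) (hμ₀ : InvChar N μ₀) (hNM : N ≤ M) (hμ : LinChar M μ)
    (hext : ∀ n ∈ N, μ n = μ₀ n) :
    DegreesDistinct (stab M μ) (M.subgroupOf (stab M μ)) (fun s => μ s) :=
  hD.stabilizer hμ₀ hNM hμ hext (le_stab hμ) fun _ => Iff.rfl

theorem DegreesDistinct.mono {Γ : Type} [Group Γ] {N M : Subgroup Γ} {μ₀ μ : Γ → ℂ}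
    (hD : DegreesDistinct Γ N μ₀) (hNM : N ≤ M) (hext : ∀ n ∈ N, μ n = μ₀ n) :
    DegreesDistinct Γ M μ :=
  fun V W _ _ _ _ _ _ ρ σ hρ hσ hVρ hWσ => hD V W ρ σ hρ hσ
    (fun n hn v => by rw [hVρ n (hNM hn), hext n hn])
    (fun n hn v => by rw [hWσ n (hNM hn), hext n hn])

theorem exists_central_layer {Γ : Type} [Group Γ] [Finite Γ] {r : ℕ} (hr : r.Prime)
    {N : Subgroup Γ} [hN : N.Normal] {m : ℕ} (hm : m ≠ 0) (hidx : N.index = r ^ m) :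
    ∃ (M : Subgroup Γ) (n : Γ), M.Normal ∧ N ≤ M ∧ n ∈ M ∧ n ^ r ∈ N ∧
      (∀ x ∈ M, ∃ i : ℕ, ∃ a ∈ N, x = n ^ i * a) ∧
      (∀ g, ∀ x ∈ M, g * x * g⁻¹ * x⁻¹ ∈ N) ∧ r * M.index = N.index ∧
      ∃ v : Γ → ℂ, LinChar M v ∧ (∀ a ∈ N, v a = 1) ∧ v n ≠ 1 := by
  classical
  have : Fact r.Prime := ⟨hr⟩
  have hcard : Nat.card (Γ ⧸ N) = r ^ m := hidx
  have hp : IsPGroup r (Γ ⧸ N) := IsPGroup.of_card hcard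
  have : Nontrivial (Γ ⧸ N) := by
    rw [← Finite.one_lt_card_iff_nontrivial, hcard]
    exact Nat.one_lt_pow hm hr.one_lt
  have := hp.center_nontrivial
  obtain ⟨l, hl0, hl⟩ := (hp.to_subgroup (Subgroup.center (Γ ⧸ N))).nontrivial_iff_card.1 this
  obtain ⟨⟨x, hxc⟩, hx⟩ := exists_prime_orderOf_dvd_card' (G := Subgroup.center (Γ ⧸ N)) r
    (by rw [hl]; exact dvd_pow_self r hl0.ne')
  have hxo : orderOf x = r := by rw [← hx, Subgroup.orderOf_mk]
  have hcz : ∀ y ∈ Subgroup.zpowers x, ∀ z, z * y * z⁻¹ = y := by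
    intro y hy z
    have : y ∈ Subgroup.center (Γ ⧸ N) := (Subgroup.zpowers_le.2 hxc) hy
    rw [Subgroup.mem_center_iff.1 this z]; simp
  have hzn : (Subgroup.zpowers x).Normal := ⟨fun y hy z => by rwa [hcz y hy z]⟩
  obtain ⟨n, rfl⟩ := QuotientGroup.mk_surjective x
  let Z := Subgroup.zpowers (n : Γ ⧸ N)
  let : CommGroup Z := { (inferInstance : Group Z) with
    mul_comm := fun a b => Subtype.ext <| by
      have := hcz b b.2 a
      rw [mul_inv_eq_iff_eq_mul] at this
      exact this }
  obtain ⟨φ, hφ⟩ := CommGroup.exists_apply_ne_one_of_hasEnoughRootsOfUnity Z ℂ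
    (a := ⟨(n : Γ ⧸ N), Subgroup.mem_zpowers _⟩) (by
      intro h
      have : (n : Γ ⧸ N) = 1 := congrArg Subtype.val h
      rw [this, orderOf_one] at hxo
      exact hr.one_lt.ne hxo)
  refine ⟨Z.comap (QuotientGroup.mk' N), n, hzn.comap _, ?_, ?_, ?_, ?_, ?_, ?_, ?_⟩
  · intro a ha
    rw [Subgroup.mem_comap, QuotientGroup.mk'_apply, (QuotientGroup.eq_one_iff a).2 ha]
    exact Z.one_mem
  · exact Subgroup.mem_zpowers _
  · rw [← QuotientGroup.eq_one_iff, QuotientGroup.mk_pow, ← hxo, pow_orderOf_eq_one]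
  · intro y hy
    rw [Subgroup.mem_comap, ← mem_powers_iff_mem_zpowers] at hy
    obtain ⟨i, hi⟩ := hy
    refine ⟨i, (n ^ i)⁻¹ * y, ?_, by group⟩
    rw [← QuotientGroup.eq, QuotientGroup.mk_pow]
    exact hi
  · intro g y hy
    rw [← QuotientGroup.eq_one_iff]
    have := hcz _ hy g
    simp only [QuotientGroup.mk'_apply] at this
    rw [QuotientGroup.mk_mul, QuotientGroup.mk_mul, QuotientGroup.mk_mul, QuotientGroup.mk_inv,
      QuotientGroup.mk_inv, this, mul_inv_cancel]
  · rw [Subgroup.index_comap_of_surjective _ (QuotientGroup.mk'_surjective N), ← hxo,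
      ← Nat.card_zpowers, Subgroup.card_mul_index]
    rfl
  · refine ⟨fun g => if h : (g : Γ ⧸ N) ∈ Z then (φ ⟨g, h⟩ : ℂ) else 0, ⟨?_, ?_⟩, ?_, ?_⟩
    · have h1 : ((1 : Γ) : Γ ⧸ N) ∈ Z := Z.one_mem
      rw [dif_pos h1]
      have : (⟨((1 : Γ) : Γ ⧸ N), h1⟩ : Z) = 1 := rfl
      rw [this, map_one]; rfl
    · intro a ha b hb
      have ha' : (a : Γ ⧸ N) ∈ Z := ha
      have hb' : (b : Γ ⧸ N) ∈ Z := hb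
      have hab : ((a * b : Γ) : Γ ⧸ N) ∈ Z := Z.mul_mem ha hb
      rw [dif_pos ha', dif_pos hb', dif_pos hab]
      have : (⟨((a * b : Γ) : Γ ⧸ N), hab⟩ : Z) = ⟨a, ha'⟩ * ⟨b, hb'⟩ := rfl
      rw [this, map_mul]; rfl
    · intro a ha
      have h1 := (QuotientGroup.eq_one_iff a).2 ha
      have h2 : (a : Γ ⧸ N) ∈ Z := by rw [h1]; exact Z.one_mem
      beta_reduce
      rw [dif_pos h2]
      have : (⟨(a : Γ ⧸ N), h2⟩ : Z) = 1 := Subtype.ext h1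
      rw [this, map_one]; rfl
    · beta_reduce
      rw [dif_pos (Subgroup.mem_zpowers _)]
      intro h
      exact hφ (Units.ext h)

theorem LinChar.mul' {Γ : Type} [Group Γ] {M : Subgroup Γ} {μ v : Γ → ℂ} (hμ : LinChar M μ)
    (hv : LinChar M v) : LinChar M (fun g => μ g * v g) where
  one := by simp [hμ.one, hv.one]
  mul a ha b hb := by
    rw [hμ.mul a ha b hb, hv.mul a ha b hb]; ring

/-- The degree-distinct situation over a normal subgroup of prime-power index is fully
ramified. -/
theorem DegreesDistinct.fully_ramified {r : ℕ} (hr : r.Prime) (m : ℕ) :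
    ∀ {Γ : Type} [Group Γ] [Finite Γ] {N : Subgroup Γ} [N.Normal] {μ : Γ → ℂ},
      InvChar N μ → DegreesDistinct Γ N μ → N.index = r ^ m →
      ∃ c, N.index = r ^ (2 * c) ∧
        ∃ (V : Type) (_ : AddCommGroup V) (_ : Module ℂ V) (_ : FiniteDimensional ℂ V)
          (ρ : Representation ℂ Γ V), Irred ρ ∧ Over N μ ρ ∧ finrank ℂ V = r ^ c := by
  induction m using Nat.strong_induction_on with
  | _ m ih =>
  intro Γ _ _ N hN μ hμ hD hidx
  rcases Nat.eq_zero_or_pos m with rfl | hm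
  · refine ⟨0, hidx, ?_⟩
    obtain ⟨V, i1, i2, i3, ρ, hirr, hover⟩ := exists_irred_over hμ
    refine ⟨V, i1, i2, i3, ρ, hirr, hover, le_antisymm ?_ ?_⟩
    · have hle := hirr.finrank_le_index N fun a ha b hb => by
        ext v
        rw [hover _ (N.mul_mem ha hb), hover _ (N.mul_mem hb ha), hμ.mul a ha b hb,
          hμ.mul b hb a ha, mul_comm]
      rwa [hidx] at hle
    · have := hirr.1
      rw [pow_zero]
      exact finrank_pos (R := ℂ) (M := V)
  obtain ⟨M, n, hM, hNM, hnM, hnr, hgen, hcen, hMidx, v, hv, hvN, hvn⟩ :=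
    exists_central_layer hr hm.ne' hidx
  have hMm : M.index = r ^ (m - 1) := by
    obtain ⟨k, rfl⟩ : ∃ k, m = k + 1 := ⟨m - 1, by omega⟩
    rw [hidx, pow_succ'] at hMidx
    exact Nat.eq_of_mul_eq_mul_left hr.pos hMidx
  obtain ⟨ν, hν, hνN⟩ := exists_extension hμ hNM fun V _ _ ρ hρ g h => by
    obtain ⟨i, a, ha, hg⟩ := hgen g g.2
    obtain ⟨j, b, hb, hh⟩ := hgen h h.2
    have hg' : g = ⟨n, hnM⟩ ^ i * ⟨a, hNM ha⟩ := Subtype.ext hg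
    have hh' : h = ⟨n, hnM⟩ ^ j * ⟨b, hNM hb⟩ := Subtype.ext hh
    have key : ∀ (i j : ℕ) (a b : Γ) (ha : a ∈ N) (hb : b ∈ N) (w : V),
        ρ (⟨n, hnM⟩ ^ i * ⟨a, hNM ha⟩ * (⟨n, hnM⟩ ^ j * ⟨b, hNM hb⟩)) w =
        (μ a * μ b) • ρ (⟨n, hnM⟩ ^ (i + j)) w := by
      intro i j a b ha hb w
      rw [rep_mul_apply, rep_mul_apply, rep_mul_apply, hρ ⟨b, _⟩ hb, map_smul, map_smul, map_smul,
        hρ ⟨a, _⟩ ha, map_smul, smul_smul, pow_add, rep_mul_apply, mul_comm]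
    ext w
    rw [hg', hh', key i j a b ha hb, key j i b a hb ha, mul_comm, add_comm]
  let f : Γ →* ℂ :=
    { toFun g := ν (g * n * g⁻¹ * n⁻¹)
      map_one' := by simp [hν.one]
      map_mul' g h := by
        have h1 := hcen g n hnM
        have h2 := hcen h n hnM
        have h3 : g * h * n * (g * h)⁻¹ * n⁻¹ =
            g * (h * n * h⁻¹ * n⁻¹) * g⁻¹ * (g * n * g⁻¹ * n⁻¹) := by group
        rw [h3, hν.mul _ (hNM (hN.conj_mem _ h2 g)) _ (hNM h1), hνN _ (hN.conj_mem _ h2 g),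
          hμ.conj g _ h2, hνN _ h2, mul_comm] }
  have hfn : ∀ g, ν (g * n * g⁻¹) = f g * ν n := fun g => by
    have := hν.mul _ (hNM (hcen g n hnM)) n hnM
    refine Eq.trans ?_ this
    congr 1; group
  have hfker : ∀ g, g ∈ stab M ν ↔ f g = 1 := by
    intro g
    constructor
    · intro h
      have h1 := hfn g
      rw [h n hnM] at h1
      exact (mul_eq_right₀ (hν.ne_zero hnM)).1 h1.symm
    · intro h x hx
      obtain ⟨i, a, ha, rfl⟩ := hgen x hx
      have h1 : g * (n ^ i * a) * g⁻¹ = (g * n * g⁻¹) ^ i * (g * a * g⁻¹) := by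
        rw [conj_pow]; group
      have hgn : g * n * g⁻¹ ∈ M := hM.conj_mem n hnM g
      rw [h1, hν.mul _ (M.pow_mem hgn i) _ (hNM (hN.conj_mem a ha g)), hν.pow hgn, hfn, h, one_mul,
        hν.mul _ (M.pow_mem hnM i) _ (hNM ha), hν.pow hnM, hνN _ (hN.conj_mem a ha g),
        hμ.conj g a ha, hνN a ha]
  have hfr : ∀ g, f g ^ r = 1 := by
    intro g
    have hgn : g * n * g⁻¹ ∈ M := hM.conj_mem n hnM g
    have h1 : ν ((g * n * g⁻¹) ^ r) = ν (n ^ r) := by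
      rw [conj_pow, hνN _ (hN.conj_mem _ hnr g), hμ.conj g _ hnr, hνN _ hnr]
    rw [hν.pow hgn, hfn, hν.pow hnM, mul_pow] at h1
    exact (mul_eq_right₀ (pow_ne_zero r (hν.ne_zero hnM))).1 h1
  have hstab : stab M ν = f.toHomUnits.ker := by
    ext g
    rw [hfker, MonoidHom.mem_ker, Units.ext_iff]; rfl
  have hdvd : (stab M ν).index ∣ r := by
    rw [hstab, Subgroup.index_ker]
    have : NeZero r := ⟨hr.ne_zero⟩
    rw [← Complex.card_rootsOfUnity r]
    refine Subgroup.card_dvd_of_le ?_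
    rintro _ ⟨g, rfl⟩
    rw [mem_rootsOfUnity, Units.ext_iff]
    exact hfr g
  rcases (Nat.dvd_prime hr).1 hdvd with h1 | hindex
  · exfalso
    have htop : stab M ν = ⊤ := Subgroup.index_eq_one.1 h1
    have hνinv : InvChar M ν := ⟨hν, fun g a ha => by
      have : g ∈ stab M ν := htop ▸ Subgroup.mem_top g
      exact this a ha⟩
    have hνv : InvChar M (fun g => ν g * v g) := ⟨hν.mul' hv, fun g a ha => by
      have h1 : v (g * a * g⁻¹) = v a := by
        have h2 := hv.mul _ (hNM (hcen g a ha)) a ha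
        rw [hvN _ (hcen g a ha), one_mul] at h2
        rw [← h2]; congr 1; group
      rw [hνinv.conj g a ha, h1]⟩
    obtain ⟨c, hc, V, _, _, _, ρ, hρ, hρo, hρd⟩ := ih (m - 1) (by omega) hνinv
      (hD.mono hNM hνN) hMm
    obtain ⟨c', hc', V', _, _, _, ρ', hρ', hρo', hρd'⟩ := ih (m - 1) (by omega) hνv
      (hD.mono hNM fun n hn => by rw [hνN n hn, hvN n hn, mul_one]) hMm
    have hcc : c = c' := by
      have := Nat.pow_right_injective hr.two_le (hc.symm.trans hc')
      omega
    subst hcc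
    obtain ⟨e, he⟩ := hD V V' ρ ρ' hρ hρ'
      (fun n hn w => by rw [hρo n (hNM hn), hνN n hn])
      (fun n hn w => by rw [hρo' n (hNM hn)]; beta_reduce; rw [hνN n hn, hvN n hn, mul_one])
      (hρd.trans hρd'.symm)
    have := hρ.1
    obtain ⟨w, hw⟩ := exists_ne (0 : V)
    have h2 := he n w
    rw [hρo n hnM, hρo' n hnM, map_smul] at h2
    have h3 := smul_left_injective ℂ ((LinearEquiv.map_ne_zero_iff e).2 hw) h2
    exact hvn ((mul_eq_left₀ (hν.ne_zero hnM)).1 h3.symm)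
  · have hle := le_stab hν
    have h2 : (M.subgroupOf (stab M ν)).index * r = r ^ (m - 1) := by
      rw [← hMm, ← Subgroup.relIndex_mul_index hle, hindex]; rfl
    have hm1 : m - 1 ≠ 0 := fun h => by
      rw [h, pow_zero] at h2
      exact hr.one_lt.ne' (Nat.eq_one_of_mul_eq_one_left h2)
    obtain ⟨k, hk⟩ : ∃ k, m = k + 2 := ⟨m - 2, by omega⟩
    have h3 : (M.subgroupOf (stab M ν)).index = r ^ k := by
      rw [hk, show k + 2 - 1 = k + 1 from rfl, pow_succ] at h2
      exact Nat.eq_of_mul_eq_mul_right hr.pos h2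
    obtain ⟨c, hc, U, _, _, _, σ, hσ, hσo, hσd⟩ := ih k (by omega) (invChar_stab hν)
      (hD.of_stab hμ hNM hν hνN) h3
    refine ⟨c + 1, ?_, indSpace σ, inferInstance, inferInstance, inferInstance, indRep σ,
      irred_indRep hν hle (fun _ => Iff.rfl) hσ hσo, over_indRep hle hNM hμ hνN hσo, ?_⟩
    · rw [hidx, hk, pow_add, ← h3, hc]; ring
    · rw [finrank_indSpace, hindex, hσd, pow_succ']

theorem coe_commute_of_commutator_mem {Γ : Type} [Group Γ] {N : Subgroup Γ} [N.Normal] {a b : Γ}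
    (h : a * b * a⁻¹ * b⁻¹ ∈ N) : Commute (a : Γ ⧸ N) (b : Γ ⧸ N) := by
  rw [← QuotientGroup.eq_one_iff] at h
  simp only [QuotientGroup.mk_mul, QuotientGroup.mk_inv] at h
  rw [mul_inv_eq_one, mul_inv_eq_iff_eq_mul] at h
  exact h

theorem exists_coe_orderOf {Γ : Type} [Group Γ] [Finite Γ] {N M : Subgroup Γ} [hN : N.Normal]
    {p : ℕ} (hp : p.Prime) (hdvd : p ∣ N.relIndex M) :
    ∃ x ∈ M, x ^ p ∈ N ∧ x ∉ N := by
  have : Fact p.Prime := ⟨hp⟩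
  obtain ⟨x, hx⟩ := exists_prime_orderOf_dvd_card' (G := M ⧸ N.subgroupOf M) p hdvd
  obtain ⟨y, rfl⟩ := QuotientGroup.mk_surjective x
  refine ⟨y, y.2, ?_, fun h => ?_⟩
  · have h2 := pow_orderOf_eq_one (y : M ⧸ N.subgroupOf M)
    rw [hx, ← QuotientGroup.mk_pow, QuotientGroup.eq_one_iff] at h2
    exact h2
  · have h2 : (y : M ⧸ N.subgroupOf M) = 1 := (QuotientGroup.eq_one_iff y).2 h
    rw [h2, orderOf_one] at hx
    exact hp.one_lt.ne hx

/-- Minimal normal subgroups over `N` give elementary abelian sections. -/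
theorem exists_minimal_normal {Γ : Type} [Group Γ] [Finite Γ] (hsol : Group.IsSolvable Γ)
    {N L : Subgroup Γ} [hN : N.Normal] (hL : L.Normal) (hNL : N < L) :
    ∃ (M : Subgroup Γ) (p : ℕ), M.Normal ∧ N < M ∧ M ≤ L ∧ p.Prime ∧
      (∀ M' : Subgroup Γ, M'.Normal → N ≤ M' → M' ≤ M → M' = N ∨ M' = M) ∧
      (∀ m ∈ M, m ^ p ∈ N) ∧ ∀ a ∈ M, ∀ b ∈ M, a * b * a⁻¹ * b⁻¹ ∈ N := by
  have hsol' : Group.IsSolvable (Γ ⧸ N) := inferInstance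
  obtain ⟨M, ⟨hMn, hNM, hML⟩, hmin⟩ := Set.Finite.exists_minimal
    (s := {M : Subgroup Γ | M.Normal ∧ N < M ∧ M ≤ L}) (Set.toFinite _) ⟨L, hL, hNL, le_rfl⟩
  have hmin' : ∀ M' : Subgroup Γ, M'.Normal → N ≤ M' → M' ≤ M → M' = N ∨ M' = M := by
    intro M' h1 h2 h3
    rcases h2.eq_or_lt with h | h
    · exact Or.inl h.symm
    · exact Or.inr (le_antisymm h3 (hmin ⟨h1, h, h3.trans hML⟩ h3))
  have hcomm : ∀ a ∈ M, ∀ b ∈ M, a * b * a⁻¹ * b⁻¹ ∈ N := by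
    rcases hmin' (N ⊔ ⁅M, M⁆) inferInstance le_sup_left
      (sup_le hNM.le (Subgroup.commutator_le_left M M)) with h | h
    · intro a ha b hb
      rw [← h]
      exact Subgroup.mem_sup_right (Subgroup.commutator_mem_commutator ha hb)
    · exfalso
      have h1 : M.map (QuotientGroup.mk' N) ≠ ⊥ := by
        intro h0
        rw [Subgroup.map_eq_bot_iff, QuotientGroup.ker_mk'] at h0
        exact hNM.not_ge h0
      have h2 := Group.IsSolvable.commutator_lt_of_ne_bot h1
      rw [← Subgroup.map_commutator] at h2
      have h3 : M.map (QuotientGroup.mk' N) = (⁅M, M⁆).map (QuotientGroup.mk' N) := by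
        conv_lhs => rw [← h]
        rw [Subgroup.map_sup]
        simp
      exact h2.ne h3.symm
  have hrel : N.relIndex M ≠ 1 := fun h => hNM.not_ge (Subgroup.relIndex_eq_one.1 h)
  obtain ⟨p, hp, hpd⟩ := Nat.exists_prime_and_dvd hrel
  obtain ⟨x, hxM, hxp, hxN⟩ := exists_coe_orderOf hp hpd
  let M' : Subgroup Γ :=
    { carrier := {m | m ∈ M ∧ m ^ p ∈ N}
      one_mem' := ⟨M.one_mem, by simp [N.one_mem]⟩
      mul_mem' := by
        rintro a b ⟨ha, ha'⟩ ⟨hb, hb'⟩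
        refine ⟨M.mul_mem ha hb, ?_⟩
        rw [← QuotientGroup.eq_one_iff, QuotientGroup.mk_pow] at ha' hb' ⊢
        rw [QuotientGroup.mk_mul, (coe_commute_of_commutator_mem (hcomm a ha b hb)).mul_pow, ha', hb',
          one_mul]
      inv_mem' := by
        rintro a ⟨ha, ha'⟩
        exact ⟨M.inv_mem ha, by rw [inv_pow]; exact N.inv_mem ha'⟩ }
  have hM'n : M'.Normal := ⟨fun a ha g => ⟨hMn.conj_mem a ha.1 g, by
    rw [conj_pow]; exact hN.conj_mem _ ha.2 g⟩⟩
  refine ⟨M, p, hMn, hNM, hML, hp, hmin', ?_, hcomm⟩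
  rcases hmin' M' hM'n (fun n hn => ⟨hNM.le hn, N.pow_mem hn p⟩) (fun m hm => hm.1) with h | h
  · exact absurd (h ▸ (show x ∈ M' from ⟨hxM, hxp⟩)) hxN
  · intro m hm
    rw [← h] at hm
    exact hm.2

/-- Values of `μ` on `N` are roots of unity of order dividing `e`. -/
def ValuesOrder {Γ : Type} [Group Γ] (N : Subgroup Γ) (μ : Γ → ℂ) (e : ℕ) : Prop :=
  ∀ n ∈ N, μ n ^ e = 1

/-- The statement that degree-distinctness forces the index of `N` to be a power of `r`. -/
def IndexClaim (r : ℕ) (Γ : Type) [Group Γ] (N : Subgroup Γ) : Prop :=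
  N.Normal → Group.IsSolvable Γ → ∀ (μ : Γ → ℂ) (k : ℕ), InvChar N μ → ValuesOrder N μ (r ^ k) →
    DegreesDistinct Γ N μ → ∃ l, N.index = r ^ l

theorem exists_pow_mul_eq_self {q e : ℕ} (h : q.Coprime e) :
    ∃ t, ∀ z : ℂ, z ^ e = 1 → z ^ (q * t) = z := by
  rcases lt_trichotomy e 1 with he | he | he
  · obtain rfl : e = 0 := by omega
    obtain rfl : q = 1 := by simpa using h
    exact ⟨1, fun z _ => by simp⟩
  · subst he
    exact ⟨1, fun z hz => by simp at hz; simp [hz]⟩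
  · obtain ⟨t, -, ht⟩ := Nat.exists_mul_mod_eq_one_of_coprime h he
    refine ⟨t, fun z hz => ?_⟩
    rw [← Nat.div_add_mod (q * t) e, ht, pow_add, pow_mul, hz]
    simp

theorem mem_of_pow_mem_of_pow_mem {Γ : Type} [Group Γ] {N : Subgroup Γ} {x : Γ} {a b : ℕ}
    (hab : a.Coprime b) (ha : x ^ a ∈ N) (hb : x ^ b ∈ N) : x ∈ N := by
  have h := Nat.gcd_eq_gcd_ab a b
  rw [hab.gcd_eq_one] at h
  have h2 : x = x ^ ((a : ℤ) * a.gcdA b + b * a.gcdB b) := by rw [← h]; simp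
  rw [h2, zpow_add, zpow_mul, zpow_mul, zpow_natCast, zpow_natCast]
  exact N.mul_mem (N.zpow_mem ha _) (N.zpow_mem hb _)

theorem pow_relIndex_mem {Γ : Type} [Group Γ] {M S : Subgroup Γ} [hM : M.Normal] {x : Γ}
    (hx : x ∈ S) : x ^ M.relIndex S ∈ M := by
  have h := pow_card_eq_one' (x := ((⟨x, hx⟩ : S) : S ⧸ M.subgroupOf S))
  rw [← QuotientGroup.mk_pow, QuotientGroup.eq_one_iff] at h
  exact h

/-- An extension of `μ` to `M` can be averaged to one fixed by a given element of order prime to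
`r` modulo `M`. -/
theorem exists_fixed_extension {Γ : Type} [Group Γ] {N M : Subgroup Γ} [hN : N.Normal]
    [hM : M.Normal] {μ ν : Γ → ℂ} (hμ : InvChar N μ) (hν : LinChar M ν)
    (hext : ∀ n ∈ N, ν n = μ n) {e e' q : ℕ} (hval : ValuesOrder N μ e)
    (hval' : ValuesOrder M ν e') (hq : q.Coprime e) {x : Γ} (hx : x ^ q ∈ M) :
    ∃ ν' : Γ → ℂ, LinChar M ν' ∧ (∀ n ∈ N, ν' n = μ n) ∧ ValuesOrder M ν' e' ∧
      x ∈ stab M ν' := by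
  obtain ⟨t, ht⟩ := exists_pow_mul_eq_self hq
  have hconj : ∀ (i : ℕ), ∀ m ∈ M, x ^ i * m * (x ^ i)⁻¹ ∈ M := fun i m hm => hM.conj_mem m hm _
  refine ⟨fun m => (∏ i ∈ Finset.range q, ν (x ^ i * m * (x ^ i)⁻¹)) ^ t, ⟨?_, ?_⟩, ?_, ?_, ?_⟩
  · simp [hν.one]
  · intro a ha b hb
    rw [← mul_pow, ← Finset.prod_mul_distrib]
    congr 1
    refine Finset.prod_congr rfl fun i _ => ?_
    rw [← hν.mul _ (hconj i a ha) _ (hconj i b hb)]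
    congr 1; group
  · intro n hn
    have h1 : ∀ i ∈ Finset.range q, ν (x ^ i * n * (x ^ i)⁻¹) = μ n := fun i _ => by
      rw [hext _ (hN.conj_mem n hn _), hμ.conj _ n hn]
    beta_reduce
    rw [Finset.prod_congr rfl h1, Finset.prod_const, Finset.card_range, ← pow_mul]
    exact ht _ (hval n hn)
  · intro m hm
    rw [← pow_mul, mul_comm, pow_mul, ← Finset.prod_pow,
      Finset.prod_eq_one fun i _ => hval' _ (hconj i m hm), one_pow]
  · intro m hm
    beta_reduce
    congr 1
    have h1 : ∀ i ∈ Finset.range q, ν (x ^ i * (x * m * x⁻¹) * (x ^ i)⁻¹)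
        = ν (x ^ (i + 1) * m * (x ^ (i + 1))⁻¹) := fun i _ => by
      congr 1; rw [pow_succ]; group
    rw [Finset.prod_congr rfl h1]
    have h2 := Finset.prod_range_succ' (fun i => ν (x ^ i * m * (x ^ i)⁻¹)) q
    rw [Finset.prod_range_succ] at h2
    have h3 : ν (x ^ q * m * (x ^ q)⁻¹) = ν m := le_stab hν hx m hm
    have h4 : ν (x ^ 0 * m * (x ^ 0)⁻¹) = ν m := by simp
    rw [h3, h4] at h2
    exact (mul_right_cancel₀ (hν.ne_zero hm) h2).symm

theorem index_eq_pow_of_commutator {r k : ℕ} (hr : r.Prime) {Γ : Type} [Group Γ] [Finite Γ]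
    (hsol : Group.IsSolvable Γ) {N M : Subgroup Γ} [hN : N.Normal] [hM : M.Normal] {μ : Γ → ℂ}
    (hμ : InvChar N μ) (hval : ValuesOrder N μ (r ^ k)) (hD : DegreesDistinct Γ N μ)
    (hNM : N < M) (hMp : ∀ m ∈ M, m ^ r ∈ N)
    (hcomm : ∀ a ∈ M, ∀ b ∈ M, a * b * a⁻¹ * b⁻¹ ∈ N ∧ μ (a * b * a⁻¹ * b⁻¹) = 1)
    (IH : ∀ (Δ : Type) [Group Δ] [Finite Δ] (L : Subgroup Δ), L.index < N.index →
      IndexClaim r Δ L) : ∃ l, N.index = r ^ l := by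
  obtain ⟨ν, hν, hext⟩ := exists_extension hμ hNM.le (commute_of_commutator hcomm)
  have hvalν : ValuesOrder M ν (r ^ (k + 1)) := by
    intro m hm
    rw [pow_succ', pow_mul, ← hν.pow hm, hext _ (hMp m hm)]
    exact hval _ (hMp m hm)
  refine ⟨_, Nat.eq_prime_pow_of_unique_prime_dvd N.index_ne_zero_of_finite fun {q} hq hqd => ?_⟩
  by_contra hne
  have hqr : q.Coprime r := (Nat.coprime_primes hq hr).2 hne
  obtain ⟨x, -, hxq, hxN⟩ := exists_coe_orderOf (N := N) (M := ⊤) hq (by rwa [Subgroup.relIndex_top_right])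
  obtain ⟨ν', hν', hext', hval', hx⟩ := exists_fixed_extension hμ hν hext hval hvalν
    (hqr.pow_right k) (hNM.le hxq)
  have hlt : (M.subgroupOf (stab M ν')).index < N.index := by
    refine lt_of_le_of_lt (Nat.le_of_dvd (Nat.pos_of_ne_zero M.index_ne_zero_of_finite)
      (Subgroup.relIndex_dvd_index_of_normal M _)) ?_
    exact Subgroup.index_strictAnti hNM
  obtain ⟨l, hl⟩ := IH _ _ hlt inferInstance inferInstance _ (k + 1) (invChar_stab hν')
    (fun n hn => hval' _ hn) (hD.of_stab hμ hNM.le hν' hext')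
  have hxl := pow_relIndex_mem (M := M) hx
  rw [Subgroup.relIndex, hl] at hxl
  have hxM : x ∈ M := mem_of_pow_mem_of_pow_mem (hqr.pow_right l) (hNM.le hxq) hxl
  exact hxN (mem_of_pow_mem_of_pow_mem hqr hxq (hMp x hxM))

theorem Over.character_eq {Γ : Type} [Group Γ] {N : Subgroup Γ} {μ : Γ → ℂ} {V : Type}
    [AddCommGroup V] [Module ℂ V] [FiniteDimensional ℂ V] {ρ : Representation ℂ Γ V}
    (h : Over N μ ρ) {n : Γ}
    (hn : n ∈ N) : ρ.character n = μ n * finrank ℂ V := by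
  have h1 : ρ n = μ n • LinearMap.id := by ext v; simpa using h n hn v
  rw [Representation.character, h1, map_smul, LinearMap.trace_id, smul_eq_mul]

theorem Over.character_eq_zero {Γ : Type} [Group Γ] {N : Subgroup Γ} {μ : Γ → ℂ} {V : Type}
    [AddCommGroup V] [Module ℂ V] {ρ : Representation ℂ Γ V} (h : Over N μ ρ) {a b : Γ}
    (hab : a * b * a⁻¹ * b⁻¹ ∈ N) (h1 : μ (a * b * a⁻¹ * b⁻¹) ≠ 1) : ρ.character a = 0 := by
  have h2 : ρ.character (b * a * b⁻¹) = ρ.character a := Representation.char_conj ρ a b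
  have h3 : a * b * a⁻¹ * b⁻¹ * (b * a * b⁻¹) = a := by group
  have h4 : ρ a = μ (a * b * a⁻¹ * b⁻¹) • ρ (b * a * b⁻¹) := by
    ext v
    conv_lhs => rw [← h3]
    rw [rep_mul_apply, h _ hab]; rfl
  have h5 : ρ.character a = μ (a * b * a⁻¹ * b⁻¹) * ρ.character (b * a * b⁻¹) := by
    rw [Representation.character, h4, map_smul, smul_eq_mul]; rfl
  rw [h2] at h5
  by_contra h0
  exact h1 (mul_right_cancel₀ h0 (by rw [← h5, one_mul]))

section Ramified

variable {Δ : Type} [Group Δ] [Finite Δ] {N : Subgroup Δ} {μ : Δ → ℂ}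
  (hμ : LinChar N μ) (hcomm : ∀ a b : Δ, a * b * a⁻¹ * b⁻¹ ∈ N)
  (hrad : ∀ a : Δ, (∀ b, μ (a * b * a⁻¹ * b⁻¹) = 1) → a ∈ N)
  {V W : Type} [AddCommGroup V] [Module ℂ V] [FiniteDimensional ℂ V]
  [AddCommGroup W] [Module ℂ W] [FiniteDimensional ℂ W] {ρ : Representation ℂ Δ V}
  {σ : Representation ℂ Δ W}

include hμ hcomm hrad

omit [Finite Δ] in
theorem sum_character_of_nondegenerate [Fintype Δ] (hρ : Over N μ ρ) (hσ : Over N μ σ) :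
    ∑ g, ρ.character g * σ.character g⁻¹ = Nat.card N * finrank ℂ V * finrank ℂ W := by
  classical
  have h1 : ∀ g, ρ.character g * σ.character g⁻¹ =
      if g ∈ N then (finrank ℂ V * finrank ℂ W : ℂ) else 0 := by
    intro g
    split_ifs with hg
    · have := hμ.ne_zero hg
      rw [hρ.character_eq hg, hσ.character_eq (N.inv_mem hg), hμ.inv hg]
      field_simp
    · have h2 : ¬ ∀ b, μ (g * b * g⁻¹ * b⁻¹) = 1 := fun h => hg (hrad g h)
      push Not at h2
      obtain ⟨b, hb⟩ := h2
      rw [hρ.character_eq_zero (hcomm g b) hb, zero_mul]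
  rw [Finset.sum_congr rfl fun g _ => h1 g, ← Finset.sum_filter, Finset.sum_const, nsmul_eq_mul,
    mul_assoc]
  congr 2
  rw [← Fintype.card_subtype, ← Nat.card_eq_fintype_card]

theorem isom_of_nondegenerate (hρi : Irred ρ) (hσi : Irred σ) (hρ : Over N μ ρ)
    (hσ : Over N μ σ) : Isom ρ σ := by
  classical
  have := Fintype.ofFinite Δ
  have h1 := sum_character_of_nondegenerate hμ hcomm hrad hρ hσ
  rw [hρi.char_orthonormal hσi] at h1
  by_contra hne
  rw [if_neg hne] at h1
  have := hρi.1
  have := hσi.1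
  have h2 : (finrank ℂ V : ℂ) ≠ 0 := by exact_mod_cast finrank_pos.ne'
  have h3 : (finrank ℂ W : ℂ) ≠ 0 := by exact_mod_cast finrank_pos.ne'
  have h4 : (Nat.card N : ℂ) ≠ 0 := by exact_mod_cast Nat.card_pos.ne'
  exact mul_ne_zero (mul_ne_zero h4 h2) h3 h1.symm

theorem finrank_sq_of_nondegenerate (hρi : Irred ρ) (hρ : Over N μ ρ) :
    finrank ℂ V ^ 2 = N.index := by
  classical
  have := Fintype.ofFinite Δ
  have h1 := sum_character_of_nondegenerate hμ hcomm hrad hρ hρ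
  rw [hρi.char_orthonormal hρi, if_pos ⟨LinearEquiv.refl ℂ V, fun _ _ => rfl⟩,
    ← N.card_mul_index] at h1
  have h4 : Nat.card N ≠ 0 := Nat.card_pos.ne'
  have h5 : Nat.card N * N.index = Nat.card N * finrank ℂ V * finrank ℂ V := by exact_mod_cast h1
  rw [mul_assoc] at h5
  rw [sq]
  exact (Nat.eq_of_mul_eq_mul_left (Nat.pos_of_ne_zero h4) h5).symm

theorem span_range_of_nondegenerate [N.Normal] (hρi : Irred ρ) (hρ : Over N μ ρ) :
    Submodule.span ℂ (Set.range ρ) = ⊤ := by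
  classical
  have := Fintype.ofFinite (Δ ⧸ N)
  have hV := hρi.1
  let f : Δ ⧸ N → (V →ₗ[ℂ] V) := fun q => ρ q.out
  have hli : LinearIndependent ℂ f := by
    rw [Fintype.linearIndependent_iff]
    intro c hc q
    have h1 : LinearMap.trace ℂ V (ρ (q.out)⁻¹ ∘ₗ ∑ i, c i • f i) = 0 := by rw [hc]; simp
    have h2 : ∀ i, LinearMap.trace ℂ V (ρ (q.out)⁻¹ ∘ₗ f i) =
        if i = q then (finrank ℂ V : ℂ) else 0 := by
      intro i
      have h3 : ρ (q.out)⁻¹ ∘ₗ f i = ρ ((q.out)⁻¹ * i.out) := (map_mul ρ _ _).symm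
      have h4 : LinearMap.trace ℂ V (ρ (q.out)⁻¹ ∘ₗ f i) = ρ.character ((q.out)⁻¹ * i.out) := by
        rw [h3]; rfl
      rw [h4]
      split_ifs with h
      · rw [h, inv_mul_cancel, hρ.character_eq N.one_mem, hμ.one, one_mul]
      · have h5 : (q.out)⁻¹ * i.out ∉ N := by
          rw [← QuotientGroup.eq, QuotientGroup.out_eq', QuotientGroup.out_eq']
          exact fun h' => h h'.symm
        have h6 : ¬ ∀ b, μ ((q.out)⁻¹ * i.out * b * ((q.out)⁻¹ * i.out)⁻¹ * b⁻¹) = 1 :=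
          fun h => h5 (hrad _ h)
        push Not at h6
        obtain ⟨b, hb⟩ := h6
        exact hρ.character_eq_zero (hcomm _ b) hb
    have h7 : ρ (q.out)⁻¹ ∘ₗ ∑ i, c i • f i = ∑ i, c i • (ρ (q.out)⁻¹ ∘ₗ f i) := by
      ext v; simp [LinearMap.sum_apply, map_sum]
    rw [h7, map_sum] at h1
    simp only [map_smul, h2, smul_eq_mul, mul_ite, mul_zero] at h1
    simp only [Finset.sum_ite_eq', Finset.mem_univ, if_true] at h1
    exact (mul_eq_zero.1 h1).resolve_right (by exact_mod_cast finrank_pos.ne')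
  have hcard : Fintype.card (Δ ⧸ N) = finrank ℂ (V →ₗ[ℂ] V) := by
    rw [Module.finrank_linearMap, ← Nat.card_eq_fintype_card, ← sq,
      finrank_sq_of_nondegenerate hμ hcomm hrad hρi hρ]; rfl
  rw [eq_top_iff, ← hli.span_eq_top_of_card_eq_finrank' hcard]
  refine Submodule.span_mono ?_
  rintro _ ⟨q, rfl⟩
  exact ⟨_, rfl⟩

end Ramified

/-- A nondegenerate commutator pairing yields a matrix model of the unique irreducible
representation of `M` over `μ`, stable under conjugation by the whole group. -/
theorem exists_matrix_model {Γ : Type} [Group Γ] [Finite Γ] {N M : Subgroup Γ} [hN : N.Normal]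
    [hM : M.Normal] {μ : Γ → ℂ} (hμ : InvChar N μ)
    (hcomm : ∀ a ∈ M, ∀ b ∈ M, a * b * a⁻¹ * b⁻¹ ∈ N)
    (hrad : ∀ a ∈ M, (∀ b ∈ M, μ (a * b * a⁻¹ * b⁻¹) = 1) → a ∈ N) :
    ∃ (d : ℕ) (R : M →* Matrix (Fin d) (Fin d) ℂ), d ^ 2 = N.relIndex M ∧
      Submodule.span ℂ (Set.range R) = ⊤ ∧
      (∀ m : M, (m : Γ) ∈ N → R m = μ m • (1 : Matrix (Fin d) (Fin d) ℂ)) ∧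
      ∀ g : Γ, ∃ X : Matrix (Fin d) (Fin d) ℂ, IsUnit X ∧
        ∀ m : M, X * R m = R (MulAut.conjNormal g m) * X := by
  classical
  have hμM := InvChar.subgroupOf (S := M) hμ.toLinChar fun s _ n hn => hμ.conj s n hn
  obtain ⟨V, _, _, _, ρ, hirr, hover⟩ := exists_irred_over (N := N.subgroupOf M) hμM
  have hcomm' : ∀ a b : M, a * b * a⁻¹ * b⁻¹ ∈ N.subgroupOf M := fun a b => hcomm a a.2 b b.2
  have hrad' : ∀ a : M, (∀ b : M, μ ↑(a * b * a⁻¹ * b⁻¹) = 1) → a ∈ N.subgroupOf M :=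
    fun a h => hrad a a.2 fun b hb => h ⟨b, hb⟩
  let b := Module.finBasis ℂ V
  let Φ := LinearMap.toMatrixAlgEquiv b
  refine ⟨finrank ℂ V, (Φ : (V →ₗ[ℂ] V) →* Matrix _ _ ℂ).comp ρ,
    finrank_sq_of_nondegenerate hμM.toLinChar hcomm' hrad' hirr hover, ?_, ?_, ?_⟩
  · have h1 := span_range_of_nondegenerate hμM.toLinChar hcomm' hrad' hirr hover
    have h2 : Set.range ((Φ : (V →ₗ[ℂ] V) →* Matrix _ _ ℂ).comp ρ) =
        Φ.toLinearEquiv.toLinearMap '' Set.range ρ := by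
      rw [← Set.range_comp]; rfl
    rw [h2, Submodule.span_image, h1, Submodule.map_top, LinearMap.range_eq_top]
    exact Φ.surjective
  · intro m hm
    have h1 : ρ m = μ m • (1 : V →ₗ[ℂ] V) := by ext v; exact hover m hm v
    change Φ (ρ m) = _
    rw [h1, map_smul, map_one]
  · intro g
    let σ : Representation ℂ M V := ρ.comp (MulAut.conjNormal g).toMonoidHom
    have hσ : ∀ m, σ m = ρ (MulAut.conjNormal g m) := fun _ => rfl
    have hσi : Irred σ := by
      refine ⟨hirr.1, fun U hU => hirr.2 U fun m u hu => ?_⟩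
      have := hU ((MulAut.conjNormal g).symm m) u hu
      rwa [hσ, MulEquiv.apply_symm_apply] at this
    have hσo : Over (N.subgroupOf M) (fun m => μ m) σ := by
      intro n hn v
      rw [hσ, hover _ (by
        rw [Subgroup.mem_subgroupOf, MulAut.conjNormal_apply]; exact hN.conj_mem _ hn g)]
      beta_reduce
      rw [MulAut.conjNormal_apply, hμ.conj g n hn]
    obtain ⟨e, he⟩ := isom_of_nondegenerate hμM.toLinChar hcomm' hrad' hirr hσi hover hσo
    refine ⟨Φ e.toLinearMap, ?_, fun m => ?_⟩
    · refine IsUnit.map Φ ?_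
      exact (LinearMap.isUnit_iff_ker_eq_bot _).2 e.ker
    · change Φ _ * Φ (ρ m) = Φ (ρ _) * Φ _
      rw [← map_mul, ← map_mul]
      congr 1
      ext v
      exact he m v

section Cover

variable {Γ : Type} [Group Γ] {M : Subgroup Γ} [hM : M.Normal] {d : ℕ}
  (R : M →* Matrix (Fin d) (Fin d) ℂ)

/-- Pairs `(g, X)` where `X` intertwines `R` with its conjugate by `g`, with bounded determinant. -/
def cover (e : ℕ) : Subgroup (Γ × (Matrix (Fin d) (Fin d) ℂ)ˣ) where
  carrier := {p | (∀ m : M, (p.2 : Matrix (Fin d) (Fin d) ℂ) * R m =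
    R (MulAut.conjNormal p.1 m) * p.2) ∧ (p.2 : Matrix (Fin d) (Fin d) ℂ).det ^ e = 1}
  one_mem' := by simp
  mul_mem' := by
    rintro a b ⟨ha, ha'⟩ ⟨hb, hb'⟩
    refine ⟨fun m => ?_, ?_⟩
    · simp only [Prod.snd_mul, Units.val_mul, Prod.fst_mul, map_mul, MulAut.mul_apply]
      rw [mul_assoc, hb, ← mul_assoc, ha, mul_assoc]
    · simp only [Prod.snd_mul, Units.val_mul, Matrix.det_mul, mul_pow, ha', hb', one_mul]
  inv_mem' := by
    rintro a ⟨ha, ha'⟩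
    refine ⟨fun m => ?_, ?_⟩
    · simp only [Prod.snd_inv, Prod.fst_inv]
      rw [Units.inv_mul_eq_iff_eq_mul, ← mul_assoc, ha, map_inv]
      rw [MulAut.apply_inv_self, mul_assoc, Units.mul_inv, mul_one]
    · have h1 : (a.2 : Matrix (Fin d) (Fin d) ℂ).det * ((a.2⁻¹ : (Matrix (Fin d) (Fin d) ℂ)ˣ) :
          Matrix (Fin d) (Fin d) ℂ).det = 1 := by
        rw [← Matrix.det_mul, Units.mul_inv, Matrix.det_one]
      simp only [Prod.snd_inv]
      have h2 := congrArg (· ^ e) h1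
      simpa only [mul_pow, ha', one_mul, one_pow] using h2

/-- The projection of the cover to the original group. -/
def coverFst (e : ℕ) : cover R e →* Γ := (MonoidHom.fst _ _).comp (cover R e).subtype

/-- The matrix component of an element of the cover. -/
def coverMat (e : ℕ) (p : cover R e) : Matrix (Fin d) (Fin d) ℂ := (p.1.2 : Matrix _ _ ℂ)

variable {R} {e : ℕ}

theorem coverMat_mul (p q : cover R e) : coverMat R e (p * q) = coverMat R e p * coverMat R e q :=
  rfl

theorem coverMat_one : coverMat R e 1 = 1 := rfl

theorem coverMat_inv_mul (p : cover R e) : coverMat R e p⁻¹ * coverMat R e p = 1 := by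
  rw [← coverMat_mul, inv_mul_cancel, coverMat_one]

theorem coverMat_comm (p : cover R e) (m : M) : coverMat R e p * R m =
    R (MulAut.conjNormal (coverFst R e p) m) * coverMat R e p := p.2.1 m

theorem cover_ext {p q : cover R e} (h1 : coverFst R e p = coverFst R e q)
    (h2 : coverMat R e p = coverMat R e q) : p = q :=
  Subtype.ext (Prod.ext h1 (Units.ext h2))

omit hM in
theorem exists_scalar_of_commute (hspan : Submodule.span ℂ (Set.range R) = ⊤)
    {A : Matrix (Fin d) (Fin d) ℂ} (hA : ∀ m, A * R m = R m * A) :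
    ∃ c : ℂ, A = c • (1 : Matrix (Fin d) (Fin d) ℂ) := by
  have h1 : ∀ B : Matrix (Fin d) (Fin d) ℂ, A * B = B * A := by
    intro B
    have hB : B ∈ Submodule.span ℂ (Set.range R) := hspan ▸ Submodule.mem_top
    induction hB using Submodule.span_induction with
    | mem x hx => obtain ⟨m, rfl⟩ := hx; exact hA m
    | zero => simp
    | add x y _ _ hx hy => rw [mul_add, add_mul, hx, hy]
    | smul c x _ hx => rw [Matrix.mul_smul, Matrix.smul_mul, hx]
  obtain ⟨c, hc⟩ := (Matrix.mem_range_scalar_iff_commute_single (M := A)).2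
    fun i j _ => (h1 _).symm
  exact ⟨c, by rw [← hc, Matrix.smul_one_eq_diagonal]; rfl⟩

theorem exists_cover_scalar (hspan : Submodule.span ℂ (Set.range R) = ⊤) (p : cover R e)
    (hp : coverFst R e p ∈ M) :
    ∃ c : ℂ, coverMat R e p = c • R ⟨coverFst R e p, hp⟩ := by
  set x : M := ⟨coverFst R e p, hp⟩
  have hx : R x⁻¹ * R x = 1 := by rw [← map_mul, inv_mul_cancel, map_one]
  have hx' : R x * R x⁻¹ = 1 := by rw [← map_mul, mul_inv_cancel, map_one]
  have hconj : ∀ m, MulAut.conjNormal (coverFst R e p) m = x * m * x⁻¹ := by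
    intro m; ext; simp [x]
  obtain ⟨c, hc⟩ := exists_scalar_of_commute hspan (A := R x⁻¹ * coverMat R e p) (by
    intro m
    rw [mul_assoc, coverMat_comm, hconj, map_mul, map_mul, ← mul_assoc, ← mul_assoc, ← mul_assoc,
      hx, one_mul, mul_assoc])
  refine ⟨c, ?_⟩
  rw [← one_mul (coverMat R e p), ← hx', mul_assoc, hc, Matrix.mul_smul, mul_one]

theorem coverFst_surjective (hd : 0 < d)
    (hconj : ∀ g : Γ, ∃ X : Matrix (Fin d) (Fin d) ℂ, IsUnit X ∧
        ∀ m : M, X * R m = R (MulAut.conjNormal g m) * X) :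
    Function.Surjective (coverFst R e) := by
  intro g
  obtain ⟨X, hX, hXm⟩ := hconj g
  have hdet : X.det ≠ 0 := ((Matrix.isUnit_iff_isUnit_det X).1 hX).ne_zero
  obtain ⟨c, hc⟩ := IsAlgClosed.exists_pow_nat_eq (X.det)⁻¹ hd
  have h1 : (c • X).det = 1 := by
    rw [Matrix.det_smul, Fintype.card_fin, hc, inv_mul_cancel₀ hdet]
  have hu : IsUnit (c • X) := (Matrix.isUnit_iff_isUnit_det _).2 (by rw [h1]; exact isUnit_one)
  refine ⟨⟨(g, hu.unit), fun m => ?_, ?_⟩, rfl⟩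
  · change c • X * R m = R _ * (c • X)
    rw [Matrix.smul_mul, Matrix.mul_smul, hXm]
  · change (c • X).det ^ e = 1
    rw [h1, one_pow]

theorem exists_scalar_of_mem_ker (hspan : Submodule.span ℂ (Set.range R) = ⊤) {p : cover R e}
    (hp : p ∈ (coverFst R e).ker) :
    ∃ c : ℂ, coverMat R e p = c • (1 : Matrix (Fin d) (Fin d) ℂ) := by
  have hp' : coverFst R e p = 1 := hp
  obtain ⟨c, hc⟩ := exists_cover_scalar hspan p (hp' ▸ M.one_mem)
  refine ⟨c, hc.trans ?_⟩
  have : (⟨coverFst R e p, hp' ▸ M.one_mem⟩ : M) = 1 := Subtype.ext hp'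
  rw [this, map_one]

theorem finite_cover [Finite Γ] (hd : 0 < d) (he : 0 < e)
    (hspan : Submodule.span ℂ (Set.range R) = ⊤) : Finite (cover R e) := by
  rw [(coverFst R e).finite_iff_finite_ker_range]
  refine ⟨?_, inferInstance⟩
  choose c hc using fun p : (coverFst R e).ker => exists_scalar_of_mem_ker hspan p.2
  have hmem : ∀ p, c p ∈ (Polynomial.nthRootsFinset (d * e) (1 : ℂ)) := by
    intro p
    rw [Polynomial.mem_nthRootsFinset (by positivity)]
    have h := p.1.2.2
    change (coverMat R e p.1).det ^ e = 1 at h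
    rw [hc, Matrix.det_smul, Matrix.det_one, mul_one, Fintype.card_fin, ← pow_mul] at h
    exact h
  refine Finite.of_injective
    (fun p => (⟨c p, hmem p⟩ : (Polynomial.nthRootsFinset (d * e) (1 : ℂ)))) ?_
  intro p q hpq
  have h : c p = c q := congrArg Subtype.val hpq
  refine Subtype.ext (cover_ext (p.2.trans q.2.symm) ?_)
  rw [hc, hc, h]

theorem isSolvable_cover (hsol : Group.IsSolvable Γ)
    (hspan : Submodule.span ℂ (Set.range R) = ⊤) : Group.IsSolvable (cover R e) := by
  have hc : ∀ a b : (coverFst R e).ker, a * b = b * a := by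
    intro a b
    obtain ⟨x, hx⟩ := exists_scalar_of_mem_ker hspan a.2
    obtain ⟨y, hy⟩ := exists_scalar_of_mem_ker hspan b.2
    have ha : coverFst R e a = 1 := a.2
    have hb : coverFst R e b = 1 := b.2
    refine Subtype.ext (cover_ext ?_ ?_)
    · simp [ha, hb]
    · simp only [Subgroup.coe_mul, coverMat_mul, hx, hy, smul_mul_smul_comm, mul_comm]
  have : Group.IsSolvable (coverFst R e).ker := Group.isSolvable_of_comm hc
  exact Group.isSolvable_of_ker_le_range (coverFst R e).ker.subtype (coverFst R e)
    (by rw [Subgroup.range_subtype])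

end Cover

/-- A representation trivial on the kernel of a surjection descends. -/
theorem exists_descent {Δ Γ : Type} [Group Δ] [Group Γ] (f : Δ →* Γ)
    (hf : Function.Surjective f) {V : Type} [AddCommGroup V] [Module ℂ V]
    (τ : Representation ℂ Δ V) (hτ : ∀ p, f p = 1 → τ p = 1) :
    ∃ ρ : Representation ℂ Γ V, ∀ p, ρ (f p) = τ p := by
  have h : f.ker ≤ (MonoidHom.toHomUnits τ).ker := fun p hp => Units.ext (hτ p hp)
  refine ⟨(Units.coeHom _).comp (f.liftOfSurjective hf ⟨MonoidHom.toHomUnits τ, h⟩), fun p => ?_⟩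
  have h2 := MonoidHom.liftOfRightInverse_comp_apply f _ (Function.rightInverse_surjInv hf)
    ⟨MonoidHom.toHomUnits τ, h⟩ p
  exact congrArg Units.val h2

section Tensor

variable {Γ : Type} [Group Γ] {M : Subgroup Γ} [hM : M.Normal] {d : ℕ}
  {R : M →* Matrix (Fin d) (Fin d) ℂ} {e : ℕ} {U U' : Type} [AddCommGroup U']
  [Module ℂ U'] [AddCommGroup U] [Module ℂ U]

/-- Matrices acting on column vectors with entries in `U`. -/
def matAct (A : Matrix (Fin d) (Fin d) ℂ) : (Fin d → U) →ₗ[ℂ] (Fin d → U) where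
  toFun s i := ∑ j, A i j • s j
  map_add' s t := by ext i; simp [Finset.sum_add_distrib]
  map_smul' c s := by ext i; simp [Finset.smul_sum, smul_comm c]

theorem matAct_apply (A : Matrix (Fin d) (Fin d) ℂ) (s : Fin d → U) (i : Fin d) :
    matAct A s i = ∑ j, A i j • s j := rfl

theorem matAct_mul (A B : Matrix (Fin d) (Fin d) ℂ) (s : Fin d → U) :
    matAct (A * B) s = matAct A (matAct B s) := by
  ext i
  simp only [matAct_apply, Matrix.mul_apply, Finset.sum_smul, Finset.smul_sum, mul_smul]
  rw [Finset.sum_comm]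

theorem matAct_one (s : Fin d → U) : matAct 1 s = s := by
  ext i
  simp [matAct_apply, Matrix.one_apply]

theorem matAct_smul (c : ℂ) (A : Matrix (Fin d) (Fin d) ℂ) (s : Fin d → U) :
    matAct (c • A) s = c • matAct A s := by
  ext i
  simp [matAct_apply, Finset.smul_sum, mul_smul]

theorem matAct_add (A B : Matrix (Fin d) (Fin d) ℂ) (s : Fin d → U) :
    matAct (A + B) s = matAct A s + matAct B s := by
  ext i
  simp [matAct_apply, add_smul, Finset.sum_add_distrib]

theorem matAct_single (i j : Fin d) (s : Fin d → U) :
    matAct (Matrix.single i j 1) s = Pi.single i (s j) := by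
  ext k
  by_cases h : k = i
  · subst h
    simp [matAct_apply, Matrix.single_apply]
  · simp [matAct_apply, Ne.symm h, h]

theorem matAct_map (A : Matrix (Fin d) (Fin d) ℂ) (f : U →ₗ[ℂ] U') (s : Fin d → U) :
    matAct A (fun i => f (s i)) = fun i => f (matAct A s i) := by
  ext i
  simp [matAct_apply]

/-- The representation `X ⊗ σ` of the cover on column vectors. -/
def tensorRep (σ : Representation ℂ (cover R e) U) : Representation ℂ (cover R e) (Fin d → U) where
  toFun p := (matAct (coverMat R e p)) ∘ₗ (LinearMap.compLeft (σ p) (Fin d))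
  map_one' := by
    refine LinearMap.ext fun s => ?_
    simp only [LinearMap.comp_apply, coverMat_one, matAct_one, map_one]
    rfl
  map_mul' p q := by
    refine LinearMap.ext fun s => ?_
    simp only [LinearMap.comp_apply, coverMat_mul, Module.End.mul_apply, matAct_mul, map_mul]
    congr 1
    exact matAct_map (coverMat R e q) (σ p) (fun i => σ q (s i))

theorem tensorRep_apply (σ : Representation ℂ (cover R e) U) (p : cover R e) (s : Fin d → U) :
    tensorRep σ p s = matAct (coverMat R e p) (fun i => σ p (s i)) := rfl

omit hM in
/-- Stability under the matrices `R m` implies stability under all matrices. -/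
theorem matAct_mem_of_span (hspan : Submodule.span ℂ (Set.range R) = ⊤)
    {S : Submodule ℂ (Fin d → U)} (hS : ∀ m, ∀ s ∈ S, matAct (R m) s ∈ S)
    (A : Matrix (Fin d) (Fin d) ℂ) : ∀ s ∈ S, matAct A s ∈ S := by
  have hA : A ∈ Submodule.span ℂ (Set.range R) := hspan ▸ Submodule.mem_top
  induction hA using Submodule.span_induction with
  | mem x hx => obtain ⟨m, rfl⟩ := hx; exact hS m
  | zero =>
    intro s _
    have : matAct (0 : Matrix (Fin d) (Fin d) ℂ) s = 0 := by ext; simp [matAct_apply]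
    rw [this]; exact S.zero_mem
  | add x y _ _ hx hy => intro s hs; rw [matAct_add]; exact S.add_mem (hx s hs) (hy s hs)
  | smul c x _ hx => intro s hs; rw [matAct_smul]; exact S.smul_mem c (hx s hs)

omit hM in
theorem matAct_commute_of_span (hspan : Submodule.span ℂ (Set.range R) = ⊤)
    (E : (Fin d → U) →ₗ[ℂ] (Fin d → U')) (hE : ∀ m s, E (matAct (R m) s) = matAct (R m) (E s))
    (A : Matrix (Fin d) (Fin d) ℂ) : ∀ s, E (matAct A s) = matAct A (E s) := by
  have hA : A ∈ Submodule.span ℂ (Set.range R) := hspan ▸ Submodule.mem_top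
  induction hA using Submodule.span_induction with
  | mem x hx => obtain ⟨m, rfl⟩ := hx; exact hE m
  | zero =>
    intro s
    have h0 : ∀ {U : Type} [AddCommGroup U] [Module ℂ U] (s : Fin d → U),
      matAct (0 : Matrix (Fin d) (Fin d) ℂ) s = 0 := by intros; ext; simp [matAct_apply]
    rw [h0, h0, map_zero]
  | add x y _ _ hx hy => intro s; rw [matAct_add, matAct_add, map_add, hx, hy]
  | smul c x _ hx => intro s; rw [matAct_smul, matAct_smul, map_smul, hx]

theorem irred_tensorRep (hd : 0 < d) (hspan : Submodule.span ℂ (Set.range R) = ⊤)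
    {σ : Representation ℂ (cover R e) U} (hσ : Irred σ)
    (hM' : ∀ m : M, ∃ p, ∀ s, tensorRep σ p s = matAct (R m) s) : Irred (tensorRep σ) := by
  have := hσ.1
  have : Nonempty (Fin d) := ⟨⟨0, hd⟩⟩
  refine ⟨inferInstance, fun S hS => ?_⟩
  have hA : ∀ A : Matrix (Fin d) (Fin d) ℂ, ∀ s ∈ S, matAct A s ∈ S :=
    matAct_mem_of_span hspan fun m s hs => by
      obtain ⟨p, hp⟩ := hM' m
      rw [← hp]; exact hS p s hs
  let i₀ : Fin d := ⟨0, hd⟩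
  let U₁ : Submodule ℂ U := S.comap (LinearMap.single ℂ (fun _ => U) i₀)
  have hmem : ∀ u, u ∈ U₁ ↔ Pi.single i₀ u ∈ S := fun _ => Iff.rfl
  have hinv : ∀ p, ∀ u ∈ U₁, σ p u ∈ U₁ := by
    intro p u hu
    rw [hmem] at hu ⊢
    have h1 := hA (coverMat R e p⁻¹) _ (hS p _ hu)
    rw [tensorRep_apply, ← matAct_mul, coverMat_inv_mul, matAct_one] at h1
    convert h1 using 1
    ext i
    by_cases h : i = i₀
    · subst h; simp
    · simp [Pi.single_eq_of_ne h]
  rcases hσ.2 U₁ hinv with h | h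
  · left
    rw [eq_bot_iff]
    intro s hs
    rw [Submodule.mem_bot]
    ext j
    have h1 := hA (Matrix.single i₀ j 1) s hs
    rw [matAct_single, ← hmem, h, Submodule.mem_bot] at h1
    exact h1
  · right
    rw [eq_top_iff]
    intro s _
    have h1 : ∀ i u, Pi.single i u ∈ S := by
      intro i u
      have h2 : Pi.single i₀ u ∈ S := by rw [← hmem, h]; exact Submodule.mem_top
      have h3 := hA (Matrix.single i i₀ 1) _ h2
      rwa [matAct_single, Pi.single_eq_same] at h3
    rw [← Finset.univ_sum_single s]
    exact S.sum_mem fun i _ => h1 i _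

theorem isom_of_isom_tensorRep (hd : 0 < d) (hspan : Submodule.span ℂ (Set.range R) = ⊤)
    {σ : Representation ℂ (cover R e) U} {σ' : Representation ℂ (cover R e) U'} (hσ : Irred σ)
    (hσ' : Irred σ')
    (hM' : ∀ m : M, ∃ p, (∀ s, tensorRep σ p s = matAct (R m) s) ∧
      ∀ s, tensorRep σ' p s = matAct (R m) s)
    (h : Isom (tensorRep σ) (tensorRep σ')) : Isom σ σ' := by
  obtain ⟨E, hE⟩ := h
  have hA := matAct_commute_of_span hspan E.toLinearMap (fun m s => by
    obtain ⟨p, hp, hp'⟩ := hM' m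
    rw [← hp, ← hp']; exact hE p s)
  let i₀ : Fin d := ⟨0, hd⟩
  let F : U →ₗ[ℂ] U' := LinearMap.proj i₀ ∘ₗ E.toLinearMap ∘ₗ LinearMap.single ℂ (fun _ => U) i₀
  have hF : ∀ u, F u = E (Pi.single i₀ u) i₀ := fun _ => rfl
  have hsingle : ∀ u, E (Pi.single i₀ u) = Pi.single i₀ (F u) := by
    intro u
    have h1 := hA (Matrix.single i₀ i₀ 1) (Pi.single i₀ u)
    rw [matAct_single, matAct_single, Pi.single_eq_same] at h1
    rw [hF]; exact h1
  have hcomm : ∀ p u, F (σ p u) = σ' p (F u) := by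
    intro p u
    have h1 := hE p (Pi.single i₀ u)
    have h2 := hA (coverMat R e p⁻¹) (tensorRep σ p (Pi.single i₀ u))
    have h2' : E (tensorRep σ p (Pi.single i₀ u)) = _ := h1
    rw [LinearEquiv.coe_coe, h2', tensorRep_apply, tensorRep_apply, ← matAct_mul, ← matAct_mul,
      coverMat_inv_mul, matAct_one, matAct_one, hsingle] at h2
    have h3 : (fun i => (σ p) ((Pi.single i₀ u : Fin d → U) i)) = Pi.single i₀ (σ p u) := by
      ext i
      by_cases h : i = i₀
      · subst h; simp
      · simp [Pi.single_eq_of_ne h]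
    rw [h3] at h2
    rw [hF, h2]
    beta_reduce
    rw [Pi.single_eq_same]
  refine hσ.isom_of_ne_zero hσ' F hcomm ?_
  intro h0
  have := hσ.1
  obtain ⟨u, hu⟩ := exists_ne (0 : U)
  have h1 := hsingle u
  rw [h0, LinearMap.zero_apply, Pi.single_zero, LinearEquiv.map_eq_zero_iff] at h1
  exact hu (by simpa using congrFun h1 i₀)

/-- The scalar relating the matrix component of an element over `M` to `R`. -/
theorem exists_coverScalar (hd : 0 < d) (hspan : Submodule.span ℂ (Set.range R) = ⊤) :
    ∃ c : cover R e → ℂ, (∀ p (hp : coverFst R e p ∈ M),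
      coverMat R e p = c p • R ⟨coverFst R e p, hp⟩) ∧
      InvChar (M.comap (coverFst R e)) (fun p => (c p)⁻¹) ∧
      ∀ p, coverFst R e p ∈ M → c p ≠ 0 := by
  classical
  have hR0 : ∀ m : M, R m ≠ 0 := by
    intro m h
    have h1 : R m * R m⁻¹ = 1 := by rw [← map_mul, mul_inv_cancel, map_one]
    rw [h, zero_mul] at h1
    have := congrFun (congrFun h1 ⟨0, hd⟩) ⟨0, hd⟩
    simp at this
  have hX0 : ∀ p : cover R e, coverMat R e p ≠ 0 := by
    intro p h
    have h1 := coverMat_inv_mul p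
    rw [h, mul_zero] at h1
    have := congrFun (congrFun h1 ⟨0, hd⟩) ⟨0, hd⟩
    simp at this
  choose c₀ hc₀ using fun p : cover R e => exists_cover_scalar hspan (p := p)
  let c : cover R e → ℂ := fun p => if hp : coverFst R e p ∈ M then c₀ p hp else 1
  have hc : ∀ p (hp : coverFst R e p ∈ M), coverMat R e p = c p • R ⟨coverFst R e p, hp⟩ := by
    intro p hp
    simp only [c, dif_pos hp]
    exact hc₀ p hp
  have huniq : ∀ p (hp : coverFst R e p ∈ M) (z : ℂ),
      coverMat R e p = z • R ⟨coverFst R e p, hp⟩ → c p = z := fun p hp z hz =>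
    smul_left_injective ℂ (hR0 ⟨_, hp⟩) ((hc p hp).symm.trans hz)
  refine ⟨c, hc, ⟨⟨?_, ?_⟩, ?_⟩, fun p hp h0 => hX0 p (by rw [hc p hp, h0, zero_smul])⟩
  · have h1 : coverFst R e 1 ∈ M := by rw [map_one]; exact M.one_mem
    have : (⟨coverFst R e 1, h1⟩ : M) = 1 := Subtype.ext (map_one _)
    rw [huniq 1 h1 1 (by rw [this, map_one, one_smul, coverMat_one]), inv_one]
  · intro p hp q hq
    have hpq : coverFst R e (p * q) ∈ M := by rw [map_mul]; exact M.mul_mem hp hq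
    have h1 : (⟨coverFst R e (p * q), hpq⟩ : M) = ⟨_, hp⟩ * ⟨_, hq⟩ := Subtype.ext (map_mul _ _ _)
    rw [huniq _ hpq (c p * c q), mul_inv]
    rw [h1, map_mul, coverMat_mul, hc p hp, hc q hq, smul_mul_smul_comm]
  · intro g p hp
    have hgp : coverFst R e (g * p * g⁻¹) ∈ M := by
      rw [map_mul, map_mul, map_inv]; exact hM.conj_mem _ hp _
    have h1 : (⟨coverFst R e (g * p * g⁻¹), hgp⟩ : M) =
        MulAut.conjNormal (coverFst R e g) ⟨_, hp⟩ := by ext; simp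
    rw [huniq _ hgp (c p)]
    rw [coverMat_mul, coverMat_mul, hc p hp, h1, Matrix.mul_smul, coverMat_comm, Matrix.smul_mul,
      mul_assoc, ← coverMat_mul, mul_inv_cancel, coverMat_one, mul_one]

theorem tensorRep_eq_matAct {c : cover R e → ℂ} (hc : ∀ p (hp : coverFst R e p ∈ M),
      coverMat R e p = c p • R ⟨coverFst R e p, hp⟩) (hc0 : ∀ p, coverFst R e p ∈ M → c p ≠ 0)
    {σ : Representation ℂ (cover R e) U}
    (hσ : Over (M.comap (coverFst R e)) (fun p => (c p)⁻¹) σ) {p : cover R e}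
    (hp : coverFst R e p ∈ M) (s : Fin d → U) :
    tensorRep σ p s = matAct (R ⟨coverFst R e p, hp⟩) s := by
  have h1 : (fun i => σ p (s i)) = (c p)⁻¹ • s := by ext i; exact hσ p hp (s i)
  rw [tensorRep_apply, h1, map_smul, hc p hp, matAct_smul, smul_smul,
    inv_mul_cancel₀ (hc0 p hp), one_smul]

end Tensor

theorem degreesDistinct_cover {Γ : Type} [Group Γ] {N M : Subgroup Γ} [hM : M.Normal] {d : ℕ}
    {R : M →* Matrix (Fin d) (Fin d) ℂ} {e : ℕ} {μ : Γ → ℂ} (hd : 0 < d)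
    (hspan : Submodule.span ℂ (Set.range R) = ⊤) (hNM : N ≤ M)
    (hRN : ∀ m : M, (m : Γ) ∈ N → R m = μ m • (1 : Matrix (Fin d) (Fin d) ℂ))
    (hsurj : Function.Surjective (coverFst R e)) {c : cover R e → ℂ}
    (hc : ∀ p (hp : coverFst R e p ∈ M), coverMat R e p = c p • R ⟨coverFst R e p, hp⟩)
    (hc0 : ∀ p, coverFst R e p ∈ M → c p ≠ 0) (hD : DegreesDistinct Γ N μ) :
    DegreesDistinct (cover R e) (M.comap (coverFst R e)) (fun p => (c p)⁻¹) := by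
  have key : ∀ (U : Type) [AddCommGroup U] [Module ℂ U] [FiniteDimensional ℂ U]
      (σ : Representation ℂ (cover R e) U), Irred σ →
      Over (M.comap (coverFst R e)) (fun p => (c p)⁻¹) σ →
      ∃ ρ : Representation ℂ Γ (Fin d → U), (∀ p, ρ (coverFst R e p) = tensorRep σ p) ∧
        Irred ρ ∧ Over N μ ρ := by
    intro U _ _ _ σ hσ hσo
    obtain ⟨ρ, hρ⟩ := exists_descent (coverFst R e) hsurj (tensorRep σ) (by
      intro p hp
      refine LinearMap.ext fun s => ?_
      have hpM : coverFst R e p ∈ M := hp ▸ M.one_mem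
      have h1 : (⟨coverFst R e p, hpM⟩ : M) = 1 := Subtype.ext hp
      rw [tensorRep_eq_matAct hc hc0 hσo hpM, h1, map_one, matAct_one]; rfl)
    have hirr := irred_tensorRep hd hspan hσ fun m => by
      obtain ⟨p, hp⟩ := hsurj m
      have hpM : coverFst R e p ∈ M := hp ▸ m.2
      refine ⟨p, fun s => ?_⟩
      rw [tensorRep_eq_matAct hc hc0 hσo hpM]
      congr 3
      exact Subtype.ext hp
    refine ⟨ρ, hρ, ⟨hirr.1, fun S hS => hirr.2 S fun p s hs => ?_⟩, fun n hn s => ?_⟩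
    · rw [← hρ]; exact hS _ s hs
    · obtain ⟨p, rfl⟩ := hsurj n
      rw [hρ, tensorRep_eq_matAct hc hc0 hσo (hNM hn), hRN _ hn, matAct_smul, matAct_one]
  intro U U' _ _ _ _ _ _ σ σ' hσ hσ' hσo hσo' hdim
  obtain ⟨ρ, hρ, hρi, hρo⟩ := key U σ hσ hσo
  obtain ⟨ρ', hρ', hρi', hρo'⟩ := key U' σ' hσ' hσo'
  obtain ⟨E, hE⟩ := hD _ _ ρ ρ' hρi hρi' hρo hρo' (by
    rw [Module.finrank_pi_fintype, Module.finrank_pi_fintype, hdim])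
  refine isom_of_isom_tensorRep hd hspan hσ hσ' (fun m => ?_)
    ⟨E, fun p s => by rw [← hρ, ← hρ']; exact hE _ s⟩
  obtain ⟨p, hp⟩ := hsurj m
  have hpM : coverFst R e p ∈ M := hp ▸ m.2
  have hpm : (⟨coverFst R e p, hpM⟩ : M) = m := Subtype.ext hp
  exact ⟨p, fun s => by rw [tensorRep_eq_matAct hc hc0 hσo hpM, hpm],
    fun s => by rw [tensorRep_eq_matAct hc hc0 hσo' hpM, hpm]⟩

theorem relIndex_eq_pow_of_forall_pow_mem {r : ℕ} (hr : r.Prime) {Γ : Type} [Group Γ] [Finite Γ]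
    {N M : Subgroup Γ} [N.Normal] (hMp : ∀ m ∈ M, m ^ r ∈ N) : ∃ l, N.relIndex M = r ^ l := by
  refine ⟨_, Nat.eq_prime_pow_of_unique_prime_dvd (Subgroup.index_ne_zero_of_finite)
    fun {q} hq hqd => ?_⟩
  by_contra hne
  obtain ⟨x, hxM, hxq, hxN⟩ := exists_coe_orderOf hq hqd
  exact hxN (mem_of_pow_mem_of_pow_mem ((Nat.coprime_primes hq hr).2 hne) hxq (hMp x hxM))

theorem index_eq_pow_of_nondegenerate {r k : ℕ} (hr : r.Prime) {Γ : Type} [Group Γ] [Finite Γ]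
    (hsol : Group.IsSolvable Γ) {N M : Subgroup Γ} [hN : N.Normal] [hM : M.Normal] {μ : Γ → ℂ}
    (hμ : InvChar N μ) (hval : ValuesOrder N μ (r ^ k)) (hD : DegreesDistinct Γ N μ)
    (hNM : N < M) (hMp : ∀ m ∈ M, m ^ r ∈ N)
    (hcomm : ∀ a ∈ M, ∀ b ∈ M, a * b * a⁻¹ * b⁻¹ ∈ N)
    (hrad : ∀ a ∈ M, (∀ b ∈ M, μ (a * b * a⁻¹ * b⁻¹) = 1) → a ∈ N)
    (IH : ∀ (Δ : Type) [Group Δ] [Finite Δ] (L : Subgroup Δ), L.index < N.index →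
      IndexClaim r Δ L) : ∃ l, N.index = r ^ l := by
  obtain ⟨d, R, hd2, hspan, hRN, hconj⟩ := exists_matrix_model hμ hcomm hrad
  obtain ⟨l, hl⟩ := relIndex_eq_pow_of_forall_pow_mem hr hMp
  have hd : 0 < d := by
    rcases Nat.eq_zero_or_pos d with h | h
    · rw [h, hl] at hd2
      exact absurd hd2.symm (by simp [hr.ne_zero])
    · exact h
  obtain ⟨j, -, hj⟩ := (Nat.dvd_prime_pow hr).1 (show d ∣ r ^ l by rw [← hl, ← hd2, sq]; simp)
  have he : 0 < r ^ (k + 1) := pow_pos hr.pos _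
  have hsurj : Function.Surjective (coverFst R (r ^ (k + 1))) := coverFst_surjective hd hconj
  have := finite_cover hd he hspan
  obtain ⟨c, hc, hinv, hc0⟩ := exists_coverScalar (e := r ^ (k + 1)) hd hspan
  have hindex : (M.comap (coverFst R (r ^ (k + 1)))).index = M.index :=
    Subgroup.index_comap_of_surjective M hsurj
  obtain ⟨l', hl'⟩ := IH (cover R (r ^ (k + 1))) (M.comap (coverFst R (r ^ (k + 1))))
    (by rw [hindex]; exact Subgroup.index_strictAnti hNM) inferInstance
    (isSolvable_cover hsol hspan) (fun p => (c p)⁻¹) (j + (k + 1)) hinv (by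
      intro p hp
      have h1 := p.2.2
      change (coverMat R (r ^ (k + 1)) p).det ^ _ = 1 at h1
      have hp' : coverFst R (r ^ (k + 1)) p ∈ M := hp
      set m : M := ⟨coverFst R (r ^ (k + 1)) p, hp'⟩ with hm
      have h2 : R m ^ r ^ (k + 1) = 1 := by
        have h3 : ((m ^ r : M) : Γ) ∈ N := hMp m m.2
        have h4 : μ ↑(m ^ r) ^ r ^ k = 1 := hval _ h3
        rw [pow_succ', pow_mul, ← map_pow, hRN _ h3, smul_pow, one_pow, h4, one_smul]
      rw [hc p hp', Matrix.det_smul, Fintype.card_fin, mul_pow, ← Matrix.det_pow, h2,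
        Matrix.det_one, mul_one, ← pow_mul, hj, ← pow_add] at h1
      rw [inv_pow, h1, inv_one])
    (degreesDistinct_cover hd hspan hNM.le hRN hsurj hc hc0 hD)
  refine ⟨l + l', ?_⟩
  rw [pow_add, ← hl, ← hl', hindex, Subgroup.relIndex_mul_index hNM.le]

/-- All orbit sizes are even powers of `r`, and an orbit is determined by its size. -/
structure DistinctEvenOrbits (r : ℕ) (R V : Type) [Group R] [MulAction R V] : Prop where
  even : ∀ v : V, ∃ c, Nat.card (MulAction.stabilizer R v) = r ^ (2 * c)
  distinct : ∀ v w : V, Nat.card (MulAction.orbit R v) = Nat.card (MulAction.orbit R w) →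
    w ∈ MulAction.orbit R v

section Orbits

variable {r : ℕ} {R V : Type} [Group R] [Finite V] [AddCommGroup V]
  [DistribMulAction R V]

omit [Finite V] in
theorem stabilizer_zero_eq_top : MulAction.stabilizer R (0 : V) = ⊤ := by
  ext g; simp [MulAction.mem_stabilizer_iff]

omit [Finite V] in
theorem card_orbit_zero : Nat.card (MulAction.orbit R (0 : V)) = 1 := by
  have h := MulAction.index_stabilizer R (0 : V)
  rw [stabilizer_zero_eq_top, Subgroup.index_top] at h
  exact h.symm

omit [Finite V] in
theorem DistinctEvenOrbits.card_group (h : DistinctEvenOrbits r R V) :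
    ∃ C, Nat.card R = r ^ (2 * C) := by
  obtain ⟨c, hc⟩ := h.even 0
  rw [stabilizer_zero_eq_top, Subgroup.card_top] at hc
  exact ⟨c, hc⟩

omit [Finite V] in
theorem DistinctEvenOrbits.card_orbit (h : DistinctEvenOrbits r R V) (hr : r.Prime) {C : ℕ}
    (hC : Nat.card R = r ^ (2 * C)) (v : V) :
    ∃ j ≤ C, Nat.card (MulAction.orbit R v) = r ^ (2 * j) := by
  obtain ⟨c, hc⟩ := h.even v
  have h1 := (MulAction.stabilizer R v).card_mul_index
  rw [MulAction.index_stabilizer, hc, hC] at h1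
  have hle : 2 * c ≤ 2 * C := (Nat.pow_dvd_pow_iff_le_right hr.one_lt).1 ⟨_, h1.symm⟩
  refine ⟨C - c, by omega, ?_⟩
  have h2 : r ^ (2 * C) = r ^ (2 * c) * r ^ (2 * (C - c)) := by
    rw [← pow_add]; congr 1; omega
  rw [h2] at h1
  exact Nat.eq_of_mul_eq_mul_left (pow_pos hr.pos _) h1

/-- The size of an invariant set, as a sum over the orbits it contains. -/
theorem DistinctEvenOrbits.ncard_eq_sum (h : DistinctEvenOrbits r R V) (hr : r.Prime) {C : ℕ}
    (hC : Nat.card R = r ^ (2 * C)) (S : Set V) (hS : ∀ (g : R), ∀ v ∈ S, g • v ∈ S) :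
    ∃ J ⊆ Finset.range (C + 1), S.ncard = ∑ j ∈ J, r ^ (2 * j) ∧
      ∀ j, j ∈ J ↔ ∃ v ∈ S, Nat.card (MulAction.orbit R v) = r ^ (2 * j) := by
  classical
  have := Fintype.ofFinite V
  choose f hfC hf using h.card_orbit hr hC
  have hfiff : ∀ v j, Nat.card (MulAction.orbit R v) = r ^ (2 * j) ↔ f v = j := by
    intro v j
    rw [hf]
    constructor
    · intro h1
      have := Nat.pow_right_injective hr.two_le h1
      omega
    · rintro rfl; rfl
  refine ⟨(S.toFinset).image f, ?_, ?_, ?_⟩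
  · intro j hj
    obtain ⟨v, -, rfl⟩ := Finset.mem_image.1 hj
    exact Finset.mem_range.2 (Nat.lt_succ_of_le (hfC v))
  · rw [Set.ncard_eq_toFinset_card']
    rw [Finset.card_eq_sum_card_image f]
    refine Finset.sum_congr rfl fun j hj => ?_
    obtain ⟨v, hv, rfl⟩ := Finset.mem_image.1 hj
    rw [Set.mem_toFinset] at hv
    rw [← hf v, ← Set.ncard_coe_finset]
    refine congrArg Set.ncard (Set.ext fun w => ?_)
    simp only [Finset.coe_filter, Set.mem_toFinset, Set.mem_ofPred_eq]
    constructor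
    · rintro ⟨-, hw⟩
      exact h.distinct v w (by rw [hf, hf, hw])
    · rintro ⟨g, rfl⟩
      refine ⟨hS g v hv, ?_⟩
      rw [← hfiff, ← hf v]
      change Nat.card (MulAction.orbit R (g • v)) = _
      rw [MulAction.orbit_smul]
  · intro j
    simp only [Finset.mem_image, Set.mem_toFinset, hfiff]

/-- The `r`-part of the size of a nonempty invariant set is a square. -/
theorem DistinctEvenOrbits.even_factorization_ncard (h : DistinctEvenOrbits r R V)
    (hr : r.Prime) (S : Set V) (hS : ∀ (g : R), ∀ v ∈ S, g • v ∈ S) (hne : S.Nonempty) :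
    Even (S.ncard.factorization r) := by
  obtain ⟨C, hC⟩ := h.card_group
  obtain ⟨J, -, hsum, hJ⟩ := h.ncard_eq_sum hr hC S hS
  have hJne : J.Nonempty := by
    obtain ⟨v, hv⟩ := hne
    obtain ⟨j, -, hj⟩ := h.card_orbit hr hC v
    exact ⟨j, (hJ j).2 ⟨v, hv, hj⟩⟩
  set a := J.min' hJne
  have ha : a ∈ J := J.min'_mem hJne
  have h1 : S.ncard = r ^ (2 * a) * (1 + r * ∑ j ∈ J.erase a, r ^ (2 * j - 2 * a - 1)) := by
    rw [hsum, ← Finset.add_sum_erase J _ ha, mul_add, mul_one, Finset.mul_sum, Finset.mul_sum]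
    congr 1
    refine Finset.sum_congr rfl fun j hj => ?_
    have : a < j := lt_of_le_of_ne (J.min'_le j (Finset.mem_of_mem_erase hj))
      (Finset.ne_of_mem_erase hj).symm
    rw [← pow_succ', ← pow_add]
    congr 1; omega
  have h2 : ¬ r ∣ 1 + r * ∑ j ∈ J.erase a, r ^ (2 * j - 2 * a - 1) := by
    rw [← Nat.dvd_add_iff_left (Dvd.intro _ rfl)]
    exact hr.one_lt.ne' ∘ Nat.dvd_one.1
  rw [h1, Nat.factorization_mul (pow_ne_zero _ hr.ne_zero) (by omega), hr.factorization_pow]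
  simp [Nat.factorization_eq_zero_of_not_dvd h2]

end Orbits

section

/-- A system of imprimitivity: `V` is the direct sum of blocks permuted transitively by `R`. -/
structure BlockSystem (R V : Type) [Group R] [AddCommGroup V] [DistribMulAction R V] (Ω : Type)
    [Fintype Ω] [MulAction R Ω] (B : Ω → AddSubgroup V) : Prop where
  smul_mem : ∀ (g : R) (i : Ω), ∀ v ∈ B i, g • v ∈ B (g • i)
  trans : ∀ i j : Ω, ∃ g : R, g • i = j
  exists_sum : ∀ v, ∃ f : Ω → V, (∀ i, f i ∈ B i) ∧ ∑ i, f i = v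
  unique : ∀ f f' : Ω → V, (∀ i, f i ∈ B i) → (∀ i, f' i ∈ B i) → ∑ i, f i = ∑ i, f' i → f = f'

namespace BlockSystem

variable {R V : Type} [Group R] [AddCommGroup V] [DistribMulAction R V] {Ω : Type}
    [Fintype Ω] [MulAction R Ω] {B : Ω → AddSubgroup V} (hB : BlockSystem R V Ω B)

/-- The components of a vector. -/
noncomputable def comp (v : V) : Ω → V := (hB.exists_sum v).choose

theorem comp_mem (v : V) (i : Ω) : hB.comp v i ∈ B i := (hB.exists_sum v).choose_spec.1 i

theorem sum_comp (v : V) : ∑ i, hB.comp v i = v := (hB.exists_sum v).choose_spec.2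

theorem comp_sum {f : Ω → V} (hf : ∀ i, f i ∈ B i) : hB.comp (∑ i, f i) = f :=
  hB.unique _ _ (hB.comp_mem _) hf (hB.sum_comp _)

theorem comp_smul (g : R) (v : V) (i : Ω) : hB.comp (g • v) (g • i) = g • hB.comp v i := by
  have h1 : hB.comp (g • v) = fun j => g • hB.comp v (g⁻¹ • j) := by
    refine hB.unique _ _ (hB.comp_mem _) (fun j => ?_) ?_
    · have := hB.smul_mem g (g⁻¹ • j) _ (hB.comp_mem v (g⁻¹ • j))
      rwa [smul_inv_smul] at this
    · rw [hB.sum_comp, ← Finset.smul_sum]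
      congr 1
      exact ((Equiv.sum_comp (MulAction.toPerm g⁻¹) (hB.comp v)).trans (hB.sum_comp v)).symm
  rw [h1]
  simp

include hB in
theorem card_block (i j : Ω) : Nat.card (B i) = Nat.card (B j) := by
  obtain ⟨g, rfl⟩ := hB.trans i j
  refine Nat.card_congr ⟨fun v => ⟨g • v.1, hB.smul_mem g i v v.2⟩,
    fun v => ⟨g⁻¹ • v.1, ?_⟩, fun v => ?_, fun v => ?_⟩
  · have := hB.smul_mem g⁻¹ _ v v.2
    rwa [inv_smul_smul] at this
  · simp
  · simp

open scoped Classical in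
/-- The set of blocks in which a vector has a nonzero component. -/
noncomputable def supp (v : V) : Finset Ω := Finset.univ.filter fun i => hB.comp v i ≠ 0

theorem mem_supp {v : V} {i : Ω} : i ∈ hB.supp v ↔ hB.comp v i ≠ 0 := by
  classical
  simp [supp]

theorem card_supp_smul (g : R) (v : V) : (hB.supp (g • v)).card = (hB.supp v).card := by
  refine (Finset.card_bij (fun i _ => g • i) (fun i hi => ?_) (fun i _ j _ h => ?_)
    (fun j hj => ?_)).symm
  · rw [mem_supp] at hi ⊢
    rwa [comp_smul, smul_ne_zero_iff_ne]
  · exact smul_left_cancel g h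
  · refine ⟨g⁻¹ • j, ?_, smul_inv_smul g j⟩
    rw [mem_supp] at hj ⊢
    have := hB.comp_smul g v (g⁻¹ • j)
    rw [smul_inv_smul] at this
    rwa [this, smul_ne_zero_iff_ne] at hj

theorem ncard_supp [Finite V] {u : ℕ} (hu : ∀ i, Nat.card (B i) = u) (w : ℕ) :
    {v | (hB.supp v).card = w}.ncard = (Fintype.card Ω).choose w * (u - 1) ^ w := by
  classical
  have := Fintype.ofFinite V
  let t : Finset Ω → Ω → Finset V := fun s i =>
    if i ∈ s then (B i : Set V).toFinset.erase 0 else {0}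
  have ht : ∀ s i, (t s i).card = if i ∈ s then u - 1 else 1 := by
    intro s i
    simp only [t]
    split_ifs
    · rw [Finset.card_erase_of_mem (by simp), ← hu i, ← Set.ncard_eq_toFinset_card']
      rfl
    · simp
  have htB : ∀ s f, f ∈ Fintype.piFinset (t s) → (∀ i, f i ∈ B i) ∧ ∀ i, f i ≠ 0 ↔ i ∈ s := by
    intro s f hf
    rw [Fintype.mem_piFinset] at hf
    refine ⟨fun i => ?_, fun i => ?_⟩
    · have := hf i
      simp only [t] at this
      split_ifs at this
      · simp at this; exact this.2
      · simp at this; rw [this]; exact (B i).zero_mem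
    · have := hf i
      simp only [t] at this
      split_ifs at this with h
      · simp at this; simp [h, this.1]
      · simp at this; simp [h, this]
  have hset : {v | (hB.supp v).card = w} = ((Finset.powersetCard w Finset.univ).biUnion
      fun s => (Fintype.piFinset (t s)).image fun f => ∑ i, f i : Finset V) := by
    ext v
    simp only [Finset.coe_biUnion, Finset.coe_image, Set.mem_iUnion, Set.mem_image,
      Finset.mem_coe, Finset.mem_powersetCard_univ, Set.mem_ofPred_eq, exists_prop]
    constructor
    · intro h
      refine ⟨hB.supp v, h, hB.comp v, ?_, hB.sum_comp v⟩
      rw [Fintype.mem_piFinset]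
      intro i
      simp only [t]
      split_ifs with hi
      · rw [mem_supp] at hi
        simp [hi, hB.comp_mem v i]
      · rw [mem_supp, not_not] at hi
        simp [hi]
    · rintro ⟨s, hs, f, hf, rfl⟩
      obtain ⟨h1, h2⟩ := htB s f hf
      have : hB.supp (∑ i, f i) = s := by
        ext i; rw [mem_supp, hB.comp_sum h1, h2]
      rw [this, hs]
  rw [hset, Set.ncard_coe_finset, Finset.card_biUnion]
  · have : ∀ s ∈ Finset.powersetCard w (Finset.univ : Finset Ω),
        ((Fintype.piFinset (t s)).image fun f => ∑ i, f i).card = (u - 1) ^ w := by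
      intro s hs
      rw [Finset.mem_powersetCard_univ] at hs
      rw [Finset.card_image_of_injOn, Fintype.card_piFinset]
      · simp only [ht]
        rw [Finset.prod_ite_mem, Finset.univ_inter, Finset.prod_const, hs]
      · intro f hf f' hf' h
        exact hB.unique f f' (htB s f hf).1 (htB s f' hf').1 h
    rw [Finset.sum_congr rfl this, Finset.sum_const, Finset.card_powersetCard, Finset.card_univ,
      smul_eq_mul]
  · intro s _ s' _ hss
    rw [Function.onFun, Finset.disjoint_left]
    intro v hv hv'
    obtain ⟨f, hf, rfl⟩ := Finset.mem_image.1 hv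
    obtain ⟨f', hf', h⟩ := Finset.mem_image.1 hv'
    obtain ⟨h1, h2⟩ := htB s f hf
    obtain ⟨h1', h2'⟩ := htB s' f' hf'
    have := hB.unique f' f h1' h1 h
    subst this
    exact hss (by ext i; rw [← h2, ← h2'])

end BlockSystem

end

section

/-- Two complementary blocks interchanged by the group. -/
structure TwoBlocks (R : Type) {V : Type} [Group R] [AddCommGroup V] [DistribMulAction R V]
    (V₁ V₂ : AddSubgroup V) : Prop where
  disjoint : ∀ v ∈ V₁, v ∈ V₂ → v = 0
  exists_add : ∀ v, ∃ x ∈ V₁, ∃ y ∈ V₂, x + y = v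
  stable : ∀ g : R, ((∀ v ∈ V₁, g • v ∈ V₁) ∧ ∀ v ∈ V₂, g • v ∈ V₂) ∨
    ((∀ v ∈ V₁, g • v ∈ V₂) ∧ ∀ v ∈ V₂, g • v ∈ V₁)
  swap : ∃ g : R, (∀ v ∈ V₁, g • v ∈ V₂) ∧ ∀ v ∈ V₂, g • v ∈ V₁

namespace BlockSystem

variable {r : ℕ} {R V : Type} [Group R] [Finite V] [AddCommGroup V]
  [DistribMulAction R V] {Ω : Type} [Fintype Ω] [MulAction R Ω] {B : Ω → AddSubgroup V}

theorem even_weight (hB : BlockSystem R V Ω B) (hr : r.Prime) (hD : DistinctEvenOrbits r R V)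
    {i u : ℕ} (hΩ : Fintype.card Ω = r ^ i) (hu : ∀ j, Nat.card (B j) = u) (hu2 : 2 ≤ u)
    {w : ℕ} (hw : w ≠ 0) (hwi : w ≤ r ^ i) :
    Even (i - w.factorization r + w * (u - 1).factorization r) := by
  have hc := hB.ncard_supp hu w
  have hch : (Fintype.card Ω).choose w ≠ 0 := (Nat.choose_pos (hΩ ▸ hwi)).ne'
  have hp : (u - 1) ^ w ≠ 0 := pow_ne_zero _ (by omega)
  have := hD.even_factorization_ncard hr {v | (hB.supp v).card = w}
    (fun g v hv => by
      change (hB.supp (g • v)).card = w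
      rw [hB.card_supp_smul]; exact hv)
    (by
      rw [← Set.ncard_pos, hc]
      positivity)
  rw [hc, Nat.factorization_mul hch hp, Nat.factorization_pow, hΩ, Finsupp.add_apply,
    Nat.factorization_choose_prime_pow hr hwi hw] at this
  simpa using this

theorem card_eq_two (hB : BlockSystem R V Ω B) (hr : r.Prime) (hD : DistinctEvenOrbits r R V)
    {i u : ℕ} (hΩ : Fintype.card Ω = r ^ i) (hi : i ≠ 0) (hu : ∀ j, Nat.card (B j) = u)
    (hu2 : 2 ≤ u) : r = 2 ∧ i = 1 := by
  have h1r : r ≤ r ^ i := Nat.le_self_pow hi r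
  have hwr := hB.even_weight hr hD hΩ hu hu2 hr.ne_zero h1r
  rw [hr.factorization_self] at hwr
  rcases hr.eq_two_or_odd' with rfl | hodd
  · refine ⟨rfl, ?_⟩
    by_contra hi1
    have h4 : 4 ≤ 2 ^ i := by
      calc 4 = 2 ^ 2 := rfl
        _ ≤ 2 ^ i := Nat.pow_le_pow_right (by norm_num) (by omega)
    have hw4 := hB.even_weight hr hD hΩ hu hu2 (by norm_num) h4
    have : (4 : ℕ).factorization 2 = 2 := by
      rw [show 4 = 2 ^ 2 from rfl, Nat.prime_two.factorization_pow]; simp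
    rw [this] at hw4
    rw [Nat.even_iff] at hwr hw4
    omega
  · have hw1 := hB.even_weight hr hD hΩ hu hu2 one_ne_zero (hr.pos.trans_le h1r)
    obtain ⟨s, rfl⟩ := hodd
    have : (2 * s + 1) * (u - 1).factorization (2 * s + 1) =
      2 * (s * (u - 1).factorization (2 * s + 1)) + (u - 1).factorization (2 * s + 1) := by ring
    rw [this] at hwr
    rw [Nat.even_iff] at hwr hw1
    simp only [Nat.factorization_one, Finsupp.coe_zero, Pi.zero_apply] at hw1
    omega

omit [Finite V] in
theorem twoBlocks (hB : BlockSystem R V Ω B) (hΩ : Fintype.card Ω = 2) :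
    ∃ i j, TwoBlocks R (B i) (B j) := by
  classical
  rw [← Finset.card_univ, Finset.card_eq_two] at hΩ
  obtain ⟨i, j, hij, huniv⟩ := hΩ
  have hor : ∀ m : Ω, m = i ∨ m = j := fun m => by
    have := Finset.mem_univ m
    rw [huniv] at this
    simpa using this
  have hsum : ∀ f : Ω → V, ∑ m, f m = f i + f j := fun f => by
    rw [huniv, Finset.sum_pair hij]
  refine ⟨i, j, ?_, ?_, ?_, ?_⟩
  · intro v hvi hvj
    have := hB.unique (fun m => if m = i then v else 0) (fun m => if m = i then 0 else v)
      (fun m => by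
        rcases hor m with rfl | rfl
        · simpa using hvi
        · simp [hij.symm])
      (fun m => by
        rcases hor m with rfl | rfl
        · simp
        · simpa [hij.symm] using hvj)
      (by simp [hsum, hij.symm])
    simpa using congrFun this i
  · intro v
    refine ⟨_, hB.comp_mem v i, _, hB.comp_mem v j, ?_⟩
    rw [← hsum, hB.sum_comp]
  · intro g
    have hne : g • i ≠ g • j := fun h => hij (smul_left_cancel g h)
    have hi := hB.smul_mem g i
    have hj := hB.smul_mem g j
    rcases hor (g • i) with h1 | h1 <;> rcases hor (g • j) with h2 | h2 <;> rw [h1] at hi <;>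
      rw [h2] at hj
    · exact absurd (h1.trans h2.symm) hne
    · exact Or.inl ⟨hi, hj⟩
    · exact Or.inr ⟨hi, hj⟩
    · exact absurd (h1.trans h2.symm) hne
  · obtain ⟨g, hg⟩ := hB.trans i j
    have hne : g • i ≠ g • j := fun h => hij (smul_left_cancel g h)
    have hj : g • j = i := (hor (g • j)).resolve_right fun h => hne (hg.trans h.symm)
    refine ⟨g, ?_, ?_⟩
    · have := hB.smul_mem g i; rwa [hg] at this
    · have := hB.smul_mem g j; rwa [hj] at this

end BlockSystem

end

section

namespace TwoBlocks

variable {R V : Type} [Group R] [Finite V] [AddCommGroup V]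
  [DistribMulAction R V] {V₁ V₂ : AddSubgroup V}

omit [Finite V] in
theorem add_inj (h : TwoBlocks R V₁ V₂) {x x' y y' : V} (hx : x ∈ V₁) (hx' : x' ∈ V₁)
    (hy : y ∈ V₂) (hy' : y' ∈ V₂) (e : x + y = x' + y') : x = x' ∧ y = y' := by
  have e2 : x - x' = y' - y := by
    rw [sub_eq_sub_iff_add_eq_add, e, add_comm]
  have := h.disjoint (x - x') (V₁.sub_mem hx hx') (e2 ▸ V₂.sub_mem hy' hy)
  exact ⟨sub_eq_zero.1 this, (sub_eq_zero.1 (e2 ▸ this)).symm⟩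

omit [Finite V] in
/-- An invariant set meets the two blocks in equally many vectors. -/
theorem ncard_inter_eq (h : TwoBlocks R V₁ V₂) (S : Set V) (hS : ∀ g : R, ∀ v ∈ S, g • v ∈ S) :
    (S ∩ V₁).ncard = (S ∩ V₂).ncard := by
  obtain ⟨s, hs1, hs2⟩ := h.swap
  have hV : ∀ v ∈ V₂, s⁻¹ • v ∈ V₁ := by
    intro v hv
    rcases h.stable s⁻¹ with h1 | h1
    · have h2 := hs2 _ (h1.2 v hv)
      rw [smul_inv_smul] at h2
      rw [h.disjoint v h2 hv, smul_zero]
      exact V₁.zero_mem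
    · exact h1.2 v hv
  have : S ∩ V₂ = (fun v => s • v) '' (S ∩ V₁) := by
    ext v
    constructor
    · rintro ⟨h1, h2⟩
      exact ⟨s⁻¹ • v, ⟨hS _ _ h1, hV v h2⟩, smul_inv_smul s v⟩
    · rintro ⟨w, ⟨h1, h2⟩, rfl⟩
      exact ⟨hS _ _ h1, hs1 _ h2⟩
  rw [this, Set.ncard_image_of_injective _ (MulAction.injective s)]

omit [Finite V] in
theorem card_eq (h : TwoBlocks R V₁ V₂) : Nat.card V₁ = Nat.card V₂ := by
  have := h.ncard_inter_eq Set.univ (fun _ _ _ => trivial)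
  rwa [Set.univ_inter, Set.univ_inter] at this

/-- Nonzero vectors in one of the blocks. -/
def axes (V₁ V₂ : AddSubgroup V) : Set V := {v | v ≠ 0 ∧ (v ∈ V₁ ∨ v ∈ V₂)}

/-- Vectors with two nonzero components. -/
def generic (V₁ V₂ : AddSubgroup V) : Set V := {v | v ∉ V₁ ∧ v ∉ V₂}

omit [Finite V] in
theorem smul_axes (h : TwoBlocks R V₁ V₂) (g : R) (v : V) (hv : v ∈ axes V₁ V₂) :
    g • v ∈ axes V₁ V₂ := by
  obtain ⟨h0, h1⟩ := hv
  refine ⟨(smul_ne_zero_iff_ne g).2 h0, ?_⟩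
  rcases h.stable g with h2 | h2 <;> rcases h1 with h1 | h1
  · exact Or.inl (h2.1 v h1)
  · exact Or.inr (h2.2 v h1)
  · exact Or.inr (h2.1 v h1)
  · exact Or.inl (h2.2 v h1)

omit [Finite V] in
theorem generic_eq : generic V₁ V₂ = {v | v ≠ 0 ∧ v ∉ axes V₁ V₂} := by
  ext v
  simp only [generic, axes, Set.mem_ofPred_eq]
  constructor
  · rintro ⟨h1, h2⟩
    refine ⟨?_, ?_⟩
    · rintro rfl; exact h1 V₁.zero_mem
    · rintro ⟨-, h | h⟩
      · exact h1 h
      · exact h2 h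
  · rintro ⟨h0, h⟩
    exact ⟨fun h1 => h ⟨h0, Or.inl h1⟩, fun h1 => h ⟨h0, Or.inr h1⟩⟩

omit [Finite V] in
theorem smul_generic (h : TwoBlocks R V₁ V₂) (g : R) (v : V) (hv : v ∈ generic V₁ V₂) :
    g • v ∈ generic V₁ V₂ := by
  rw [generic_eq] at hv ⊢
  refine ⟨(smul_ne_zero_iff_ne g).2 hv.1, fun h1 => hv.2 ?_⟩
  simpa using h.smul_axes g⁻¹ _ h1

omit [Finite V] in
theorem add_mem_generic (h : TwoBlocks R V₁ V₂) {x y : V} (hx : x ∈ V₁) (hy : y ∈ V₂)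
    (hx0 : x ≠ 0) (hy0 : y ≠ 0) : x + y ∈ generic V₁ V₂ := by
  refine ⟨fun h1 => hy0 (h.disjoint y ?_ hy), fun h1 => hx0 (h.disjoint x hx ?_)⟩
  · exact (V₁.add_mem_cancel_left hx).1 h1
  · exact (V₂.add_mem_cancel_right hy).1 h1

/-- The number of vectors whose components lie in two given invariant sets of axis vectors. -/
theorem ncard_mixed (h : TwoBlocks R V₁ V₂) (O O' : Set V) (hO : ∀ g : R, ∀ v ∈ O, g • v ∈ O)
    (hO' : ∀ g : R, ∀ v ∈ O', g • v ∈ O') (hdis : Disjoint O O') (hOa : O ⊆ axes V₁ V₂)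
    (hOa' : O' ⊆ axes V₁ V₂) :
    ∃ T : Set V, (∀ g : R, ∀ v ∈ T, g • v ∈ T) ∧ 2 * T.ncard = O.ncard * O'.ncard := by
  have half : ∀ S : Set V, (∀ g : R, ∀ v ∈ S, g • v ∈ S) → S ⊆ axes V₁ V₂ →
      2 * (S ∩ V₁).ncard = S.ncard ∧ 2 * (S ∩ V₂).ncard = S.ncard := by
    intro S hS hSa
    have h1 := h.ncard_inter_eq S hS
    have h2 : S = (S ∩ V₁) ∪ (S ∩ V₂) := by
      ext v
      constructor
      · intro hv
        rcases (hSa hv).2 with h3 | h3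
        · exact Or.inl ⟨hv, h3⟩
        · exact Or.inr ⟨hv, h3⟩
      · rintro (h3 | h3) <;> exact h3.1
    have h3 : Disjoint (S ∩ V₁) (S ∩ V₂) := by
      rw [Set.disjoint_left]
      rintro v ⟨hv, h4⟩ ⟨-, h5⟩
      exact (hSa hv).1 (h.disjoint v h4 h5)
    have h4 := Set.ncard_union_eq h3
    rw [← h2] at h4
    omega
  set P : Set (V × V) := ((O ∩ V₁) ×ˢ (O' ∩ V₂)) ∪ ((O' ∩ V₁) ×ˢ (O ∩ V₂)) with hP
  refine ⟨(fun p : V × V => p.1 + p.2) '' P, ?_, ?_⟩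
  · rintro g _ ⟨⟨x, y⟩, hxy, rfl⟩
    dsimp only
    rw [smul_add]
    rcases h.stable g with hg | hg <;> rcases hxy with ⟨⟨a1, a2⟩, a3, a4⟩ | ⟨⟨a1, a2⟩, a3, a4⟩
    · exact ⟨(g • x, g • y), Or.inl ⟨⟨hO g _ a1, hg.1 _ a2⟩, hO' g _ a3, hg.2 _ a4⟩, rfl⟩
    · exact ⟨(g • x, g • y), Or.inr ⟨⟨hO' g _ a1, hg.1 _ a2⟩, hO g _ a3, hg.2 _ a4⟩, rfl⟩
    · exact ⟨(g • y, g • x), Or.inr ⟨⟨hO' g _ a3, hg.2 _ a4⟩, hO g _ a1, hg.1 _ a2⟩, add_comm _ _⟩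
    · exact ⟨(g • y, g • x), Or.inl ⟨⟨hO g _ a3, hg.2 _ a4⟩, hO' g _ a1, hg.1 _ a2⟩, add_comm _ _⟩
  · have hinj : Set.InjOn (fun p : V × V => p.1 + p.2) P := by
      have hPV : ∀ p ∈ P, p.1 ∈ V₁ ∧ p.2 ∈ V₂ := by
        rintro p (⟨⟨-, a⟩, -, b⟩ | ⟨⟨-, a⟩, -, b⟩) <;> exact ⟨a, b⟩
      intro p hp q hq e
      obtain ⟨e1, e2⟩ := h.add_inj (hPV p hp).1 (hPV q hq).1 (hPV p hp).2 (hPV q hq).2 e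
      exact Prod.ext e1 e2
    have hd : Disjoint ((O ∩ V₁) ×ˢ (O' ∩ V₂)) ((O' ∩ V₁) ×ˢ (O ∩ V₂)) := by
      rw [Set.disjoint_left]
      rintro p ⟨⟨a, -⟩, -⟩ ⟨⟨b, -⟩, -⟩
      exact Set.disjoint_left.1 hdis a b
    rw [hinj.ncard_image, hP, Set.ncard_union_eq hd, Set.ncard_prod, Set.ncard_prod]
    obtain ⟨a1, a2⟩ := half O hO hOa
    obtain ⟨b1, b2⟩ := half O' hO' hOa'
    rw [← a1, ← b1]
    have a3 : (O ∩ V₂).ncard = (O ∩ V₁).ncard := by omega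
    have b3 : (O' ∩ V₂).ncard = (O' ∩ V₁).ncard := by omega
    rw [a3, b3]
    ring

theorem ncard_axes (h : TwoBlocks R V₁ V₂) {u : ℕ} (hu : Nat.card V₁ = u) :
    (axes V₁ V₂).ncard = 2 * (u - 1) := by
  have h1 : axes V₁ V₂ = ((V₁ : Set V) \ {0}) ∪ ((V₂ : Set V) \ {0}) := by
    ext v
    simp only [axes, Set.mem_ofPred_eq, Set.mem_union, Set.mem_sdiff, SetLike.mem_coe,
      Set.mem_singleton_iff]
    tauto
  have h2 : Disjoint ((V₁ : Set V) \ {0}) ((V₂ : Set V) \ {0}) := by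
    rw [Set.disjoint_left]
    rintro v ⟨hv, h0⟩ ⟨hv', -⟩
    exact h0 (h.disjoint v hv hv')
  have h3 : ∀ W : AddSubgroup V, ((W : Set V) \ {0}).ncard = Nat.card W - 1 := fun W =>
    Set.ncard_sdiff_singleton_of_mem W.zero_mem
  rw [h1, Set.ncard_union_eq h2, h3, h3, ← h.card_eq, hu]
  ring

omit [Finite V] in
theorem card_eq_sq (h : TwoBlocks R V₁ V₂) : Nat.card V = Nat.card V₁ * Nat.card V₂ := by
  rw [← Nat.card_prod]
  refine (Nat.card_eq_of_bijective (fun p : V₁ × V₂ => (p.1 : V) + p.2) ⟨?_, ?_⟩).symm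
  · intro p q e
    obtain ⟨e1, e2⟩ := h.add_inj p.1.2 q.1.2 p.2.2 q.2.2 e
    exact Prod.ext (Subtype.ext e1) (Subtype.ext e2)
  · intro v
    obtain ⟨x, hx, y, hy, e⟩ := h.exists_add v
    exact ⟨(⟨x, hx⟩, ⟨y, hy⟩), e⟩

theorem ncard_generic (h : TwoBlocks R V₁ V₂) {u : ℕ} (hu : Nat.card V₁ = u) :
    (generic V₁ V₂).ncard = (u - 1) ^ 2 := by
  have hupos : 0 < u := hu ▸ Nat.card_pos
  have h1 : generic V₁ V₂ = (axes V₁ V₂ ∪ {0})ᶜ := by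
    rw [generic_eq]; ext v
    simp
  have h2 := Set.ncard_add_ncard_compl (axes V₁ V₂ ∪ {0})
  rw [← h1, Set.ncard_union_eq, h.ncard_axes hu, Set.ncard_singleton, h.card_eq_sq, ← h.card_eq,
    hu] at h2
  · obtain ⟨t, rfl⟩ : ∃ t, u = t + 1 := ⟨u - 1, by omega⟩
    simp only [Nat.add_sub_cancel] at h2 ⊢
    nlinarith
  · rw [Set.disjoint_singleton_right]
    exact fun h => h.1 rfl

end TwoBlocks

end

section

theorem prime_pow_eq_three_or_nine {p m s : ℕ} (hp : p.Prime) (h2 : 2 ≤ p ^ m)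
    (h : 2 * (p ^ m - 1) = 2 ^ (2 * s)) : p ^ m = 3 ∨ p ^ m = 9 := by
  obtain _ | t := s
  · simp at h
  have h1 : p ^ m = 1 + 2 * 4 ^ t := by
    have : 2 ^ (2 * (t + 1)) = 4 * 4 ^ t := by rw [pow_mul, pow_succ']; norm_num
    omega
  have h3 : 3 ∣ p ^ m := by
    rw [h1, Nat.dvd_iff_mod_eq_zero, Nat.add_mod, Nat.mul_mod, Nat.pow_mod]
    simp
  obtain rfl : p = 3 := ((Nat.prime_dvd_prime_iff_eq Nat.prime_three hp).1
    (Nat.prime_three.dvd_of_dvd_pow h3)).symm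
  obtain _ | _ | t := t
  · left; simpa using h1
  · right; simpa using h1
  exfalso
  have h32 : 3 ^ m % 32 = 1 := by
    rw [h1, pow_add]; omega
  have hm : m % 8 = 0 := by
    have h8 : 3 ^ m % 32 = 3 ^ (m % 8) % 32 := by
      conv_lhs => rw [← Nat.div_add_mod m 8, pow_add, pow_mul, Nat.mul_mod, Nat.pow_mod]
      simp
    have hlt := Nat.mod_lt m (show 8 > 0 by norm_num)
    generalize m % 8 = b at *
    interval_cases b <;> simp_all
  have h5 : 3 ^ m % 5 = 1 := by
    rw [← Nat.div_add_mod m 8, hm, add_zero, pow_mul, Nat.pow_mod]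
    simp
  have h5' : 5 ∣ 2 * 4 ^ (t + 1 + 1) := by omega
  have h55 : Nat.Prime 5 := by norm_num
  rcases h55.dvd_mul.1 h5' with h6 | h6
  · omega
  · have := h55.dvd_of_dvd_pow h6
    omega

namespace TwoBlocks

variable {R V : Type} [Group R] [Finite V] [AddCommGroup V]
  [DistribMulAction R V] {V₁ V₂ : AddSubgroup V}

theorem axes_subset_orbit (h : TwoBlocks R V₁ V₂) (hD : DistinctEvenOrbits 2 R V) {v v' : V}
    (hv : v ∈ axes V₁ V₂) (hv' : v' ∈ axes V₁ V₂) : v' ∈ MulAction.orbit R v := by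
  by_contra hne
  obtain ⟨C, hC⟩ := hD.card_group
  have hinv : ∀ v : V, ∀ g : R, ∀ w ∈ MulAction.orbit R v, g • w ∈ MulAction.orbit R v := by
    rintro v g w hw
    exact MulAction.mem_orbit_of_mem_orbit g hw
  have hax : ∀ v ∈ axes V₁ V₂, MulAction.orbit R v ⊆ axes V₁ V₂ := by
    rintro v hv _ ⟨g, rfl⟩
    exact h.smul_axes g v hv
  have hdis : Disjoint (MulAction.orbit R v) (MulAction.orbit R v') := by
    rw [Set.disjoint_left]
    intro w hw hw'
    rw [← MulAction.orbit_eq_iff] at hw hw'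
    rw [← hw, hw'] at hne
    exact hne (MulAction.mem_orbit_self v')
  obtain ⟨T, hT, hcard⟩ := h.ncard_mixed _ _ (hinv v) (hinv v') hdis (hax v hv) (hax v' hv')
  obtain ⟨j, -, hj⟩ := hD.card_orbit Nat.prime_two hC v
  obtain ⟨j', -, hj'⟩ := hD.card_orbit Nat.prime_two hC v'
  rw [Nat.card_coe_set_eq] at hj hj'
  rw [hj, hj', ← pow_add] at hcard
  have hT0 : T.ncard ≠ 0 := by
    intro h0
    rw [h0] at hcard
    exact absurd hcard.symm (by positivity)
  have hev := hD.even_factorization_ncard Nat.prime_two T hT (Set.nonempty_of_ncard_ne_zero hT0)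
  have := congrArg (fun n => n.factorization 2) hcard
  simp only [Nat.factorization_mul two_ne_zero hT0, Finsupp.add_apply,
    Nat.prime_two.factorization_self, Nat.prime_two.factorization_pow, Finsupp.single_eq_same]
    at this
  rw [Nat.even_iff] at hev
  omega

theorem card_eq_nine (h : TwoBlocks R V₁ V₂) (hD : DistinctEvenOrbits 2 R V) {p : ℕ}
    (hp : p.Prime) (hpV : ∀ v : V, p • v = 0) (h1 : 2 ≤ Nat.card V₁) :
    Nat.card V₁ = 9 ∧ (∀ v ∈ axes V₁ V₂, Nat.card (MulAction.orbit R v) = 16) ∧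
      ∀ v ∈ generic V₁ V₂, Nat.card (MulAction.orbit R v) = 64 := by
  obtain ⟨C, hC⟩ := hD.card_group
  obtain ⟨m, hm⟩ : ∃ m, Nat.card V₁ = p ^ m := by
    have := Fact.mk hp
    let _ : Module (ZMod p) V₁ := AddCommGroup.zmodModule fun v => Subtype.ext (hpV v)
    exact ⟨_, by rw [Module.natCard_eq_pow_finrank (K := ZMod p), Nat.card_zmod]⟩
  have hax : ∀ v ∈ axes V₁ V₂, Nat.card (MulAction.orbit R v) = 2 * (p ^ m - 1) := by
    intro v hv
    rw [← h.ncard_axes hm, Nat.card_coe_set_eq]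
    congr 1
    ext w
    constructor
    · rintro ⟨g, rfl⟩; exact h.smul_axes g v hv
    · exact h.axes_subset_orbit hD hv
  have hgen := h.ncard_generic hm
  obtain ⟨J, -, hsum, hJ⟩ := hD.ncard_eq_sum Nat.prime_two hC (generic V₁ V₂) h.smul_generic
  obtain ⟨v₀, hv₀⟩ : (axes V₁ V₂).Nonempty := by
    rw [← Set.ncard_pos, h.ncard_axes hm]; omega
  obtain ⟨s, -, hs⟩ := hD.card_orbit Nat.prime_two hC v₀
  have hgen' : ∀ v ∈ generic V₁ V₂, Nat.card (MulAction.orbit R v) ≠ 2 * (p ^ m - 1) := by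
    intro v hv hcv
    have h2 := hD.distinct v₀ v (by rw [hcv, hax v₀ hv₀])
    obtain ⟨g, rfl⟩ := h2
    rw [generic_eq] at hv
    exact hv.2 (h.smul_axes g v₀ hv₀)
  rw [hgen] at hsum
  have hle : ∀ j ∈ J, 2 ^ (2 * j) ≤ (p ^ m - 1) ^ 2 := fun j hj => by
    rw [hsum]; exact Finset.single_le_sum (f := fun j => 2 ^ (2 * j)) (by simp) hj
  rw [hax v₀ hv₀] at hs
  rcases prime_pow_eq_three_or_nine hp (hm ▸ h1) hs with h3 | h9
  · exfalso
    rw [h3] at hle hsum hgen'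
    have hJ1 : ∀ j ∈ J, j = 0 := by
      intro j hj
      have h4 : 2 ^ (2 * j) ≤ 2 ^ 2 := hle j hj
      have h5 := (Nat.pow_le_pow_iff_right (by norm_num)).1 h4
      have h6 : j ≠ 1 := by
        rintro rfl
        obtain ⟨v, hv, hvc⟩ := (hJ 1).1 hj
        exact hgen' v hv (by rw [hvc]; norm_num)
      omega
    have hsub : J ⊆ {0} := fun j hj => by simp [hJ1 j hj]
    have := Finset.sum_le_sum_of_subset (f := fun j => 2 ^ (2 * j)) hsub
    rw [← hsum] at this
    simp at this
  · refine ⟨hm.trans h9, fun v hv => by rw [hax v hv, h9], fun v hv => ?_⟩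
    obtain ⟨j, -, hj⟩ := hD.card_orbit Nat.prime_two hC v
    have hjJ := (hJ j).2 ⟨v, hv, hj⟩
    rw [h9] at hle hsum
    have hle3 : ∀ j ∈ J, j ≤ 3 := by
      intro j hj
      have h4 : 2 ^ (2 * j) ≤ 2 ^ 6 := hle j hj
      have h5 := (Nat.pow_le_pow_iff_right (by norm_num)).1 h4
      omega
    have h3J : 3 ∈ J := by
      by_contra h3J
      have hsub : J ⊆ Finset.range 3 := fun j hj => by
        have := hle3 j hj
        have : j ≠ 3 := fun e => h3J (e ▸ hj)
        rw [Finset.mem_range]; omega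
      have := Finset.sum_le_sum_of_subset (f := fun j => 2 ^ (2 * j)) hsub
      rw [← hsum] at this
      simp [Finset.sum_range_succ] at this
    have hj3 : j = 3 := by
      by_contra hj3
      have hsub : {3, j} ⊆ J := by
        intro x hx
        simp only [Finset.mem_insert, Finset.mem_singleton] at hx
        rcases hx with rfl | rfl <;> assumption
      have := Finset.sum_le_sum_of_subset (f := fun j => 2 ^ (2 * j)) hsub
      rw [← hsum, Finset.sum_pair (Ne.symm hj3)] at this
      have : 0 < 2 ^ (2 * j) := by positivity
      omega
    rw [hj, hj3]; norm_num

end TwoBlocks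

end

/-- The formal properties of the relation of commuting in a projective representation. -/
structure CommRelation {R : Type} [Group R] (Z : R → R → Prop) : Prop where
  refl : ∀ x, Z x x
  symm : ∀ x y, Z x y → Z y x
  one : ∀ x, Z x 1
  mul : ∀ x y z, Z x y → Z x z → Z x (y * z)
  inv : ∀ x y, Z x y → Z x y⁻¹
  involution : ∀ d x y, d * d = 1 → d * x = x * d → d * y = y * d → ¬ Z d x → ¬ Z d y →
    Z d (x * y)

theorem CommRelation.closure {R : Type} [Group R] {Z : R → R → Prop} (hZ : CommRelation Z)
    {S : Set R} (hS : ∀ x ∈ S, ∀ y ∈ S, Z x y) :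
    ∀ x ∈ Subgroup.closure S, ∀ y ∈ Subgroup.closure S, Z x y := by
  have key : ∀ (x : R) (T : Set R), (∀ y ∈ T, Z x y) → ∀ y ∈ Subgroup.closure T, Z x y := by
    intro x T hT y hy
    induction hy using Subgroup.closure_induction with
    | mem y hy => exact hT y hy
    | one => exact hZ.one x
    | mul a b _ _ ha hb => exact hZ.mul x a b ha hb
    | inv a _ ha => exact hZ.inv x a ha
  intro x hx
  refine key x S fun y hy => hZ.symm _ _ ?_
  exact key y S (hS y hy) x hx

theorem CommRelation.zpowers {R : Type} [Group R] {Z : R → R → Prop} (hZ : CommRelation Z)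
    (g : R) : ∀ x ∈ Subgroup.zpowers g, ∀ y ∈ Subgroup.zpowers g, Z x y := by
  rw [Subgroup.zpowers_eq_closure]
  refine hZ.closure ?_
  rintro x rfl y rfl
  exact hZ.refl _

theorem ncard_le_two_mul {R : Type} [Group R] [Finite R] {S T : Set R}
    (h : ∀ x ∈ S, ∀ y ∈ S, x ∉ T → y ∉ T → x⁻¹ * y ∈ T) : S.ncard ≤ 2 * T.ncard := by
  by_cases hST : S ⊆ T
  · have := Set.ncard_le_ncard hST
    omega
  · obtain ⟨x, hx, hxT⟩ := Set.not_subset.1 hST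
    have hsub : S ⊆ T ∪ (fun t => x * t) '' T := by
      intro y hy
      by_cases hyT : y ∈ T
      · exact Or.inl hyT
      · exact Or.inr ⟨x⁻¹ * y, h x hx y hy hxT hyT, mul_inv_cancel_left x y⟩
    have h1 := Set.ncard_le_ncard hsub
    have h2 := Set.ncard_union_le T ((fun t => x * t) '' T)
    have h3 := Set.ncard_image_le (f := fun t => x * t) (Set.toFinite T)
    omega

theorem zmod_three_cases : ∀ b : ZMod 3, b = 0 ∨ b = 1 ∨ b = -1 := by decide

section Nine

variable {R V : Type} [Group R] [AddCommGroup V] [DistribMulAction R V] [Module (ZMod 3) V]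

theorem smul_zmod_smul (g : R) (a : ZMod 3) (v : V) : g • (a • v) = a • (g • v) :=
  ZMod.map_smul (DistribSMul.toAddMonoidHom V g) a v

theorem exists_coord {W : AddSubgroup V} (hW : Nat.card W = 9) {w w' : V} (hw : w ∈ W)
    (hw' : w' ∈ W) (hw0 : w ≠ 0) (hind : ∀ c : ZMod 3, w' ≠ c • w) :
    ∀ x ∈ W, ∃ a b : ZMod 3, x = a • w + b • w' := by
  have : Fact (Nat.Prime 3) := ⟨Nat.prime_three⟩
  have hsm : ∀ (a : ZMod 3), ∀ v ∈ W, a • v ∈ W := fun a v hv => ZMod.smul_mem hv a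
  let f : ZMod 3 × ZMod 3 → W := fun p =>
    ⟨p.1 • w + p.2 • w', W.add_mem (hsm _ _ hw) (hsm _ _ hw')⟩
  have hinj : Function.Injective f := by
    rintro ⟨a, b⟩ ⟨a', b'⟩ h
    have h1 : a • w + b • w' = a' • w + b' • w' := congrArg Subtype.val h
    have h2 : (a - a') • w = (b' - b) • w' := by
      rw [sub_smul, sub_smul, sub_eq_sub_iff_add_eq_add, h1, add_comm]
    have hb : b' - b = 0 := by
      by_contra hb
      refine hind ((b' - b)⁻¹ * (a - a')) ?_
      rw [mul_smul, h2, smul_smul, inv_mul_cancel₀ hb, one_smul]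
    rw [hb, zero_smul] at h2
    have ha := (smul_eq_zero.1 h2).resolve_right hw0
    rw [sub_eq_zero] at ha hb
    rw [ha, hb]
  have : Finite W := Nat.finite_of_card_ne_zero (by omega)
  have hbij := (Nat.bijective_iff_injective_and_card f).2 ⟨hinj, by simp [hW]⟩
  intro x hx
  obtain ⟨⟨a, b⟩, h⟩ := hbij.2 ⟨x, hx⟩
  exact ⟨a, b, (congrArg Subtype.val h).symm⟩

theorem exists_independent {W : AddSubgroup V} (hW : Nat.card W = 9) (w : V) :
    ∃ w' ∈ W, ∀ c : ZMod 3, w' ≠ c • w := by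
  by_contra! h
  have h1 : (W : Set V) ⊆ Set.range fun c : ZMod 3 => c • w := fun x hx => by
    obtain ⟨c, hc⟩ := h x hx
    exact ⟨c, hc.symm⟩
  have h2 := Set.ncard_le_ncard h1 (Set.finite_range _)
  have h3 : (Set.range fun c : ZMod 3 => c • w).ncard ≤ 3 := by
    rw [← Set.image_univ]
    exact (Set.ncard_image_le Set.finite_univ).trans (by simp)
  have h4 : (W : Set V).ncard = 9 := hW
  omega

omit [Module (ZMod 3) V] in
theorem pow_six_smul_eq {g : R} {m : ℕ} (hg : g ^ 2 ^ m = 1) {v : V} (h : g ^ 6 • v = v) :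
    g ^ 2 • v = v := by
  have h1 : g ^ 6 ∈ MulAction.stabilizer R v := h
  have h2 : ∃ k, (g ^ 2) ^ 3 ^ k = g ^ 2 ∧ 0 < k := by
    refine ⟨2 ^ m, ?_, by positivity⟩
    have h3 : 3 ^ 2 ^ m ≡ 1 [MOD 2 ^ m] := by
      rcases m with _ | m
      · exact Nat.modEq_one
      · have h5 : 3 ^ (2 ^ (m + 1)).totient ≡ 1 [MOD 2 ^ (m + 1)] :=
          Nat.ModEq.pow_totient (Nat.Coprime.pow_right _ (by norm_num))
        rw [Nat.totient_prime_pow_succ Nat.prime_two] at h5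
        have h6 := h5.pow 2
        rw [← pow_mul] at h6
        simpa [pow_succ] using h6
    have h4 : (g ^ 2) ^ 3 ^ 2 ^ m = (g ^ 2) ^ 1 := by
      rw [pow_eq_pow_iff_modEq]
      refine h3.of_dvd (orderOf_dvd_of_pow_eq_one ?_)
      rw [← pow_mul, mul_comm, pow_mul, hg, one_pow]
    rwa [pow_one] at h4
  obtain ⟨k, hk, hk0⟩ := h2
  obtain ⟨k, rfl⟩ : ∃ l, k = l + 1 := ⟨k - 1, by omega⟩
  have h5 := Subgroup.pow_mem _ h1 (3 ^ k)
  have h6 : (g ^ 6) ^ 3 ^ k = g ^ 2 := by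
    rw [← hk, ← pow_mul, ← pow_mul]
    congr 1
    ring
  rw [h6] at h5
  exact h5

variable {W : AddSubgroup V}

/-- A `2`-element fixing a nonzero vector of a plane over the field with three elements is either
trivial or a reflection. -/
theorem smul_eq_self_or_reflection (hW : Nat.card W = 9) {w w' : V} (hw : w ∈ W)
    (hw' : w' ∈ W) (hw0 : w ≠ 0) (hind : ∀ c : ZMod 3, w' ≠ c • w) {g : R} {m : ℕ}
    (hg : g ^ 2 ^ m = 1) (hgW : ∀ v ∈ W, g • v ∈ W) (hgw : g • w = w) :
    (∀ v ∈ W, g • v = v) ∨ ∃ c : ZMod 3, g • w' = c • w - w' := by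
  obtain ⟨a, b, hab⟩ := exists_coord hW hw hw' hw0 hind _ (hgW _ hw')
  have hb : b = 0 ∨ b = 1 ∨ b = -1 := zmod_three_cases b
  rcases hb with rfl | rfl | rfl
  · exfalso
    refine hind a ?_
    have : g • w' = g • (a • w) := by rw [hab, smul_zmod_smul, hgw]; simp
    exact smul_left_cancel g this
  · left
    have h2 : g ^ 2 • w' = w' := by
      refine pow_six_smul_eq hg ?_
      have h1 : ∀ n : ℕ, g ^ n • w' = ((n : ZMod 3) * a) • w + w' := by
        intro n
        induction n with
        | zero => simp
        | succ n ih =>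
          rw [pow_succ', mul_smul, ih, smul_add, smul_zmod_smul, hgw, hab, Nat.cast_succ,
            add_mul, add_smul, one_mul, one_smul, add_assoc]
      rw [h1, show ((6 : ℕ) : ZMod 3) = 0 from rfl, zero_mul, zero_smul, zero_add]
    have h3 : ((2 : ZMod 3) * a) • w = 0 := by
      rw [pow_two, mul_smul, hab, one_smul, smul_add, smul_zmod_smul, hgw, hab, one_smul,
        ← add_assoc, add_eq_right] at h2
      rw [two_mul, add_smul, h2]
    have h20 : (2 : ZMod 3) ≠ 0 := by decide
    have : Fact (Nat.Prime 3) := ⟨Nat.prime_three⟩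
    have h4 := (smul_eq_zero.1 h3).resolve_right hw0
    have ha : a = 0 := (mul_eq_zero.1 h4).resolve_left h20
    intro v hv
    obtain ⟨c, d, rfl⟩ := exists_coord hW hw hw' hw0 hind v hv
    rw [smul_add, smul_zmod_smul, smul_zmod_smul, hgw, hab, ha, zero_smul, zero_add, one_smul]
  · right
    exact ⟨a, by rw [hab, neg_smul, one_smul, sub_eq_add_neg]⟩

/-- Two nontrivial `2`-elements of a `2`-group fixing the same nonzero vector act in the
same way. -/
theorem inv_mul_smul_eq_self (hW : Nat.card W = 9) (hR : ∀ g : R, ∃ m, g ^ 2 ^ m = 1) {w : V}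
    (hw : w ∈ W) (hw0 : w ≠ 0) {g h : R} (hgW : ∀ v ∈ W, g • v ∈ W)
    (hhW : ∀ v ∈ W, h • v ∈ W) (hghW : ∀ v ∈ W, (g⁻¹ * h) • v ∈ W) (hgw : g • w = w)
    (hhw : h • w = w)
    (hg : ¬ ∀ v ∈ W, g • v = v) (hh : ¬ ∀ v ∈ W, h • v = v) :
    ∀ v ∈ W, (g⁻¹ * h) • v = v := by
  obtain ⟨w', hw', hind⟩ := exists_independent hW w
  obtain ⟨m, hm⟩ := hR g
  obtain ⟨m', hm'⟩ := hR h
  obtain ⟨m'', hm''⟩ := hR (g⁻¹ * h)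
  obtain ⟨a, ha⟩ := (smul_eq_self_or_reflection hW hw hw' hw0 hind hm hgW hgw).resolve_left hg
  obtain ⟨b, hb⟩ := (smul_eq_self_or_reflection hW hw hw' hw0 hind hm' hhW hhw).resolve_left hh
  have hgw' : g⁻¹ • w = w := by rw [inv_smul_eq_iff, hgw]
  refine (smul_eq_self_or_reflection hW hw hw' hw0 hind hm'' hghW
    (by rw [mul_smul, hhw, hgw'])).resolve_right ?_
  rintro ⟨c, hc⟩
  rw [mul_smul, inv_smul_eq_iff, hb, smul_sub, smul_zmod_smul, hgw, ha] at hc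
  have h2 : (2 : ZMod 3) • w' = (b + a - c) • w := by
    linear_combination (norm := module) (-1 : ZMod 3) • hc
  refine hind (2 * (b + a - c)) ?_
  rw [mul_smul, ← h2, smul_smul, show (2 * 2 : ZMod 3) = 1 from rfl, one_smul]

end Nine

section Nine

variable {R V : Type} [Group R] [AddCommGroup V] [DistribMulAction R V] [Module (ZMod 3) V]

theorem false_of_smul_eq {w v : V} (hw0 : w ≠ 0) (hind : ∀ c : ZMod 3, v ≠ c • w) {y : R} {m : ℕ}
    (hy : y ^ 2 ^ m = 1) (hy4 : y ^ 4 = 1) (hyw : y • w = v) {a b : ZMod 3} (hb0 : b ≠ 0)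
    (hyv : y • v = a • w + b • v) : False := by
  have hF : Fact (Nat.Prime 3) := ⟨Nat.prime_three⟩
  have hbb : b * b = 1 := by
    rcases zmod_three_cases b with rfl | rfl | rfl
    · exact absurd rfl hb0
    · rfl
    · rfl
  have h3 : y ^ 3 • w = (a * b) • w + (a + 1) • v := by
    rw [show y ^ 3 = y * (y * y) from by rw [pow_succ', pow_two], mul_smul, mul_smul, hyw, hyv, smul_add,
      smul_zmod_smul, smul_zmod_smul, hyw, hyv, smul_add, smul_smul, smul_smul, hbb]
    module
  rcases zmod_three_cases a with rfl | rfl | rfl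
  · refine hind b (smul_left_cancel y ?_)
    rw [hyv, smul_zmod_smul, hyw]; simp
  · have h4 : y ^ 4 • w = (2 : ZMod 3) • w + (3 * b) • v := by
      rw [pow_succ', mul_smul, h3, smul_add, smul_zmod_smul,
        smul_zmod_smul, hyw, hyv]
      module
    rw [hy4, one_smul, show (3 : ZMod 3) = 0 from rfl, zero_mul, zero_smul, add_zero] at h4
    have h5 : (1 : ZMod 3) • w = 0 := by
      linear_combination (norm := module) (-1 : ZMod 3) • h4
    exact hw0 (by simpa using h5)
  · rw [neg_add_cancel, zero_smul, add_zero, neg_one_mul] at h3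
    have h6 : y ^ 6 • w = w := by
      rw [show y ^ 6 = y ^ 3 * y ^ 3 from pow_add y 3 3, mul_smul, h3, smul_zmod_smul, h3, smul_smul,
        neg_mul_neg, hbb, one_smul]
    have h2 := pow_six_smul_eq hy h6
    rw [pow_two, mul_smul, hyw, hyv] at h2
    refine hind (b * 2) ?_
    have h7 : b • v = (2 : ZMod 3) • w := by
      linear_combination (norm := module) (1 : ZMod 3) • h2
    rw [mul_smul, ← h7, smul_smul, hbb, one_smul]

variable {W : AddSubgroup V} [Finite R]

/-- A group of order `16` acting faithfully on a plane over the field with three elements has an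
element of order at least `8`. -/
theorem exists_pow_four_ne_one (hW : Nat.card W = 9) (Y : Subgroup R)
    (hR : ∀ g : R, ∃ m, g ^ 2 ^ m = 1)
    (hYW : ∀ y ∈ Y, ∀ v ∈ W, y • v ∈ W) (hY : Nat.card Y = 16)
    (hfaith : ∀ y ∈ Y, (∀ v ∈ W, y • v = v) → y = 1) : ∃ y ∈ Y, y ^ 4 ≠ 1 := by
  by_contra! h4
  obtain ⟨w, hw, hind0⟩ := exists_independent hW (0 : V)
  have hw0 : w ≠ 0 := by simpa using hind0 0
  have hstab : Nat.card (MulAction.stabilizer Y w) ≤ 2 := by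
    have h1 : {y : R | y ∈ Y ∧ y • w = w}.ncard ≤ 2 * ({1} : Set R).ncard := by
      refine ncard_le_two_mul ?_
      rintro x ⟨hx, hxw⟩ y ⟨hy, hyw⟩ hx1 hy1
      refine hfaith _ (Y.mul_mem (Y.inv_mem hx) hy) ?_
      exact inv_mul_smul_eq_self hW hR hw hw0 (hYW x hx) (hYW y hy)
        (hYW _ (Y.mul_mem (Y.inv_mem hx) hy)) hxw hyw (fun h => hx1 (hfaith x hx h))
        (fun h => hy1 (hfaith y hy h))
    rw [Set.ncard_singleton, mul_one, ← Nat.card_coe_set_eq] at h1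
    refine (Nat.card_le_card_of_injective (fun y : MulAction.stabilizer Y w =>
      (⟨y.1.1, y.1.2, y.2⟩ : {y : R | y ∈ Y ∧ y • w = w})) ?_).trans h1
    intro y y' h
    exact Subtype.ext (Subtype.ext (Subtype.mk.inj h))
  have : Finite W := Nat.finite_of_card_ne_zero (by omega)
  have horb_sub : MulAction.orbit Y w ⊆ (W : Set V) \ {0} := by
    rintro _ ⟨y, rfl⟩
    refine ⟨hYW y y.2 w hw, ?_⟩
    exact (smul_ne_zero_iff_ne y).2 hw0
  have h8 : ((W : Set V) \ {0}).ncard = 8 := by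
    rw [Set.ncard_sdiff_singleton_of_mem W.zero_mem]
    change Nat.card W - 1 = 8
    omega
  have hfinW : (W : Set V).Finite := Set.toFinite (W : Set V)
  have hle := Set.ncard_le_ncard horb_sub (hfinW.sdiff)
  have hmul := (MulAction.stabilizer Y w).card_mul_index
  rw [MulAction.index_stabilizer, hY] at hmul
  have hstab2 : Nat.card (MulAction.stabilizer Y w) = 2 := by
    by_contra hne
    have : Nat.card (MulAction.stabilizer Y w) ≤ 1 := by omega
    have : Nat.card (MulAction.stabilizer Y w) * (MulAction.orbit Y w).ncard ≤ 1 * 8 :=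
      Nat.mul_le_mul this (h8 ▸ hle)
    omega
  have horb : MulAction.orbit Y w = (W : Set V) \ {0} := by
    refine Set.eq_of_subset_of_ncard_le horb_sub ?_ hfinW.sdiff
    rw [hstab2] at hmul
    omega
  obtain ⟨ρ, hρ1⟩ : ∃ ρ : MulAction.stabilizer Y w, ρ ≠ 1 := by
    have : Nontrivial (MulAction.stabilizer Y w) :=
      (Finite.one_lt_card_iff_nontrivial).1 (by omega)
    exact exists_ne 1
  have hρw : (ρ.1 : R) • w = w := ρ.2
  have hρne : ¬ ∀ v ∈ W, (ρ.1 : R) • v = v := fun h =>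
    hρ1 (Subtype.ext (Subtype.ext (hfaith _ ρ.1.2 h)))
  obtain ⟨m, hm⟩ := hR ρ.1
  obtain ⟨w', hw', hind⟩ := exists_independent hW w
  obtain ⟨c, hc⟩ := (smul_eq_self_or_reflection hW hw hw' hw0 hind hm (hYW _ ρ.1.2)
    hρw).resolve_left hρne
  set v : V := w' + (c + 1) • w with hv
  have hsm : ∀ (a : ZMod 3), ∀ v ∈ W, a • v ∈ W := fun a v hv => ZMod.smul_mem hv a
  have hvW : v ∈ W := W.add_mem hw' (hsm _ _ hw)
  have hindv : ∀ a : ZMod 3, v ≠ a • w := by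
    intro a ha
    refine hind (a - (c + 1)) ?_
    rw [sub_smul, ← ha, hv]; abel
  have hρv : (ρ.1 : R) • v = (-1 : ZMod 3) • w + (-1 : ZMod 3) • v := by
    have h30 : (3 : ZMod 3) • (c • w + w) = 0 := by
      rw [show (3 : ZMod 3) = 0 from rfl, zero_smul]
    rw [hv, smul_add, hc, smul_zmod_smul, hρw]
    linear_combination (norm := module) (1 : ZMod 3) • h30
  have hv0 : v ≠ 0 := by simpa using hindv 0
  obtain ⟨y, hy⟩ : v ∈ MulAction.orbit Y w := by
    rw [horb]; exact ⟨hvW, hv0⟩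
  have hyw : (y : R) • w = v := hy
  obtain ⟨a, b, hab⟩ := exists_coord hW hw hvW hw0 hindv _ (hYW y y.2 v hvW)
  by_cases hb : b = 0
  · have hyρw : ((y : R) * ρ.1) • w = v := by rw [mul_smul, hρw, hyw]
    have hyρv : ((y : R) * ρ.1) • v = (-a) • w + (-1 : ZMod 3) • v := by
      rw [mul_smul, hρv, smul_add, smul_zmod_smul, smul_zmod_smul, hyw, hab, hb]
      module
    obtain ⟨m, hm⟩ := hR (y * ρ.1)
    exact false_of_smul_eq hw0 hindv hm (h4 _ (Y.mul_mem y.2 ρ.1.2)) hyρw (by decide) hyρv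
  · obtain ⟨m, hm⟩ := hR y
    exact false_of_smul_eq hw0 hindv hm (h4 _ y.2) hyw hb hab

end Nine

section

namespace TwoBlocks

variable {R V : Type} [Group R] [AddCommGroup V]
  [DistribMulAction R V] {V₁ V₂ : AddSubgroup V}

theorem eq_one [FaithfulSMul R V] (h : TwoBlocks R V₁ V₂) {g : R} (h1 : ∀ v ∈ V₁, g • v = v)
    (h2 : ∀ v ∈ V₂, g • v = v) : g = 1 := by
  refine FaithfulSMul.eq_of_smul_eq_smul fun v : V => ?_
  obtain ⟨x, hx, y, hy, rfl⟩ := h.exists_add v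
  rw [smul_add, h1 x hx, h2 y hy, one_smul]

theorem smul_mem (h : TwoBlocks R V₁ V₂) {v : V} (hv : v ∈ V₁) (hv0 : v ≠ 0) {g : R}
    (hg : g • v = v) : (∀ x ∈ V₁, g • x ∈ V₁) ∧ ∀ x ∈ V₂, g • x ∈ V₂ := by
  refine (h.stable g).resolve_right fun h1 => hv0 (h.disjoint v hv ?_)
  have := h1.1 v hv
  rwa [hg] at this

variable [Module (ZMod 3) V] [Finite R] [FaithfulSMul R V]

theorem ncard_fixing_le_two (h : TwoBlocks R V₁ V₂) (hR : ∀ g : R, ∃ m, g ^ 2 ^ m = 1)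
    (h9 : Nat.card V₁ = 9) {v : V} (hv : v ∈ V₁) (hv0 : v ≠ 0) :
    {g : R | g • v = v ∧ ∀ x ∈ V₂, g • x = x}.ncard ≤ 2 := by
  have h1 : {g : R | g • v = v ∧ ∀ x ∈ V₂, g • x = x}.ncard ≤ 2 * ({1} : Set R).ncard := by
    refine ncard_le_two_mul ?_
    rintro x ⟨hxv, hx2⟩ y ⟨hyv, hy2⟩ hx1 hy1
    have hxyv : (x⁻¹ * y) • v = v := by rw [mul_smul, hyv, inv_smul_eq_iff, hxv]
    refine h.eq_one (inv_mul_smul_eq_self h9 hR hv hv0 (h.smul_mem hv hv0 hxv).1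
      (h.smul_mem hv hv0 hyv).1 (h.smul_mem hv hv0 hxyv).1 hxv hyv
      (fun h' => hx1 (h.eq_one h' hx2)) (fun h' => hy1 (h.eq_one h' hy2))) fun z hz => ?_
    rw [mul_smul, hy2 z hz, inv_smul_eq_iff, hx2 z hz]
  simpa using h1

theorem card_stabilizer_add_le (h : TwoBlocks R V₁ V₂) (hR : ∀ g : R, ∃ m, g ^ 2 ^ m = 1)
    (h9 : Nat.card V₁ = 9) (h9' : Nat.card V₂ = 9) {v w : V} (hv : v ∈ V₁) (hv0 : v ≠ 0)
    (hw : w ∈ V₂) (hw0 : w ≠ 0) : Nat.card (MulAction.stabilizer R (v + w)) ≤ 8 := by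
  have h1 : (MulAction.stabilizer R (v + w) : Set R).ncard ≤
      2 * {g : R | g • v = v ∧ g • w = w}.ncard := by
    have key : ∀ x : R, x • (v + w) = v + w → ¬ (x • v = v ∧ x • w = w) →
        x • v = w ∧ x • w = v := by
      intro x hx hx'
      rw [smul_add] at hx
      rcases h.stable x with hs | hs
      · exact absurd (h.add_inj (hs.1 v hv) hv (hs.2 w hw) hw hx) hx'
      · rw [add_comm] at hx
        exact (h.add_inj (hs.2 w hw) hv (hs.1 v hv) hw hx).symm
    refine ncard_le_two_mul ?_
    intro x hx y hy hx1 hy1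
    obtain ⟨x1, x2⟩ := key x hx hx1
    obtain ⟨y1, y2⟩ := key y hy hy1
    refine ⟨?_, ?_⟩
    · rw [mul_smul, y1, inv_smul_eq_iff, x1]
    · rw [mul_smul, y2, inv_smul_eq_iff, x2]
  have h2 : {g : R | g • v = v ∧ g • w = w}.ncard ≤
      2 * {g : R | g • v = v ∧ ∀ x ∈ V₂, g • x = x}.ncard := by
    refine ncard_le_two_mul ?_
    rintro x ⟨hxv, hxw⟩ y ⟨hyv, hyw⟩ hx1 hy1
    have hxyv : (x⁻¹ * y) • v = v := by rw [mul_smul, hyv, inv_smul_eq_iff, hxv]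
    refine ⟨hxyv, inv_mul_smul_eq_self h9' hR hw hw0 (h.smul_mem hv hv0 hxv).2
      (h.smul_mem hv hv0 hyv).2 (h.smul_mem hv hv0 hxyv).2 hxw hyw
      (fun h' => hx1 ⟨hxv, h'⟩) fun h' => hy1 ⟨hyv, h'⟩⟩
  have h3 := h.ncard_fixing_le_two hR h9 hv hv0
  have h4 : (MulAction.stabilizer R (v + w) : Set R).ncard =
    Nat.card (MulAction.stabilizer R (v + w)) := rfl
  omega

variable {Z : R → R → Prop}

omit [Module (ZMod 3) V] [FaithfulSMul R V] in
/-- If the vector `v` of one block has a stabilizer of order `4`, and the sums of `v` and vectors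
in the other block have trivial stabilizers, we reach a contradiction. -/
theorem false_of_card_stabilizer_eq_four (hZ : CommRelation Z)
    (hCB : ∀ (v : V) (B : Subgroup R), B ≤ MulAction.stabilizer R v →
      (∀ x ∈ B, ∀ y ∈ B, Z x y) → Nat.card B ^ 2 ≤ Nat.card (MulAction.stabilizer R v))
    (h : TwoBlocks R V₁ V₂) {v w : V} (hv : v ∈ V₁) (hv0 : v ≠ 0) (hw : w ∈ V₂) (hw0 : w ≠ 0)
    (hY : Nat.card (MulAction.stabilizer R v) = 4)
    (hX : ∀ w ∈ V₂, w ≠ 0 → Nat.card (MulAction.stabilizer R (v + w)) = 1) : False := by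
  have hfree : ∀ g : R, g • v = v → ∀ w ∈ V₂, w ≠ 0 → g • w = w → g = 1 := by
    intro g hg w hw hw0 hgw
    have h1 := hX w hw hw0
    rw [Subgroup.card_eq_one] at h1
    have h2 : g ∈ MulAction.stabilizer R (v + w) := by
      rw [MulAction.mem_stabilizer_iff, smul_add, hg, hgw]
    rwa [h1, Subgroup.mem_bot] at h2
  have hsq : ∀ g : R, g • v = v → g * g = 1 := by
    intro g hg
    have h1 := hCB v (Subgroup.zpowers g) (by rwa [Subgroup.zpowers_le]) (hZ.zpowers g)
    rw [Nat.card_zpowers, hY] at h1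
    have h2 : orderOf g ≤ 2 := by nlinarith
    have h3 : orderOf g ≠ 0 := (orderOf_pos g).ne'
    have h4 : orderOf g ∣ 2 := by
      interval_cases orderOf g <;> simp_all
    rw [← pow_two]
    exact orderOf_dvd_iff_pow_eq_one.1 h4
  have hneg : ∀ g : R, g • v = v → g ≠ 1 → g • w = -w := by
    intro g hg hg1
    by_contra hne
    have h1 : w + g • w ≠ 0 := fun h0 => hne (eq_neg_of_add_eq_zero_right h0)
    refine hg1 (hfree g hg (w + g • w) (V₂.add_mem hw ((h.smul_mem hv hv0 hg).2 w hw)) h1 ?_)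
    rw [smul_add, smul_smul, hsq g hg, one_smul, add_comm]
  have h1 : (MulAction.stabilizer R v : Set R).ncard ≤ 2 * ({1} : Set R).ncard := by
    refine ncard_le_two_mul ?_
    intro x hx y hy hx1 hy1
    refine hfree _ ((MulAction.stabilizer R v).mul_mem
      ((MulAction.stabilizer R v).inv_mem hx) hy) w hw hw0 ?_
    rw [mul_smul, hneg y hy hy1, inv_smul_eq_iff, hneg x hx hx1]
  have h2 : (MulAction.stabilizer R v : Set R).ncard = 4 := hY
  rw [Set.ncard_singleton] at h1
  omega

/-- Stabilizers of order `16` of block vectors, and of order `4` of generic vectors, are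
impossible. -/
theorem false_of_card_stabilizer_eq_sixteen (hZ : CommRelation Z)
    (hCB : ∀ (v : V) (B : Subgroup R), B ≤ MulAction.stabilizer R v →
      (∀ x ∈ B, ∀ y ∈ B, Z x y) → Nat.card B ^ 2 ≤ Nat.card (MulAction.stabilizer R v))
    (h : TwoBlocks R V₁ V₂) (hR : ∀ g : R, ∃ m, g ^ 2 ^ m = 1)
    (h9 : Nat.card V₁ = 9) (h9' : Nat.card V₂ = 9) {v : V} (hv : v ∈ V₁) (hv0 : v ≠ 0)
    (hY : Nat.card (MulAction.stabilizer R v) = 16)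
    (hX : ∀ w ∈ V₂, w ≠ 0 → Nat.card (MulAction.stabilizer R (v + w)) = 4) : False := by
  set Y := MulAction.stabilizer R v with hYdef
  have hYV : ∀ y ∈ Y, ∀ x ∈ V₂, y • x ∈ V₂ := fun y hy => (h.smul_mem hv hv0 hy).2
  by_cases hD : ∀ y ∈ Y, (∀ x ∈ V₂, y • x = x) → y = 1
  · obtain ⟨y, hy, hy4⟩ := exists_pow_four_ne_one h9' Y hR hYV hY hD
    have h1 := hCB v (Subgroup.zpowers y) (by rwa [Subgroup.zpowers_le]) (hZ.zpowers y)
    rw [Nat.card_zpowers, ← hYdef, hY] at h1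
    have h2 : orderOf y ≤ 4 := by nlinarith
    obtain ⟨m, hm⟩ := hR y
    obtain ⟨k, -, hk⟩ := (Nat.dvd_prime_pow Nat.prime_two).1 (orderOf_dvd_of_pow_eq_one hm)
    refine hy4 (orderOf_dvd_iff_pow_eq_one.1 ?_)
    rw [hk] at h2 ⊢
    have h3 : 2 ^ k ≤ 2 ^ 2 := h2
    exact pow_dvd_pow 2 ((Nat.pow_le_pow_iff_right (by norm_num)).1 h3)
  push Not at hD
  obtain ⟨d, hdY, hd2, hd1⟩ := hD
  have hD2 := h.ncard_fixing_le_two hR h9 hv hv0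
  set D : Set R := {g : R | g • v = v ∧ ∀ x ∈ V₂, g • x = x} with hDdef
  have hdD : d ∈ D := ⟨hdY, hd2⟩
  have h1D : (1 : R) ∈ D := ⟨one_smul _ _, fun x _ => one_smul _ _⟩
  have hDmem : ∀ g ∈ D, g = 1 ∨ g = d := by
    intro g hg
    by_contra! hne
    have h1 : ({1, d, g} : Set R) ⊆ D := by
      rintro x (rfl | rfl | rfl) <;> assumption
    have h2 := Set.ncard_le_ncard h1
    rw [Set.ncard_eq_three.2 ⟨1, d, g, hd1.symm, hne.1.symm, hne.2.symm, rfl⟩] at h2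
    omega
  have hdd : d * d = 1 := by
    have h1 : d * d ∈ D := ⟨by rw [mul_smul, hdY, hdY],
      fun x hx => by rw [mul_smul, hd2 x hx, hd2 x hx]⟩
    exact (hDmem _ h1).resolve_right fun h2 => hd1 (by simpa using h2)
  have hcent : ∀ y ∈ Y, d * y = y * d := by
    intro y hy
    have hy' : y⁻¹ • v = v := Y.inv_mem hy
    have h1 : y * d * y⁻¹ ∈ D := by
      refine ⟨by rw [mul_smul, mul_smul, hy', hdY, hy], fun x hx => ?_⟩
      rw [mul_smul, mul_smul, hd2 _ (hYV _ (Y.inv_mem hy) x hx), smul_inv_smul]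
    rcases hDmem _ h1 with h2 | h2
    · exact absurd (by simpa using h2) hd1
    · rw [mul_inv_eq_iff_eq_mul] at h2
      exact h2.symm
  obtain ⟨y, hy, hZy, hyne, hyneg⟩ : ∃ y ∈ Y, Z d y ∧ (¬ ∀ x ∈ V₂, y • x = x) ∧
      ¬ ∀ x ∈ V₂, y • x = -x := by
    by_contra! hcon
    have h1 : (Y : Set R).ncard ≤ 2 * {y : R | y ∈ Y ∧ Z d y}.ncard := by
      refine ncard_le_two_mul ?_
      intro x hx y hy hx1 hy1
      refine ⟨Y.mul_mem (Y.inv_mem hx) hy, hZ.involution d _ _ hdd (hcent _ (Y.inv_mem hx))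
        (hcent y hy) (fun h' => hx1 ⟨hx, ?_⟩) fun h' => hy1 ⟨hy, h'⟩⟩
      have := hZ.inv _ _ h'
      rwa [inv_inv] at this
    have h2 : {y : R | y ∈ Y ∧ Z d y}.ncard ≤ 2 * D.ncard := by
      refine ncard_le_two_mul ?_
      rintro x ⟨hx, hxZ⟩ y ⟨hy, hyZ⟩ hx1 hy1
      have hx' := hcon x hx hxZ (by
        by_contra! hc; exact hx1 ⟨hx, hc⟩)
      have hy' := hcon y hy hyZ (by
        by_contra! hc; exact hy1 ⟨hy, hc⟩)
      refine ⟨Y.mul_mem (Y.inv_mem hx) hy, fun z hz => ?_⟩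
      rw [mul_smul, hy' z hz, inv_smul_eq_iff, hx' z hz]
    have h3 : (Y : Set R).ncard = 16 := hY
    omega
  have hy1 : y ≠ 1 := by
    rintro rfl; exact hyne fun x _ => one_smul _ _
  have hyd : y ≠ d := by
    rintro rfl; exact hyne hd2
  set B := Subgroup.closure ({d, y} : Set R) with hB
  have hdB : d ∈ B := Subgroup.subset_closure (by simp)
  have hyB : y ∈ B := Subgroup.subset_closure (by simp)
  have hBZ : ∀ x ∈ B, ∀ x' ∈ B, Z x x' := by
    refine hZ.closure ?_
    rintro a (rfl | rfl) b (rfl | rfl)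
    · exact hZ.refl _
    · exact hZy
    · exact hZ.symm _ _ hZy
    · exact hZ.refl _
  have hBle : ∀ u : V, d • u = u → y • u = u → B ≤ MulAction.stabilizer R u := by
    intro u h1 h2
    rw [hB, Subgroup.closure_le]
    rintro a (rfl | rfl) <;> assumption
  have hBcard := hCB v B (hBle v hdY hy) hBZ
  rw [← hYdef, hY] at hBcard
  have hB4 : (B : Set R).ncard ≤ 4 := by
    change Nat.card B ≤ 4
    nlinarith
  have h4sub : ({1, d, y, y * d} : Set R) ⊆ B := by
    rintro x (rfl | rfl | rfl | rfl)
    · exact B.one_mem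
    · exact hdB
    · exact hyB
    · exact B.mul_mem hyB hdB
  have hdne : d ≠ y * d := fun e => hy1 (by simpa using e)
  have hyne' : y ≠ y * d := fun e => hd1 (by simpa using e)
  have h1ne : (1 : R) ≠ y * d := fun e => hyd (by
    rw [eq_comm, mul_eq_one_iff_eq_inv] at e
    rw [e, inv_eq_iff_mul_eq_one, hdd])
  have h4card : ({1, d, y, y * d} : Set R).ncard = 4 := by
    rw [Set.ncard_insert_of_notMem (by simp [hd1.symm, hy1.symm, h1ne]),
      Set.ncard_insert_of_notMem (by simp [hyd.symm, hdne]), Set.ncard_pair hyne']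
  have hBeq := Set.eq_of_subset_of_ncard_le h4sub (by omega)
  have hysq : ∀ x ∈ V₂, y • y • x = x := by
    have h1 : y * y ∈ ({1, d, y, y * d} : Set R) := by
      rw [hBeq]; exact B.mul_mem hyB hyB
    intro x hx
    rw [smul_smul]
    rcases h1 with h1 | h1 | h1 | h1
    · rw [h1, one_smul]
    · rw [h1, hd2 x hx]
    · exact absurd (by simpa using h1) hy1
    · exact absurd (mul_left_cancel h1) hyd
  push Not at hyneg
  obtain ⟨x, hx, hxne⟩ := hyneg
  have hw0 : x + y • x ≠ 0 := fun h0 => hxne (eq_neg_of_add_eq_zero_right h0)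
  have hw : x + y • x ∈ V₂ := V₂.add_mem hx (hYV y hy x hx)
  have hyw : y • (x + y • x) = x + y • x := by rw [smul_add, hysq x hx, add_comm]
  have hyv : y • v = v := hy
  have hdv : d • v = v := hdY
  have h5 := hCB (v + (x + y • x)) B (hBle _ (by rw [smul_add, hdv, hd2 _ hw])
    (by rw [smul_add, hyv, hyw])) hBZ
  rw [hX _ hw hw0] at h5
  have h6 : Nat.card B = 4 := by
    change (B : Set R).ncard = 4
    rw [← hBeq, h4card]
  rw [h6] at h5
  omega

omit [Module (ZMod 3) V] in
theorem not_distinctEvenOrbits [Finite V] (hZ : CommRelation Z)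
    (hCB : ∀ (v : V) (B : Subgroup R), B ≤ MulAction.stabilizer R v →
      (∀ x ∈ B, ∀ y ∈ B, Z x y) → Nat.card B ^ 2 ≤ Nat.card (MulAction.stabilizer R v))
    (h : TwoBlocks R V₁ V₂) {p : ℕ} (hp : p.Prime) (hpV : ∀ v : V, p • v = 0)
    (h2 : 2 ≤ Nat.card V₁) : ¬ DistinctEvenOrbits 2 R V := by
  intro hD
  obtain ⟨h9, hax, hgen⟩ := h.card_eq_nine hD hp hpV h2
  have h9' : Nat.card V₂ = 9 := h.card_eq ▸ h9
  have hne : ∀ W : AddSubgroup V, Nat.card W = 9 → ∃ v ∈ W, v ≠ 0 := by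
    intro W hW
    have : Nontrivial W := Finite.one_lt_card_iff_nontrivial.1 (by omega)
    obtain ⟨v, hv⟩ := exists_ne (0 : W)
    exact ⟨v, v.2, fun h0 => hv (Subtype.ext h0)⟩
  obtain ⟨v, hv, hv0⟩ := hne V₁ h9
  obtain ⟨w, hw, hw0⟩ := hne V₂ h9'
  obtain rfl : p = 3 := by
    have := Fact.mk hp
    have h1 : addOrderOf (⟨v, hv⟩ : V₁) = p :=
      addOrderOf_eq_prime (Subtype.ext (hpV v)) fun h0 => hv0 (congrArg Subtype.val h0)
    have h3 := addOrderOf_dvd_natCard (⟨v, hv⟩ : V₁)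
    rw [h1, h9, show 9 = 3 ^ 2 from rfl] at h3
    exact (Nat.prime_dvd_prime_iff_eq hp Nat.prime_three).1 (hp.dvd_of_dvd_pow h3)
  let _ : Module (ZMod 3) V := AddCommGroup.zmodModule hpV
  obtain ⟨C, hC⟩ := hD.card_group
  have hR : ∀ g : R, ∃ m, g ^ 2 ^ m = 1 := fun g => ⟨2 * C, by rw [← hC, pow_card_eq_one']⟩
  have hcard : ∀ u : V, Nat.card (MulAction.stabilizer R u) * Nat.card (MulAction.orbit R u) =
      Nat.card R := fun u => by
    have := (MulAction.stabilizer R u).card_mul_index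
    rwa [MulAction.index_stabilizer] at this
  have hv16 := hcard v
  rw [hax v ⟨hv0, Or.inl hv⟩] at hv16
  have h64 : ∀ w ∈ V₂, w ≠ 0 → Nat.card (MulAction.stabilizer R (v + w)) * 64 = Nat.card R := by
    intro w hw hw0
    rw [← hcard (v + w), hgen _ (h.add_mem_generic hv hw hv0 hw0)]
  have hle := h.card_stabilizer_add_le hR h9 h9' hv hv0 hw hw0
  have hw64 := h64 w hw hw0
  obtain ⟨c, hc⟩ := hD.even (v + w)
  have hc1 : c ≤ 1 := by
    by_contra hc1
    have : 2 ^ 4 ≤ 2 ^ (2 * c) := Nat.pow_le_pow_right (by norm_num) (by omega)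
    omega
  interval_cases c
  · rw [hc] at hw64
    exact false_of_card_stabilizer_eq_four hZ hCB h hv hv0 hw hw0 (by omega)
      fun w' hw' hw0' => by have := h64 w' hw' hw0'; omega
  · rw [hc] at hw64
    exact false_of_card_stabilizer_eq_sixteen hZ hCB h hR h9 h9' hv hv0 (by omega)
      fun w' hw' hw0' => by have := h64 w' hw' hw0'; omega

end TwoBlocks

theorem BlockSystem.not_distinctEvenOrbits {r : ℕ} {R V : Type} [Group R] [Finite R] [Finite V]
    [AddCommGroup V] [DistribMulAction R V] [FaithfulSMul R V] {Ω : Type} [Fintype Ω]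
    [MulAction R Ω] {B : Ω → AddSubgroup V} (hB : BlockSystem R V Ω B) {Z : R → R → Prop}
    (hZ : CommRelation Z)
    (hCB : ∀ (v : V) (B : Subgroup R), B ≤ MulAction.stabilizer R v →
      (∀ x ∈ B, ∀ y ∈ B, Z x y) → Nat.card B ^ 2 ≤ Nat.card (MulAction.stabilizer R v))
    (hr : r.Prime) {p : ℕ} (hp : p.Prime) (hpV : ∀ v : V, p • v = 0)
    (h2 : ∃ i j : Ω, i ≠ j) (hne : ∃ i, B i ≠ ⊥) : ¬ DistinctEvenOrbits r R V := by
  intro hD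
  obtain ⟨C, hC⟩ := hD.card_group
  obtain ⟨i₀, hi₀⟩ := hne
  have hu : ∀ j, Nat.card (B j) = Nat.card (B i₀) := fun j => hB.card_block j i₀
  have hu2 : 2 ≤ Nat.card (B i₀) := by
    rw [← AddSubgroup.nontrivial_iff_ne_bot] at hi₀
    exact Finite.one_lt_card
  obtain ⟨k, -, hk⟩ : ∃ k ≤ 2 * C, Fintype.card Ω = r ^ k := by
    rw [← Nat.dvd_prime_pow hr, ← hC, ← Nat.card_eq_fintype_card]
    have h1 : MulAction.orbit R i₀ = Set.univ :=
      Set.eq_univ_of_forall fun j => hB.trans i₀ j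
    have h3 := MulAction.index_stabilizer R i₀
    rw [h1, Set.ncard_univ] at h3
    rw [← h3]
    exact Subgroup.index_dvd_card _
  have hk0 : k ≠ 0 := by
    rintro rfl
    obtain ⟨i, j, hij⟩ := h2
    rw [pow_zero, Fintype.card_eq_one_iff] at hk
    obtain ⟨x, hx⟩ := hk
    exact hij ((hx i).trans (hx j).symm)
  obtain ⟨rfl, rfl⟩ := hB.card_eq_two hr hD hk hk0 hu hu2
  obtain ⟨i, j, hT⟩ := hB.twoBlocks hk
  exact hT.not_distinctEvenOrbits hZ hCB hp hpV (by rw [hu]; exact hu2) hD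

end

/-- A nontrivial normal subgroup of a finite `p`-group contains a nontrivial central element. -/
theorem exists_mem_center_of_normal {r : ℕ} {Q : Type} [Group Q] [Finite Q] (hr : r.Prime)
    (hQ : IsPGroup r Q) {H : Subgroup Q} [H.Normal] (hH : H ≠ ⊥) :
    ∃ x ∈ H, x ≠ 1 ∧ ∀ g, g * x = x * g := by
  have : Fact r.Prime := ⟨hr⟩
  let _ : MulAction Q H := MulAction.compHom H (MulAut.conjNormal (H := H))
  have hdvd : r ∣ Nat.card H := by
    obtain ⟨n, hn⟩ := IsPGroup.iff_card.1 (hQ.to_subgroup H)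
    rw [hn]
    refine dvd_pow_self r ?_
    rintro rfl
    exact hH (Subgroup.card_eq_one.1 (by simpa using hn))
  have hact : ∀ (g : Q) (h : H), ((g • h : H) : Q) = g * h * g⁻¹ := fun g h => rfl
  obtain ⟨b, hb, hb1⟩ := hQ.exists_fixed_point_of_prime_dvd_card_of_fixed_point H hdvd
    (a := (1 : H)) (fun g => Subtype.ext (by rw [hact]; simp))
  refine ⟨b, b.2, fun h => hb1 (Subtype.ext h.symm), fun g => ?_⟩
  have := congrArg Subtype.val (hb g)
  rw [hact] at this
  exact mul_inv_eq_iff_eq_mul.1 this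

/-- A finite `p`-group has a self-centralizing abelian normal subgroup. -/
theorem exists_self_centralizing {r : ℕ} {R : Type} [Group R] [Finite R] (hr : r.Prime)
    (hR : IsPGroup r R) : ∃ A : Subgroup R, A.Normal ∧ (∀ x ∈ A, ∀ y ∈ A, x * y = y * x) ∧
      ∀ g, (∀ x ∈ A, g * x = x * g) → g ∈ A := by
  obtain ⟨A, hA⟩ := (Set.toFinite {A : Subgroup R | A.Normal ∧
    ∀ x ∈ A, ∀ y ∈ A, x * y = y * x}).exists_maximal ⟨⊥, by
      refine ⟨inferInstance, ?_⟩
      rintro x hx y hy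
      rw [Subgroup.mem_bot.1 hx, Subgroup.mem_bot.1 hy]⟩
  obtain ⟨⟨hAn, hAc⟩, hmax⟩ := hA
  refine ⟨A, hAn, hAc, ?_⟩
  by_contra! hne
  obtain ⟨g, hg, hgA⟩ := hne
  have hCn : (Subgroup.centralizer (A : Set R)).Normal := inferInstance
  have hmap : ((Subgroup.centralizer (A : Set R)).map (QuotientGroup.mk' A)).Normal :=
    hCn.map _ (QuotientGroup.mk'_surjective A)
  obtain ⟨q, hq, hq1, hqc⟩ := exists_mem_center_of_normal hr (hR.to_quotient A)
    (H := (Subgroup.centralizer (A : Set R)).map (QuotientGroup.mk' A)) (by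
      intro h
      have : (g : R ⧸ A) ∈ (Subgroup.centralizer (A : Set R)).map (QuotientGroup.mk' A) :=
        ⟨g, Subgroup.mem_centralizer_iff.2 fun x hx => (hg x hx).symm, rfl⟩
      rw [h, Subgroup.mem_bot, QuotientGroup.eq_one_iff] at this
      exact hgA this)
  obtain ⟨x, hx, rfl⟩ := hq
  have hx' : ∀ y ∈ A, y * x = x * y := Subgroup.mem_centralizer_iff.1 hx
  have hxA : x ∉ A := fun h => hq1 ((QuotientGroup.eq_one_iff x).2 h)
  have hconj : ∀ h : R, h * x * h⁻¹ * x⁻¹ ∈ A := by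
    intro h
    rw [← QuotientGroup.eq_one_iff]
    have := hqc (h : R ⧸ A)
    simp only [QuotientGroup.mk'_apply] at this
    rw [QuotientGroup.mk_mul, QuotientGroup.mk_mul, QuotientGroup.mk_mul, this]
    simp
  let S : Set R := (A : Set R) ∪ {x}
  have hScomm : ∀ y ∈ S, ∀ z ∈ S, y * z = z * y := by
    rintro y (hy | rfl) z (hz | rfl)
    · exact hAc y hy z hz
    · exact hx' y hy
    · exact (hx' z hz).symm
    · rfl
  have hle : A ≤ Subgroup.closure S := fun y hy => Subgroup.subset_closure (Or.inl hy)
  have hxS : x ∈ Subgroup.closure S := Subgroup.subset_closure (Or.inr rfl)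
  have hbig := hmax (y := Subgroup.closure S) ⟨?_, ?_⟩ hle
  · exact hxA (hbig hxS)
  · refine ⟨fun n hn h => ?_⟩
    induction hn using Subgroup.closure_induction with
    | mem y hy =>
      rcases hy with hy | rfl
      · exact hle (hAn.conj_mem y hy h)
      · have := mul_mem (hle (hconj h)) hxS
        rwa [inv_mul_cancel_right] at this
    | one => simp
    | mul y z _ _ hy hz => rw [← conj_mul]; exact mul_mem hy hz
    | inv y _ hy => rw [← conj_inv]; exact inv_mem hy
  · have := Subgroup.isMulCommutative_closure hScomm
    intro y hy z hz
    exact setLike_mul_comm hy hz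

open Pointwise in
/-- A commutative ring of operators normalized by an irreducible group either splits the
space into blocks or is a field. -/
theorem isField_or_exists_blockSystem {R V E : Type} [Group R] [Finite V] [Nontrivial V]
    [AddCommGroup V] [DistribMulAction R V]
    (hirr : ∀ W : AddSubgroup V, (∀ (g : R), ∀ v ∈ W, g • v ∈ W) → W = ⊥ ∨ W = ⊤)
    [CommRing E] [Finite E] [Module E V] [FaithfulSMul E V] [MulSemiringAction R E]
    (hsmul : ∀ (g : R) (e : E) (v : V), g • e • v = (g • e) • g • v) :
    IsField E ∨ ∃ (Ω : Type) (_ : Fintype Ω) (_ : MulAction R Ω) (B : Ω → AddSubgroup V),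
      BlockSystem R V Ω B ∧ (∃ i j : Ω, i ≠ j) ∧ ∃ i, B i ≠ ⊥ := by
  classical
  obtain ⟨U, hU, -⟩ := (eq_bot_or_exists_atom_le (⊤ : Submodule E V)).resolve_left top_ne_bot
  have hUs := isSimpleModule_iff_isAtom.2 hU
  obtain ⟨m, hmmax, ⟨φ⟩⟩ := isSimpleModule_iff_quot_maximal.1 hUs
  have hUm : ∀ e ∈ m, ∀ u ∈ U, e • u = 0 := by
    intro e he u hu
    have h1 : e • (⟨u, hu⟩ : U) = 0 := by
      apply φ.injective
      rw [map_smul, map_zero]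
      obtain ⟨y, hy⟩ := Ideal.Quotient.mk_surjective (φ ⟨u, hu⟩)
      rw [← hy, Algebra.smul_def, Ideal.Quotient.algebraMap_eq, ← map_mul,
        Ideal.Quotient.eq_zero_iff_mem]
      exact m.mul_mem_right _ he
    exact congrArg Subtype.val h1
  obtain ⟨u, huU, hu0⟩ := U.ne_bot_iff.1 hU.1
  let Ω := MulAction.orbit R m
  have : Finite (Ideal E) := Finite.of_injective _ SetLike.coe_injective
  let _ : Fintype Ω := Fintype.ofFinite _
  let B : Ω → AddSubgroup V := fun i => (Submodule.torsionBySet E V (i : Ideal E)).toAddSubgroup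
  have hBmem : ∀ (i : Ω) (v : V), v ∈ B i ↔ ∀ e ∈ (i : Ideal E), e • v = 0 := by
    intro i v
    simp [B, Submodule.mem_torsionBySet_iff]
  have hmax : ∀ i : Ω, (i : Ideal E).IsMaximal := by
    rintro ⟨_, g, rfl⟩
    exact Ideal.map_isMaximal_of_equiv (MulSemiringAction.toRingEquiv R E g) (p := m)
  have hsm : ∀ (g : R) (i : Ω), ∀ v ∈ B i, g • v ∈ B (g • i) := by
    intro g i v hv
    rw [hBmem] at hv ⊢
    intro e he
    have he' : g⁻¹ • e ∈ (i : Ideal E) := by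
      have h1 : ((g • i : Ω) : Ideal E) = g • (i : Ideal E) := rfl
      rw [h1] at he
      exact Ideal.mem_pointwise_smul_iff_inv_smul_mem.1 he
    have := hsmul g (g⁻¹ • e) v
    rw [hv _ he', smul_zero, smul_inv_smul] at this
    exact this.symm
  let i₀ : Ω := ⟨m, MulAction.mem_orbit_self m⟩
  have hne : B i₀ ≠ ⊥ := by
    rw [AddSubgroup.ne_bot_iff_exists_ne_zero]
    exact ⟨⟨u, (hBmem _ _).2 fun e he => hUm e he u huU⟩, fun h => hu0 (congrArg Subtype.val h)⟩
  let W : AddSubgroup V :=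
    { carrier := {v | ∃ f : Ω → V, (∀ i, f i ∈ B i) ∧ ∑ i, f i = v}
      zero_mem' := ⟨0, fun i => zero_mem _, by simp⟩
      add_mem' := by
        rintro _ _ ⟨f, hf, rfl⟩ ⟨f', hf', rfl⟩
        exact ⟨f + f', fun i => add_mem (hf i) (hf' i), by simp [Finset.sum_add_distrib]⟩
      neg_mem' := by
        rintro _ ⟨f, hf, rfl⟩
        exact ⟨-f, fun i => neg_mem (hf i), by simp⟩ }
  have hW : W = ⊤ := by
    refine (hirr W ?_).resolve_left ?_
    · rintro g _ ⟨f, hf, rfl⟩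
      refine ⟨fun i => g • f (g⁻¹ • i), fun i => ?_, ?_⟩
      · have := hsm g (g⁻¹ • i) _ (hf (g⁻¹ • i))
        rwa [smul_inv_smul] at this
      · rw [← Finset.smul_sum]
        congr 1
        exact Equiv.sum_comp (MulAction.toPerm g⁻¹) f
    · intro h
      have h1 : u ∈ W := ⟨Pi.single i₀ u, fun i => by
        by_cases hi : i = i₀
        · subst hi
          rw [Pi.single_eq_same]
          exact (hBmem _ _).2 fun e he => hUm e he u huU
        · rw [Pi.single_eq_of_ne hi]
          exact zero_mem _, by simp⟩
      rw [h] at h1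
      exact hu0 h1
  have huniq : ∀ f : Ω → V, (∀ i, f i ∈ B i) → ∑ i, f i = 0 → f = 0 := by
    intro f hf hsum
    funext i
    have hcop : (i : Ideal E) ⊔ ⨅ j ∈ Finset.univ.erase i, (j : Ideal E) = ⊤ :=
      Ideal.sup_iInf_eq_top fun j hj => (hmax i).coprime_of_ne (hmax j) fun h =>
        Finset.ne_of_mem_erase hj (Subtype.ext h.symm)
    obtain ⟨a, ha, b, hb, hab⟩ := Submodule.mem_sup.1 ((Ideal.eq_top_iff_one _).1 hcop)
    have h1 : b • f i = f i := by
      have := (hBmem i (f i)).1 (hf i) a ha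
      calc b • f i = a • f i + b • f i := by rw [this, zero_add]
        _ = f i := by rw [← add_smul, hab, one_smul]
    have h2 : b • ∑ j, f j = b • f i := by
      rw [Finset.smul_sum]
      refine Finset.sum_eq_single i (fun j _ hj => ?_) (by simp)
      refine (hBmem j (f j)).1 (hf j) b ?_
      simp only [Submodule.mem_iInf] at hb
      exact hb j (Finset.mem_erase.2 ⟨hj, Finset.mem_univ _⟩)
    rw [← h1, ← h2, hsum, smul_zero, Pi.zero_apply]
  have hBS : BlockSystem R V Ω B :=
    { smul_mem := hsm
      trans := fun i j => MulAction.exists_smul_eq R i j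
      exists_sum := fun v => by
        have : v ∈ W := by rw [hW]; trivial
        exact this
      unique := fun f f' hf hf' h => sub_eq_zero.1
        (huniq (f - f') (fun i => sub_mem (hf i) (hf' i)) (by simp [h])) }
  by_cases h2 : ∃ i j : Ω, i ≠ j
  · exact Or.inr ⟨Ω, inferInstance, inferInstance, B, hBS, h2, i₀, hne⟩
  push Not at h2
  left
  have hm0 : m = ⊥ := by
    rw [eq_bot_iff]
    intro e he
    refine FaithfulSMul.eq_of_smul_eq_smul (α := V) fun v => ?_
    rw [zero_smul]
    obtain ⟨f, hf, rfl⟩ := hBS.exists_sum v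
    rw [Finset.smul_sum]
    refine Finset.sum_eq_zero fun i _ => ?_
    rw [h2 i i₀]
    exact (hBmem _ _).1 (hf i₀) e he
  rw [hm0] at hmmax
  have : Nontrivial E := ⟨0, 1, fun h => hmmax.ne_top ((Ideal.eq_top_iff_one _).2 h.symm)⟩
  exact Ring.isField_iff_maximal_bot.2 hmmax

theorem exists_card_eq_pow_and_index_le {R E : Type} [Group R] [CommRing E] [Finite E]
    [MulSemiringAction R E] (hE : IsField E) {p : ℕ} (hp : p.Prime) (hpE : (p : E) = 0)
    {A : Subgroup R} (hA : ∀ g : R, (∀ e : E, g • e = e) → g ∈ A) :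
    ∃ f, Nat.card E = p ^ f ∧ A.index ≤ f := by
  let _ := hE.toField
  have : Fact p.Prime := ⟨hp⟩
  have : CharP E p := (CharP.charP_iff_prime_eq_zero hp).2 hpE
  let _ : Algebra (ZMod p) E := ZMod.algebra E p
  let _ := Fintype.ofFinite E
  refine ⟨Module.finrank (ZMod p) E, ?_, ?_⟩
  · rw [Module.natCard_eq_pow_finrank (K := ZMod p), Nat.card_zmod]
  let φ : R →* RingAut E := MulSemiringAction.toRingAut R E
  have hker : φ.ker ≤ A := fun g hg => hA g fun e => DFunLike.congr_fun (MonoidHom.mem_ker.1 hg) e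
  have hinj : Function.Injective
      (fun s : RingAut E => (AlgEquiv.ofRingEquiv (f := s) (fun x => RingHom.congr_fun (Subsingleton.elim
        ((s : E →+* E).comp (algebraMap (ZMod p) E)) (algebraMap (ZMod p) E)) x) :
        E ≃ₐ[ZMod p] E)) := fun s t h => RingEquiv.ext fun e => DFunLike.congr_fun h e
  have : Finite (RingAut E) := Finite.of_injective _ hinj
  calc A.index ≤ φ.ker.index :=
        Nat.le_of_dvd (Nat.pos_of_ne_zero (by rw [Subgroup.index_ker]; exact Nat.card_pos.ne'))
          (Subgroup.index_dvd_of_le hker)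
    _ = Nat.card φ.range := Subgroup.index_ker φ
    _ ≤ Nat.card (RingAut E) := Subgroup.card_le_card_group _
    _ ≤ Nat.card (E ≃ₐ[ZMod p] E) := Nat.card_le_card_of_injective _ hinj
    _ ≤ Module.finrank (ZMod p) E := by
      rw [Nat.card_eq_fintype_card]
      exact AlgEquiv.card_le

theorem sum_pow_even_lt {r k : ℕ} {J : Finset ℕ} (hJ : J ⊆ Finset.range (k + 1)) :
    (2 ≤ r → 3 * ∑ j ∈ J, r ^ (2 * j) < 4 * (r ^ k) ^ 2) ∧
    (3 ≤ r → 8 * ∑ j ∈ J, r ^ (2 * j) < 9 * (r ^ k) ^ 2) := by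
  have hle : ∑ j ∈ J, r ^ (2 * j) ≤ ∑ j ∈ Finset.range (k + 1), r ^ (2 * j) :=
    Finset.sum_le_sum_of_subset hJ
  have key : (2 ≤ r → 3 * ∑ j ∈ Finset.range (k + 1), r ^ (2 * j) < 4 * (r ^ k) ^ 2) ∧
      (3 ≤ r → 8 * ∑ j ∈ Finset.range (k + 1), r ^ (2 * j) < 9 * (r ^ k) ^ 2) := by
    clear hle hJ
    induction k with
    | zero => simp
    | succ k ih =>
      rw [Finset.sum_range_succ]
      have h1 : r ^ (2 * (k + 1)) = (r ^ k) ^ 2 * r ^ 2 := by ring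
      have h2 : (r ^ (k + 1)) ^ 2 = (r ^ k) ^ 2 * r ^ 2 := by ring
      rw [h1, h2]
      constructor
      · intro hr
        have := ih.1 hr
        have h3 : (r ^ k) ^ 2 * 4 ≤ (r ^ k) ^ 2 * r ^ 2 := Nat.mul_le_mul_left _ (by nlinarith)
        omega
      · intro hr
        have := ih.2 hr
        have h3 : (r ^ k) ^ 2 * 9 ≤ (r ^ k) ^ 2 * r ^ 2 := Nat.mul_le_mul_left _ (by nlinarith)
        omega
  exact ⟨fun hr => lt_of_le_of_lt (by omega) (key.1 hr),
    fun hr => lt_of_le_of_lt (by omega) (key.2 hr)⟩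

theorem four_mul_sq_le_three_mul_three_pow {b : ℕ} (hb : 2 ≤ b) : 4 * b ^ 2 ≤ 3 * 3 ^ b := by
  induction b, hb using Nat.le_induction with
  | base => norm_num
  | succ b hb ih => rw [pow_succ 3]; nlinarith

theorem nine_mul_sq_le_eight_mul_two_pow {b : ℕ} (hb : 5 ≤ b) : 9 * b ^ 2 ≤ 8 * 2 ^ b := by
  induction b, hb using Nat.le_induction with
  | base => norm_num
  | succ b hb ih => rw [pow_succ 2]; nlinarith

/-- A prime power below `p ^ (r ^ k)` cannot be a sum of distinct even powers of `r`, one of them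
`1`, with exponents bounded by `2 * k`. -/
theorem false_of_pow_le_sum {r p k b f s : ℕ} {J : Finset ℕ} (hr : r.Prime) (hp : p.Prime)
    (hJ : J ⊆ Finset.range (k + 1)) (h0 : 0 ∈ J) (hs : p ^ s = ∑ j ∈ J, r ^ (2 * j)) (hk : 1 ≤ k)
    (hb : b = r ^ k) (hbf : b ≤ f) (hf : p ^ f ≤ ∑ j ∈ J, r ^ (2 * j)) : False := by
  have hrb : r ≤ b := by rw [hb]; exact Nat.le_self_pow (by omega) r
  obtain ⟨hlt2, hlt3⟩ := sum_pow_even_lt (r := r) hJ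
  have hpb : p ^ b ≤ p ^ f := Nat.pow_le_pow_right hp.pos hbf
  have hsplit : ∑ j ∈ J, r ^ (2 * j) = ∑ j ∈ J.erase 0, r ^ (2 * j) + 1 := by
    rw [← Finset.sum_erase_add _ _ h0]; simp
  have hdvd : r ∣ ∑ j ∈ J.erase 0, r ^ (2 * j) := Finset.dvd_sum fun j hj =>
    dvd_pow_self r (by have := Finset.ne_of_mem_erase hj; omega)
  rcases hr.two_le.eq_or_lt with rfl | hr3
  · have hp3 : 3 ≤ p := by
      rcases hp.two_le.eq_or_lt with rfl | h
      · have hs0 : s ≠ 0 := by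
          rintro rfl
          have : 2 ^ 2 ≤ 2 ^ f := Nat.pow_le_pow_right (by norm_num) (by omega)
          omega
        have := dvd_pow_self 2 hs0
        omega
      · exact h
    have h1 := hlt2 le_rfl
    have h2 := four_mul_sq_le_three_mul_three_pow hrb
    have h3 : 3 ^ b ≤ p ^ b := Nat.pow_le_pow_left hp3 b
    rw [← hb] at h1
    omega
  · have h1 := hlt3 hr3
    have h3 : 2 ^ b ≤ p ^ b := Nat.pow_le_pow_left hp.two_le b
    rw [← hb] at h1
    by_cases hb5 : 5 ≤ b
    · have h2 := nine_mul_sq_le_eight_mul_two_pow hb5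
      omega
    · have hr4 : r ≠ 4 := by rintro rfl; revert hr; decide
      have hr3' : r = 3 := by omega
      subst hr3'
      have hk1 : k = 1 := by
        by_contra hk1
        have : 3 ^ 2 ≤ 3 ^ k := Nat.pow_le_pow_right (by norm_num) (by omega)
        omega
      subst hk1
      have hb3 : b = 3 := by omega
      subst hb3
      have hJ' : J.erase 0 ⊆ {1} := by
        intro j hj
        have h1 := Finset.mem_range.1 (hJ (Finset.mem_of_mem_erase hj))
        have := Finset.ne_of_mem_erase hj
        simp; omega
      rcases Finset.subset_singleton_iff.1 hJ' with h | h
      · rw [h] at hsplit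
        simp at hsplit
        omega
      · rw [h] at hsplit
        simp at hsplit
        rw [hsplit] at hs
        have hp2 : 2 = p := (Nat.prime_dvd_prime_iff_eq Nat.prime_two hp).1
          (Nat.prime_two.dvd_of_dvd_pow (n := s) (by rw [hs]; norm_num))
        have hp5 : 5 = p := (Nat.prime_dvd_prime_iff_eq Nat.prime_five hp).1
          (Nat.prime_five.dvd_of_dvd_pow (n := s) (by rw [hs]; norm_num))
        omega

/-- The ring of operators generated by a subgroup. -/
def operatorRing {R : Type} (V : Type) [Group R] [AddCommGroup V] [DistribMulAction R V]
    (A : Subgroup R) : Subring (AddMonoid.End V) :=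
  Subring.closure (DistribMulAction.toAddMonoidEnd R V '' A)

section OperatorRing

variable {R V : Type} [Group R] [AddCommGroup V] [DistribMulAction R V] {A : Subgroup R}

theorem isMulCommutative_operatorRing (hA : ∀ x ∈ A, ∀ y ∈ A, x * y = y * x) :
    IsMulCommutative (operatorRing V A) := by
  refine Subring.isMulCommutative_closure ?_
  rintro _ ⟨x, hx, rfl⟩ _ ⟨y, hy, rfl⟩
  rw [← map_mul, hA x hx y hy, map_mul]

theorem conj_mem_operatorRing [hA : A.Normal] (g : R) {e : AddMonoid.End V}
    (he : e ∈ operatorRing V A) :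
    DistribMulAction.toAddMonoidEnd R V g * e * DistribMulAction.toAddMonoidEnd R V g⁻¹ ∈
      operatorRing V A := by
  have hinv : DistribMulAction.toAddMonoidEnd R V g⁻¹ * DistribMulAction.toAddMonoidEnd R V g =
      1 := by rw [← map_mul, inv_mul_cancel, map_one]
  have hinv' : DistribMulAction.toAddMonoidEnd R V g * DistribMulAction.toAddMonoidEnd R V g⁻¹ =
      1 := by rw [← map_mul, mul_inv_cancel, map_one]
  induction he using Subring.closure_induction with
  | mem x hx =>
    obtain ⟨a, ha, rfl⟩ := hx
    rw [← map_mul, ← map_mul]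
    exact Subring.subset_closure ⟨_, hA.conj_mem a ha g, rfl⟩
  | zero => rw [mul_zero, zero_mul]; exact zero_mem _
  | one => rw [mul_one, hinv']; exact one_mem _
  | add x y _ _ hx hy => rw [mul_add, add_mul]; exact add_mem hx hy
  | neg x _ hx => rw [mul_neg, neg_mul]; exact neg_mem hx
  | mul x y _ _ hx hy =>
    have := mul_mem hx hy
    convert this using 1
    simp only [mul_assoc]
    rw [← mul_assoc _ (DistribMulAction.toAddMonoidEnd R V g), hinv, one_mul]

/-- Conjugation on the ring of operators of a normal subgroup. -/
@[reducible] def operatorRingAction (hA : A.Normal) : MulSemiringAction R (operatorRing V A) where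
  smul g e := ⟨_, conj_mem_operatorRing (A := A) g e.2⟩
  one_smul e := Subtype.ext (by
    change DistribMulAction.toAddMonoidEnd R V 1 * e.1 *
      DistribMulAction.toAddMonoidEnd R V 1⁻¹ = e.1
    rw [inv_one, map_one, one_mul, mul_one])
  mul_smul g h e := Subtype.ext (by
    change DistribMulAction.toAddMonoidEnd R V (g * h) * e.1 *
      DistribMulAction.toAddMonoidEnd R V (g * h)⁻¹ = DistribMulAction.toAddMonoidEnd R V g *
      (DistribMulAction.toAddMonoidEnd R V h * e.1 * DistribMulAction.toAddMonoidEnd R V h⁻¹) *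
      DistribMulAction.toAddMonoidEnd R V g⁻¹
    rw [mul_inv_rev, map_mul, map_mul]
    simp only [mul_assoc])
  smul_zero g := Subtype.ext (by
    change DistribMulAction.toAddMonoidEnd R V g * 0 * _ = 0
    rw [mul_zero, zero_mul])
  smul_add g e e' := Subtype.ext (by
    change DistribMulAction.toAddMonoidEnd R V g * (e.1 + e'.1) * _ = _
    rw [mul_add, add_mul]
    rfl)
  smul_one g := Subtype.ext (by
    change DistribMulAction.toAddMonoidEnd R V g * 1 * DistribMulAction.toAddMonoidEnd R V g⁻¹ = 1
    rw [mul_one, ← map_mul, mul_inv_cancel, map_one])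
  smul_mul g e e' := Subtype.ext (by
    change DistribMulAction.toAddMonoidEnd R V g * (e.1 * e'.1) *
      DistribMulAction.toAddMonoidEnd R V g⁻¹ = (DistribMulAction.toAddMonoidEnd R V g * e.1 *
      DistribMulAction.toAddMonoidEnd R V g⁻¹) * (DistribMulAction.toAddMonoidEnd R V g * e'.1 *
      DistribMulAction.toAddMonoidEnd R V g⁻¹)
    have hinv : DistribMulAction.toAddMonoidEnd R V g⁻¹ *
      DistribMulAction.toAddMonoidEnd R V g = 1 := by rw [← map_mul, inv_mul_cancel, map_one]
    simp only [mul_assoc]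
    rw [← mul_assoc _ (DistribMulAction.toAddMonoidEnd R V g), hinv, one_mul])

end OperatorRing

open scoped IsMulCommutative in
/-- A faithful irreducible action on an elementary abelian group never has orbits of distinct
sizes, all even powers of `r`, if stabilizers satisfy the bound on `Z`-isotropic subgroups. -/
theorem not_distinctEvenOrbits {r : ℕ} {R V : Type} [Group R] [Finite R] [Finite V] [Nontrivial V]
    [AddCommGroup V] [DistribMulAction R V] [FaithfulSMul R V] {Z : R → R → Prop}
    (hZ : CommRelation Z)
    (hCB : ∀ (v : V) (B : Subgroup R), B ≤ MulAction.stabilizer R v →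
      (∀ x ∈ B, ∀ y ∈ B, Z x y) → Nat.card B ^ 2 ≤ Nat.card (MulAction.stabilizer R v))
    (hr : r.Prime) {p : ℕ} (hp : p.Prime) (hpV : ∀ v : V, p • v = 0)
    (hirr : ∀ W : AddSubgroup V, (∀ (g : R), ∀ v ∈ W, g • v ∈ W) → W = ⊥ ∨ W = ⊤) :
    ¬ DistinctEvenOrbits r R V := by
  intro hD
  obtain ⟨C, hC⟩ := hD.card_group
  have hRp : IsPGroup r R := IsPGroup.of_card hC
  obtain ⟨A, hAn, hAc, hAself⟩ := exists_self_centralizing hr hRp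
  have hcomm := isMulCommutative_operatorRing (V := V) hAc
  let _ := operatorRingAction (V := V) hAn
  have : Finite (AddMonoid.End V) := DFunLike.finite _
  have hsmul : ∀ (g : R) (e : operatorRing V A) (v : V), g • e • v = (g • e) • g • v := by
    intro g e v
    change g • e.1 v = g • e.1 (g⁻¹ • g • v)
    rw [inv_smul_smul]
  have : FaithfulSMul (operatorRing V A) V :=
    ⟨fun {e e'} h => Subtype.ext (AddMonoidHom.ext h)⟩
  rcases isField_or_exists_blockSystem hirr hsmul with hE | ⟨Ω, _, _, B, hB, h2, hne⟩
  swap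
  · exact hB.not_distinctEvenOrbits hZ hCB hr hp hpV h2 hne hD
  have hpE : ((p : ℕ) : operatorRing V A) = 0 := by
    refine Subtype.ext (AddMonoidHom.ext fun v => ?_)
    have : ((p : ℕ) : operatorRing V A).1 v = p • v := by
      rw [Subring.coe_natCast]; exact AddMonoid.End.natCast_apply p v
    exact this.trans (hpV v)
  let ι : A →* operatorRing V A :=
    { toFun := fun a => ⟨DistribMulAction.toAddMonoidEnd R V a,
        Subring.subset_closure ⟨a, a.2, rfl⟩⟩
      map_one' := Subtype.ext (map_one _)
      map_mul' := fun a b => Subtype.ext (map_mul _ _ _) }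
  have hι : Function.Injective ι := fun a b h => Subtype.ext
    (FaithfulSMul.eq_of_smul_eq_smul (α := V) fun v =>
      DFunLike.congr_fun (congrArg Subtype.val h) v)
  have := hE.isDomain
  have hcyc : IsCyclic A := isCyclic_of_injective_ringHom ι hι
  have hfix : ∀ g : R, (∀ e : operatorRing V A, g • e = e) → g ∈ A := by
    intro g hg
    refine hAself g fun x hx => FaithfulSMul.eq_of_smul_eq_smul (α := V) fun v => ?_
    have h1 := congrArg Subtype.val (hg (ι ⟨x, hx⟩))
    have h2 : g • x • g⁻¹ • g • v = x • g • v := DFunLike.congr_fun h1 (g • v)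
    rwa [inv_smul_smul, ← mul_smul, ← mul_smul] at h2
  obtain ⟨f, hf, hAf⟩ := exists_card_eq_pow_and_index_le hE hp hpE hfix
  have hAle : Nat.card A ^ 2 ≤ Nat.card R := by
    have h1 := hCB 0 A (by rw [stabilizer_zero_eq_top]; exact le_top) (by
      obtain ⟨a, ha⟩ := hcyc.exists_generator
      have hmem : ∀ x ∈ A, x ∈ Subgroup.zpowers (a : R) := by
        intro x hx
        obtain ⟨n, hn⟩ := Subgroup.mem_zpowers_iff.1 (ha ⟨x, hx⟩)
        exact Subgroup.mem_zpowers_iff.2 ⟨n, by simpa using congrArg Subtype.val hn⟩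
      exact fun x hx y hy => hZ.zpowers (a : R) x (hmem x hx) y (hmem y hy))
    rwa [stabilizer_zero_eq_top, Subgroup.card_top] at h1
  obtain ⟨J, hJ, hsum, hmem⟩ := hD.ncard_eq_sum hr hC Set.univ (fun _ _ _ => trivial)
  rw [Set.ncard_univ] at hsum
  have h0 : 0 ∈ J := (hmem 0).2 ⟨0, trivial, by rw [card_orbit_zero]; rfl⟩
  have hV1 : 1 < Nat.card V := Finite.one_lt_card
  have hC1 : 1 ≤ C := by
    by_contra hC0
    have hC0 : C = 0 := by omega
    subst hC0
    have hle := Finset.sum_le_sum_of_subset (f := fun j => r ^ (2 * j)) hJ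
    simp at hle
    omega
  obtain ⟨k, hk, hAk⟩ : ∃ k ≤ 2 * C, A.index = r ^ k := by
    rw [← Nat.dvd_prime_pow hr, ← hC]; exact A.index_dvd_card
  have hCk : C ≤ k := by
    have h1 := A.card_mul_index
    by_contra hlt
    have h2 : r ^ (2 * k) < r ^ (2 * C) := Nat.pow_lt_pow_right hr.one_lt (by omega)
    have h3 : A.index ^ 2 < Nat.card R := by rw [hAk, hC, ← pow_mul, mul_comm]; exact h2
    have h4 : Nat.card R ^ 2 ≤ Nat.card R * A.index ^ 2 := by
      nth_rewrite 1 [← h1]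
      rw [mul_pow]
      exact Nat.mul_le_mul_right _ hAle
    have h5 : 0 < Nat.card R := Nat.card_pos
    nlinarith
  have hEV : Nat.card (operatorRing V A) ≤ Nat.card V := by
    obtain ⟨v, hv⟩ := exists_ne (0 : V)
    refine Nat.card_le_card_of_injective (fun e : operatorRing V A => e • v) fun e e' h => ?_
    by_contra hne
    obtain ⟨d, hd⟩ := hE.mul_inv_cancel (sub_ne_zero.2 hne)
    apply hv
    have h1 : (e - e') • v = 0 := by rw [sub_smul, sub_eq_zero]; exact h
    rw [← one_smul (operatorRing V A) v, ← hd, mul_comm, mul_smul, h1, smul_zero]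
  obtain ⟨s, hs⟩ : ∃ s, Nat.card V = p ^ s := by
    have : Fact p.Prime := ⟨hp⟩
    have h1 : IsPGroup p (Multiplicative V) := fun x => ⟨1, by
      rw [pow_one]; exact hpV x.toAdd⟩
    obtain ⟨s, hs⟩ := IsPGroup.iff_card.1 h1
    exact ⟨s, hs⟩
  exact false_of_pow_le_sum hr hp
    (hJ.trans (Finset.range_subset_range.2 (by omega : C + 1 ≤ k + 1))) h0
    (hs.symm.trans hsum) (by omega) rfl (hAk ▸ hAf) (by rw [← hf, ← hsum]; exact hEV)

section Commutator

variable {Γ : Type} [Group Γ] {N M : Subgroup Γ} {μ : Γ → ℂ}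

theorem InvChar.commutator_eq_one (hμ : InvChar N μ) {n g : Γ} (hn : n ∈ N) [hN : N.Normal] :
    μ (n * g * n⁻¹ * g⁻¹) = 1 := by
  have h : n * g * n⁻¹ * g⁻¹ = n * (g * n⁻¹ * g⁻¹) := by group
  rw [h, hμ.mul n hn _ (hN.conj_mem _ (N.inv_mem hn) g), hμ.conj g _ (N.inv_mem hn),
    hμ.inv hn, mul_inv_cancel₀ (hμ.ne_zero hn)]

theorem LinChar.commutator_mul_left (hμ : LinChar N μ) {a a' b : Γ} [hN : N.Normal]
    (ha : a * b * a⁻¹ * b⁻¹ ∈ N) (ha' : a' * b * a'⁻¹ * b⁻¹ ∈ N)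
    (hconj : ∀ n ∈ N, μ (a * n * a⁻¹) = μ n) :
    μ (a * a' * b * (a * a')⁻¹ * b⁻¹) = μ (a * b * a⁻¹ * b⁻¹) * μ (a' * b * a'⁻¹ * b⁻¹) := by
  have h : a * a' * b * (a * a')⁻¹ * b⁻¹ =
      (a * (a' * b * a'⁻¹ * b⁻¹) * a⁻¹) * (a * b * a⁻¹ * b⁻¹) := by group
  rw [h, hμ.mul _ (hN.conj_mem _ ha' a) _ ha, hconj _ ha', mul_comm]

theorem commutator_mem_pow_left [hN : N.Normal] {a b : Γ} (h : a * b * a⁻¹ * b⁻¹ ∈ N) (i : ℕ) :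
    a ^ i * b * (a ^ i)⁻¹ * b⁻¹ ∈ N := by
  have h1 := (coe_commute_of_commutator_mem h).pow_left i
  rw [← QuotientGroup.eq_one_iff]
  simp only [QuotientGroup.mk_mul, QuotientGroup.mk_inv, QuotientGroup.mk_pow]
  rw [mul_inv_eq_one, mul_inv_eq_iff_eq_mul]
  exact h1

theorem LinChar.commutator_pow_left (hμ : LinChar N μ) {a b : Γ} [hN : N.Normal]
    (ha : a * b * a⁻¹ * b⁻¹ ∈ N) (hconj : ∀ n ∈ N, μ (a * n * a⁻¹) = μ n) (i : ℕ) :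
    μ (a ^ i * b * (a ^ i)⁻¹ * b⁻¹) = μ (a * b * a⁻¹ * b⁻¹) ^ i := by
  induction i with
  | zero => simp [hμ.one]
  | succ i ih =>
    rw [pow_succ' a, hμ.commutator_mul_left ha (commutator_mem_pow_left ha i) hconj, ih, pow_succ']

end Commutator

theorem eq_one_of_pow_eq_one_of_coprime {z : ℂ} {a b : ℕ} (hab : a.Coprime b) (ha : z ^ a = 1)
    (hb : z ^ b = 1) : z = 1 := by
  have := pow_gcd_eq_one.2 ⟨ha, hb⟩
  rwa [hab.gcd_eq_one, pow_one] at this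

/-- The radical of the commutator pairing on `M`. -/
def commRadical {Γ : Type} [Group Γ] {N M : Subgroup Γ} [N.Normal] {μ : Γ → ℂ}
    (hμ : InvChar N μ) (hcomm : ∀ a ∈ M, ∀ b ∈ M, a * b * a⁻¹ * b⁻¹ ∈ N) : Subgroup Γ where
  carrier := {a | a ∈ M ∧ ∀ b ∈ M, μ (a * b * a⁻¹ * b⁻¹) = 1}
  one_mem' := ⟨one_mem _, fun b _ => by simp [hμ.one]⟩
  mul_mem' {a a'} ha ha' := ⟨mul_mem ha.1 ha'.1, fun b hb => by
    rw [hμ.commutator_mul_left (hcomm a ha.1 b hb) (hcomm a' ha'.1 b hb)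
      (fun n hn => hμ.conj a n hn), ha.2 b hb, ha'.2 b hb, one_mul]⟩
  inv_mem' {a} ha := ⟨inv_mem ha.1, fun b hb => by
    have h := hμ.commutator_mul_left (hcomm a ha.1 b hb) (hcomm a⁻¹ (inv_mem ha.1) b hb)
      (fun n hn => hμ.conj a n hn)
    rw [ha.2 b hb, one_mul] at h
    rw [← h]
    simp [hμ.one]⟩

theorem index_eq_pow_of_minimal {r k : ℕ} (hr : r.Prime) {Γ : Type} [Group Γ] [Finite Γ]
    (hsol : Group.IsSolvable Γ) {N M : Subgroup Γ} [hN : N.Normal] [hM : M.Normal] {μ : Γ → ℂ}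
    (hμ : InvChar N μ) (hval : ValuesOrder N μ (r ^ k)) (hD : DegreesDistinct Γ N μ)
    (hNM : N < M) (hMp : ∀ m ∈ M, m ^ r ∈ N)
    (hcomm : ∀ a ∈ M, ∀ b ∈ M, a * b * a⁻¹ * b⁻¹ ∈ N)
    (hmin : ∀ M' : Subgroup Γ, M'.Normal → N ≤ M' → M' ≤ M → M' = N ∨ M' = M)
    (IH : ∀ (Δ : Type) [Group Δ] [Finite Δ] (L : Subgroup Δ), L.index < N.index →
      IndexClaim r Δ L) : ∃ l, N.index = r ^ l := by
  have hrad : (commRadical hμ hcomm).Normal := ⟨fun a ha g => ⟨hM.conj_mem a ha.1 g, fun b hb => by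
    have h : g * a * g⁻¹ * b * (g * a * g⁻¹)⁻¹ * b⁻¹ =
      g * (a * (g⁻¹ * b * g) * a⁻¹ * (g⁻¹ * b * g)⁻¹) * g⁻¹ := by group
    have hb' : g⁻¹ * b * g ∈ M := by simpa using hM.conj_mem b hb g⁻¹
    rw [h, hμ.conj g _ (hcomm a ha.1 _ hb'), ha.2 _ hb']⟩⟩
  rcases hmin (commRadical hμ hcomm) hrad
    (fun n hn => ⟨hNM.le hn, fun b _ => hμ.commutator_eq_one hn⟩) (fun a ha => ha.1) with h | h
  · refine index_eq_pow_of_nondegenerate hr hsol hμ hval hD hNM hMp hcomm (fun a ha hb => ?_) IH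
    rw [← h]
    exact ⟨ha, hb⟩
  · refine index_eq_pow_of_commutator hr hsol hμ hval hD hNM hMp
      (fun a ha b hb => ⟨hcomm a ha b hb, ?_⟩) IH
    rw [← h] at ha
    exact ha.2 b hb

/-- A central extension of an `r`-group has a normal subgroup consisting of `r`-elements. -/
theorem exists_normal_of_central {r i : ℕ} (hr : r.Prime) {Γ : Type} [Group Γ] [Finite Γ]
    {N M C : Subgroup Γ} [hN : N.Normal] [hC : C.Normal] (hNC : N ≤ C)
    (hMC : M ≤ C) (hcent : ∀ c ∈ C, ∀ m ∈ M, c * m * c⁻¹ * m⁻¹ ∈ N) (hi : M.relIndex C = r ^ i)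
    (hlt : M < C) (hNM : N ≤ M) :
    ∃ L : Subgroup Γ, L.Normal ∧ N < L ∧ ∀ x ∈ L, ∃ j, x ^ r ^ j ∈ N := by
  let Q := C ⧸ N.subgroupOf C
  have hle : (M.subgroupOf C).map (QuotientGroup.mk' (N.subgroupOf C)) ≤ Subgroup.center Q := by
    rintro _ ⟨m, hm, rfl⟩
    rw [Subgroup.mem_center_iff]
    intro q
    obtain ⟨c, rfl⟩ := QuotientGroup.mk_surjective q
    exact (coe_commute_of_commutator_mem (N := N.subgroupOf C) (a := c) (b := m)
      (hcent c c.2 m hm)).eq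
  obtain ⟨s, -, hs⟩ : ∃ s ≤ i, (Subgroup.center Q).index = r ^ s := by
    rw [← Nat.dvd_prime_pow hr, ← hi]
    refine (Subgroup.index_dvd_of_le hle).trans ?_
    exact Subgroup.index_map_dvd _ (QuotientGroup.mk'_surjective _)
  have hhom : ∀ x ∈ C, ∀ y ∈ C, x ^ r ^ (s + 1) ∈ N → y ^ r ^ (s + 1) ∈ N →
      (x * y) ^ r ^ (s + 1) ∈ N := by
    intro x hx y hy hxN hyN
    let x' : Q := ((⟨x, hx⟩ : C) : C ⧸ N.subgroupOf C)
    let y' : Q := ((⟨y, hy⟩ : C) : C ⧸ N.subgroupOf C)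
    have key : ∀ (z : Γ) (hz : z ∈ C), z ^ r ^ (s + 1) ∈ N ↔
        (((⟨z, hz⟩ : C) : C ⧸ N.subgroupOf C) : Q) ^ r ^ (s + 1) = 1 := by
      intro z hz
      rw [← QuotientGroup.mk_pow, QuotientGroup.eq_one_iff]
      exact Iff.rfl
    have htr : ∀ q : Q, ((MonoidHom.transferCenterPow Q q : Subgroup.center Q) : Q) = q ^ r ^ s := by
      intro q; rw [← hs]; exact MonoidHom.transferCenterPow_apply q
    rw [key _ hx] at hxN
    rw [key _ hy] at hyN
    rw [key _ (mul_mem hx hy)]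
    have h1 : MonoidHom.transferCenterPow Q x' ^ r = 1 := Subtype.ext (by
      rw [Subgroup.coe_pow, htr, ← pow_mul, ← pow_succ]; exact hxN)
    have h2 : MonoidHom.transferCenterPow Q y' ^ r = 1 := Subtype.ext (by
      rw [Subgroup.coe_pow, htr, ← pow_mul, ← pow_succ]; exact hyN)
    have h3 : MonoidHom.transferCenterPow Q (x' * y') ^ r = 1 := by
      have hc : Commute (MonoidHom.transferCenterPow Q x') (MonoidHom.transferCenterPow Q y') :=
        Subtype.ext (Subgroup.mem_center_iff.1 (MonoidHom.transferCenterPow Q y').2 _)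
      rw [map_mul, hc.mul_pow, h1, h2, one_mul]
    have h4 := congrArg Subtype.val h3
    rw [Subgroup.coe_pow, htr, ← pow_mul, ← pow_succ] at h4
    exact h4
  let L : Subgroup Γ :=
    { carrier := {x | x ∈ C ∧ x ^ r ^ (s + 1) ∈ N}
      one_mem' := ⟨one_mem _, by simp⟩
      mul_mem' := fun {x y} hx hy => ⟨mul_mem hx.1 hy.1, hhom x hx.1 y hy.1 hx.2 hy.2⟩
      inv_mem' := fun {x} hx => ⟨inv_mem hx.1, by
        have := inv_mem hx.2
        rwa [← inv_pow] at this⟩ }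
  refine ⟨L, ⟨fun x hx g => ⟨hC.conj_mem x hx.1 g, ?_⟩⟩, ?_, fun x hx => ⟨s + 1, hx.2⟩⟩
  · rw [conj_pow]; exact hN.conj_mem _ hx.2 g
  · refine lt_of_le_of_ne (fun n hn => ⟨hNC hn, pow_mem hn _⟩) fun hNL => ?_
    have hi0 : i ≠ 0 := by
      rintro rfl
      exact hlt.not_ge (Subgroup.relIndex_eq_one.1 (by simpa using hi))
    obtain ⟨x, hxC, hxr, hxN⟩ := exists_coe_orderOf (N := N) (M := C) hr (by
      rw [← Subgroup.relIndex_mul_relIndex N M C hNM hMC, hi]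
      exact dvd_mul_of_dvd_right (dvd_pow_self r hi0) _)
    apply hxN
    rw [hNL]
    refine ⟨hxC, ?_⟩
    rw [pow_succ', pow_mul]
    exact pow_mem hxr _

/-- A separating group of characters of a finite abelian group is the full dual. -/
theorem eq_top_of_separating {A : Type} [CommGroup A] [Finite A] (W : Subgroup (A →* ℂˣ))
    (hW : ∀ a : A, (∀ w ∈ W, w a = 1) → a = 1) : W = ⊤ := by
  have : Finite (A →* ℂˣ) := inferInstance
  have hcard : ∀ (B : Type) [CommGroup B] [Finite B], Nat.card (B →* ℂˣ) = Nat.card B :=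
    fun B _ _ => CommGroup.card_monoidHom_of_hasEnoughRootsOfUnity B ℂ
  let φ : A → (W →* ℂˣ) := fun a =>
    { toFun := fun w => (w : A →* ℂˣ) a
      map_one' := rfl
      map_mul' := fun _ _ => rfl }
  have hφ : Function.Injective φ := by
    intro a b h
    rw [← mul_inv_eq_one]
    refine hW _ fun w hw => ?_
    have h1 : w a = w b := DFunLike.congr_fun h ⟨w, hw⟩
    rw [map_mul, map_inv, h1, mul_inv_cancel]
  apply Subgroup.eq_top_of_le_card
  rw [hcard A, ← hcard W]
  exact Nat.card_le_card_of_injective φ hφ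

/-- Commutation of lifts along a central extension. -/
theorem commRelation_of_central {E R : Type} [Group E] [Group R] (f : E →* R)
    (hf : Function.Surjective f) (hker : ∀ z, f z = 1 → ∀ g, Commute z g)
    (huniq : ∀ z w, f z = 1 → f w = 1 → z * z = 1 → w * w = 1 → z ≠ 1 → w ≠ 1 → z = w) :
    CommRelation (fun x y : R => ∀ g h, f g = x → f h = y → Commute g h) := by
  have hlift : ∀ g g' : E, f g = f g' → ∃ z, f z = 1 ∧ g = g' * z := fun g g' h =>
    ⟨g'⁻¹ * g, by rw [map_mul, map_inv, h, inv_mul_cancel], by group⟩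
  have hind : ∀ g g' h h' : E, f g = f g' → f h = f h' → Commute g' h' → Commute g h := by
    intro g g' h h' hg hh hc
    obtain ⟨z, hz, rfl⟩ := hlift g g' hg
    obtain ⟨w, hw, rfl⟩ := hlift h h' hh
    exact ((hc.mul_right (hker w hw g').symm).mul_left (hker z hz _))
  refine ⟨?_, ?_, ?_, ?_, ?_, ?_⟩
  · intro x g h hg hh
    exact hind g g h g rfl (hh.trans hg.symm) (Commute.refl g)
  · intro x y hxy g h hg hh
    exact (hxy h g hh hg).symm
  · intro x g h _ hh
    exact (hker h hh g).symm
  · intro x y z hxy hxz g h hg hh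
    obtain ⟨a, rfl⟩ := hf y
    obtain ⟨b, rfl⟩ := hf z
    exact hind g g h (a * b) rfl (by rw [hh, map_mul])
      ((hxy g a hg rfl).mul_right (hxz g b hg rfl))
  · intro x y hxy g h hg hh
    obtain ⟨a, rfl⟩ := hf y
    exact hind g g h a⁻¹ rfl (by rw [hh, map_inv]) (hxy g a hg rfl).inv_right
  · intro d x y hd hdx hdy hnx hny g h hg hh
    push Not at hnx hny
    obtain ⟨D, X, rfl, rfl, hDX⟩ := hnx
    obtain ⟨D', Y, hD', rfl, hDY⟩ := hny
    have hDY' : ¬ Commute D Y := fun h => hDY (hind D' D Y Y hD' rfl h)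
    have hsq : ∀ W, f D * f W = f W * f D → ∃ z, f z = 1 ∧ D * W = z * (W * D) ∧ z * z = 1 := by
      intro W hW
      refine ⟨D * W * D⁻¹ * W⁻¹, by simp [hW], by group, ?_⟩
      have hz : f (D * W * D⁻¹ * W⁻¹) = 1 := by simp [hW]
      have h1 := hker _ hz D
      have h2 : (D * D) * W * (D * D)⁻¹ * W⁻¹ =
          D * (D * W * D⁻¹ * W⁻¹) * D⁻¹ * (D * W * D⁻¹ * W⁻¹) := by group
      rw [← h1.eq, mul_inv_cancel_right] at h2
      rw [← h2, (hker (D * D) (by rw [map_mul, hd]) W).eq]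
      group
    obtain ⟨z, hz, hzX, hzz⟩ := hsq X hdx
    obtain ⟨w, hw, hwY, hww⟩ := hsq Y hdy
    have hz1 : z ≠ 1 := by rintro rfl; exact hDX (by rw [one_mul] at hzX; exact hzX)
    have hw1 : w ≠ 1 := by rintro rfl; exact hDY' (by rw [one_mul] at hwY; exact hwY)
    obtain rfl := huniq z w hz hw hzz hww hz1 hw1
    refine hind g D h (X * Y) hg (by rw [hh, map_mul]) ?_
    change D * (X * Y) = X * Y * D
    calc D * (X * Y) = z * (X * (D * Y)) := by rw [← mul_assoc, hzX]; group
      _ = z * (X * z) * (Y * D) := by rw [hwY]; group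
      _ = (z * z) * (X * (Y * D)) := by rw [← (hker z hz X).eq]; group
      _ = X * Y * D := by rw [hzz, one_mul, mul_assoc]

section Dual

variable {R A : Type} [Group R] [CommGroup A]

/-- The dual of an action by automorphisms, on the character group. -/
abbrev dualAction (α : R →* MulAut A) : DistribMulAction R (Additive (A →* ℂˣ)) where
  smul g v := Additive.ofMul (v.toMul.comp (α g⁻¹).toMonoidHom)
  one_smul v := Additive.toMul.injective (MonoidHom.ext fun a => by
    change v.toMul (α 1⁻¹ a) = v.toMul a
    simp)
  mul_smul g h v := Additive.toMul.injective (MonoidHom.ext fun a => by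
    change v.toMul (α (g * h)⁻¹ a) = v.toMul (α h⁻¹ (α g⁻¹ a))
    rw [mul_inv_rev, map_mul, MulAut.mul_apply])
  smul_zero _ := rfl
  smul_add _ _ _ := rfl

theorem dualAction_apply (α : R →* MulAut A) (g : R) (v : Additive (A →* ℂˣ)) (a : A) :
    ((dualAction α).smul g v).toMul a = v.toMul (α g⁻¹ a) := rfl

theorem dualAction_eq_iff (α : R →* MulAut A) (g : R) (v w : Additive (A →* ℂˣ)) :
    (dualAction α).smul g v = w ↔ ∀ a, w.toMul (α g a) = v.toMul a := by
  rw [← Additive.toMul.injective.eq_iff, DFunLike.ext_iff]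
  constructor
  · intro h a
    rw [← h, dualAction_apply, map_inv, MulAut.inv_apply_self]
  · intro h a
    rw [dualAction_apply, ← h, map_inv, MulAut.apply_inv_self]

theorem dualAction_irreducible [Finite A] (α : R →* MulAut A)
    (hirr : ∀ B : Subgroup A, (∀ g, ∀ b ∈ B, α g b ∈ B) → B = ⊥ ∨ B = ⊤)
    (W : AddSubgroup (Additive (A →* ℂˣ))) (hW : ∀ g, ∀ w ∈ W, (dualAction α).smul g w ∈ W) :
    W = ⊥ ∨ W = ⊤ := by
  let B : Subgroup A :=
    { carrier := {a | ∀ w ∈ W, w.toMul a = 1}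
      one_mem' := fun w _ => map_one _
      mul_mem' := fun {a b} ha hb w hw => by rw [map_mul, ha w hw, hb w hw, one_mul]
      inv_mem' := fun {a} ha w hw => by rw [map_inv, ha w hw, inv_one] }
  rcases hirr B (fun g b hb w hw => by
    have := hb _ (hW g⁻¹ w hw)
    rwa [dualAction_apply, inv_inv] at this) with h | h
  · right
    have h1 : AddSubgroup.toSubgroup' W = ⊤ := by
      refine eq_top_of_separating _ fun a ha => ?_
      have : a ∈ B := fun w hw => ha w.toMul hw
      rwa [h] at this
    refine eq_top_iff.2 fun v _ => ?_
    have : v.toMul ∈ AddSubgroup.toSubgroup' W := by rw [h1]; trivial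
    exact this
  · left
    refine eq_bot_iff.2 fun w hw => ?_
    refine AddSubgroup.mem_bot.2 (Additive.toMul.injective (MonoidHom.ext fun a => ?_))
    have : a ∈ B := by rw [h]; trivial
    exact this w hw

theorem exists_character_ne_one [Finite A] {a : A} (ha : a ≠ 1) : ∃ v : A →* ℂˣ, v a ≠ 1 :=
  CommGroup.exists_apply_ne_one_of_hasEnoughRootsOfUnity A ℂ ha

theorem dualAction_faithful [Finite A] (α : R →* MulAut A) (hα : Function.Injective α) :
    @FaithfulSMul R (Additive (A →* ℂˣ)) (dualAction α).toSMul := by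
  refine @FaithfulSMul.mk _ _ (dualAction α).toSMul fun {g h} hgh => hα (MulEquiv.ext fun a => ?_)
  by_contra hne
  have hne' : (α g a) * (α h a)⁻¹ ≠ 1 := fun h => hne (mul_inv_eq_one.1 h)
  obtain ⟨v, hv⟩ := exists_character_ne_one hne'
  apply hv
  let w : Additive (A →* ℂˣ) := (dualAction α).smul g⁻¹ (Additive.ofMul v)
  have hg : (dualAction α).smul g w = Additive.ofMul v := (dualAction_eq_iff α g _ _).2 fun b => by
    rw [dualAction_apply, inv_inv]
  have hh : (dualAction α).smul h w = Additive.ofMul v := (hgh w).symm.trans hg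
  rw [dualAction_eq_iff] at hg hh
  have h1 : v (α g a) = v (α h a) := (hg a).trans (hh a).symm
  rw [map_mul, map_inv, h1, mul_inv_cancel]

end Dual

/-- An invariant character of values of order prime to `p` extends invariantly across an elementary
abelian `p`-section. -/
theorem exists_invariant_extension {e p : ℕ} (hpe : p.Coprime e) {Γ : Type} [Group Γ]
    [Finite Γ] {N M : Subgroup Γ} [hN : N.Normal] [hM : M.Normal] {μ : Γ → ℂ}
    (hμ : InvChar N μ) (hval : ValuesOrder N μ e) (hNM : N ≤ M) (hMp : ∀ m ∈ M, m ^ p ∈ N)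
    (hcomm : ∀ a ∈ M, ∀ b ∈ M, a * b * a⁻¹ * b⁻¹ ∈ N) :
    ∃ ν : Γ → ℂ, InvChar M ν ∧ (∀ n ∈ N, ν n = μ n) ∧ ValuesOrder M ν e := by
  obtain ⟨ν, hν, hνμ⟩ := exists_extension hμ hNM (commute_of_commutator fun a ha b hb =>
    ⟨hcomm a ha b hb, by
      refine eq_one_of_pow_eq_one_of_coprime hpe ?_ (hval _ (hcomm a ha b hb))
      rw [← hμ.commutator_pow_left (hcomm a ha b hb) (hμ.conj a) p,
        hμ.commutator_eq_one (hMp a ha)]⟩)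
  obtain ⟨t, ht⟩ := exists_pow_mul_eq_self hpe
  have hp : ∀ m ∈ M, ν m ^ p = μ (m ^ p) := fun m hm => by
    rw [← hν.pow hm, hνμ _ (hMp m hm)]
  refine ⟨fun m => ν m ^ (p * t), ⟨⟨by simp [hν.one], fun a ha b hb => by
    rw [hν.mul a ha b hb, mul_pow]⟩, fun g m hm => ?_⟩, fun n hn => ?_, fun m hm => ?_⟩
  · rw [pow_mul, hp _ (hM.conj_mem m hm g), conj_pow, hμ.conj g _ (hMp m hm), ← hp m hm, pow_mul]
  · beta_reduce
    rw [hνμ n hn, ht _ (hval n hn)]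
  · beta_reduce
    rw [pow_mul, hp m hm, ← pow_mul, mul_comm, pow_mul, hval _ (hMp m hm), one_pow]

section Extensions

variable {r l : ℕ} {Γ : Type} [Group Γ] [Finite Γ] {N M : Subgroup Γ} [hN : N.Normal]
  [hM : M.Normal] {μ ν ν' : Γ → ℂ}

theorem exists_irred_over_stab (hr : r.Prime) (hμ : InvChar N μ) (hD : DegreesDistinct Γ N μ)
    (hNM : N ≤ M) (hl : M.index = r ^ l) (hν : LinChar M ν) (hext : ∀ n ∈ N, ν n = μ n) :
    ∃ c, M.relIndex (stab M ν) = r ^ (2 * c) ∧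
      ∃ (V : Type) (_ : AddCommGroup V) (_ : Module ℂ V) (_ : FiniteDimensional ℂ V)
        (ρ : Representation ℂ (stab M ν) V), Irred ρ ∧
          Over (M.subgroupOf (stab M ν)) (fun s => ν s) ρ ∧ finrank ℂ V = r ^ c := by
  obtain ⟨m, -, hm⟩ := (Nat.dvd_prime_pow hr).1
    (hl ▸ Subgroup.relIndex_dvd_index_of_normal M (stab M ν))
  exact DegreesDistinct.fully_ramified hr m (invChar_stab hν) (hD.of_stab hμ hNM hν hext) hm

theorem relIndex_sq_le (hr : r.Prime) (hμ : InvChar N μ) (hD : DegreesDistinct Γ N μ)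
    (hNM : N ≤ M) (hl : M.index = r ^ l) (hν : LinChar M ν) (hext : ∀ n ∈ N, ν n = μ n)
    {B : Subgroup Γ} (hMB : M ≤ B) (hB : B ≤ stab M ν)
    (hcomm : ∀ a ∈ B, ∀ b ∈ B, a * b * a⁻¹ * b⁻¹ ∈ M ∧ ν (a * b * a⁻¹ * b⁻¹) = 1) :
    M.relIndex B ^ 2 ≤ M.relIndex (stab M ν) := by
  obtain ⟨c, hc, V, _, _, _, ρ, hρ, hρν, hV⟩ := exists_irred_over_stab hr hμ hD hNM hl hν hext
  have h1 := hρ.finrank_le_index (B.subgroupOf (stab M ν)) fun a ha b hb => by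
    have h2 : a * b = (a * b * a⁻¹ * b⁻¹) * (b * a) := by group
    ext v
    rw [h2, rep_mul_apply, hρν (a * b * a⁻¹ * b⁻¹) (hcomm a ha b hb).1]
    change ν ((a : Γ) * b * (a : Γ)⁻¹ * (b : Γ)⁻¹) • _ = _
    rw [(hcomm a ha b hb).2, one_smul]
  rw [hV] at h1
  change r ^ c ≤ B.relIndex (stab M ν) at h1
  have h2 := Subgroup.relIndex_mul_relIndex M B _ hMB hB
  rw [hc] at h2 ⊢
  have h3 : M.relIndex B ≤ r ^ c := by
    refine Nat.le_of_mul_le_mul_right (c := r ^ c) ?_ (pow_pos hr.pos c)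
    calc M.relIndex B * r ^ c ≤ M.relIndex B * B.relIndex (stab M ν) := Nat.mul_le_mul_left _ h1
      _ = r ^ c * r ^ c := by rw [h2, ← pow_add, two_mul]
  calc M.relIndex B ^ 2 ≤ (r ^ c) ^ 2 := Nat.pow_le_pow_left h3 2
    _ = r ^ (2 * c) := by rw [← pow_mul, mul_comm]

theorem exists_conj_of_relIndex_eq (hr : r.Prime) (hμ : InvChar N μ) (hD : DegreesDistinct Γ N μ)
    (hNM : N ≤ M) (hl : M.index = r ^ l) (hν : LinChar M ν) (hext : ∀ n ∈ N, ν n = μ n)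
    (hν' : LinChar M ν') (hext' : ∀ n ∈ N, ν' n = μ n)
    (h : M.relIndex (stab M ν) = M.relIndex (stab M ν')) :
    ∃ x, ∀ m ∈ M, ν m = ν' (x * m * x⁻¹) := by
  obtain ⟨c, hc, V, _, _, _, ρ, hρ, hρν, hV⟩ := exists_irred_over_stab hr hμ hD hNM hl hν hext
  obtain ⟨c', hc', V', _, _, _, ρ', hρ', hρν', hV'⟩ :=
    exists_irred_over_stab hr hμ hD hNM hl hν' hext'
  obtain rfl : c = c' := by
    have := Nat.pow_right_injective hr.two_le (hc.symm.trans (h.trans hc'))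
    omega
  have hidx : (stab M ν).index = (stab M ν').index := by
    have h1 := Subgroup.relIndex_mul_index (le_stab hν)
    rw [← Subgroup.relIndex_mul_index (le_stab hν'), ← h] at h1
    refine Nat.eq_of_mul_eq_mul_left ?_ h1
    rw [hc]
    exact pow_pos hr.pos _
  have := hρ.1
  have := hρ'.1
  refine conj_of_isom_indRep (le_stab hν) (le_stab hν') (fun _ => Iff.rfl) hρν hρν'
    (hD _ _ _ _ (irred_indRep hν (le_stab hν) (fun _ => Iff.rfl) hρ hρν)
      (irred_indRep hν' (le_stab hν') (fun _ => Iff.rfl) hρ' hρν')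
      (over_indRep (le_stab hν) hNM hμ hext hρν)
      (over_indRep (le_stab hν') hNM hμ hext' hρν') ?_)
  rw [finrank_indSpace, finrank_indSpace, hidx, hV, hV']

end Extensions

section DualModule

variable {Γ : Type} [Group Γ]

/-- The conjugation action on a normal section. -/
noncomputable def sectionConj (N M : Subgroup Γ) [hN : N.Normal] [hM : M.Normal] :
    Γ →* MulAut (M ⧸ N.subgroupOf M) where
  toFun g := QuotientGroup.congr (N.subgroupOf M) (N.subgroupOf M) (MulAut.conjNormal g) (by
    ext m
    constructor
    · rintro ⟨n, hn, rfl⟩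
      exact hN.conj_mem n hn g
    · intro hm
      refine ⟨MulAut.conjNormal g⁻¹ m, ?_, ?_⟩
      · exact hN.conj_mem m hm g⁻¹
      · ext
        simp)
  map_one' := by
    ext x
    obtain ⟨m, rfl⟩ := QuotientGroup.mk_surjective x
    simp
  map_mul' g h := by
    ext x
    obtain ⟨m, rfl⟩ := QuotientGroup.mk_surjective x
    simp

variable {N M : Subgroup Γ} [hN : N.Normal] [hM : M.Normal]

theorem sectionConj_mk (g : Γ) (m : M) :
    sectionConj N M g (m : M ⧸ N.subgroupOf M) =
      ((⟨g * m * g⁻¹, hM.conj_mem m m.2 g⟩ : M) : M ⧸ N.subgroupOf M) := rfl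

theorem sectionConj_eq_one_iff {g : Γ} :
    sectionConj N M g = 1 ↔ ∀ m ∈ M, g * m * g⁻¹ * m⁻¹ ∈ N := by
  have hmk : ∀ x y : M, (x : M ⧸ N.subgroupOf M) = y ↔ (x : Γ) * (y : Γ)⁻¹ ∈ N := fun x y => by
    rw [← mul_inv_eq_one, ← QuotientGroup.mk_inv, ← QuotientGroup.mk_mul, QuotientGroup.eq_one_iff]
    exact Iff.rfl
  refine ⟨fun h m hm => ?_, fun h => MulEquiv.ext fun x => ?_⟩
  · have h1 := DFunLike.congr_fun h ((⟨m, hm⟩ : M) : M ⧸ N.subgroupOf M)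
    rw [sectionConj_mk] at h1
    exact (hmk _ _).1 h1
  · obtain ⟨m, rfl⟩ := QuotientGroup.mk_surjective x
    rw [sectionConj_mk]
    exact (hmk _ _).2 (h m m.2)

/-- The character group of a self-centralizing abelian chief factor, as a module for the quotient,
together with the evaluation of its elements. -/
theorem exists_dual_module [Finite Γ] {p : ℕ} (hNM : N < M) (hMp : ∀ m ∈ M, m ^ p ∈ N)
    (hcomm : ∀ a ∈ M, ∀ b ∈ M, a * b * a⁻¹ * b⁻¹ ∈ N)
    (hmin : ∀ M' : Subgroup Γ, M'.Normal → N ≤ M' → M' ≤ M → M' = N ∨ M' = M)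
    (hcent : ∀ g, (∀ m ∈ M, g * m * g⁻¹ * m⁻¹ ∈ N) → g ∈ M) :
    ∃ (V : Type) (_ : AddCommGroup V) (_ : Finite V) (_ : Nontrivial V)
      (_ : DistribMulAction (Γ ⧸ M) V) (_ : FaithfulSMul (Γ ⧸ M) V) (ev : V → Γ → ℂ),
      (∀ W : AddSubgroup V, (∀ g : Γ ⧸ M, ∀ v ∈ W, g • v ∈ W) → W = ⊥ ∨ W = ⊤) ∧
      (∀ v : V, p • v = 0) ∧ (∀ v, LinChar M (ev v)) ∧ (∀ v, ∀ n ∈ N, ev v n = 1) ∧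
      ∀ (g : Γ) (v w : V), (g : Γ ⧸ M) • v = w ↔ ∀ m ∈ M, ev w (g * m * g⁻¹) = ev v m := by
  classical
  let _ : CommGroup (M ⧸ N.subgroupOf M) :=
    { (inferInstance : Group (M ⧸ N.subgroupOf M)) with
      mul_comm := fun x y => by
        obtain ⟨a, rfl⟩ := QuotientGroup.mk_surjective x
        obtain ⟨b, rfl⟩ := QuotientGroup.mk_surjective y
        exact coe_commute_of_commutator_mem (N := N.subgroupOf M) (hcomm a a.2 b b.2) }
  let α : Γ ⧸ M →* MulAut (M ⧸ N.subgroupOf M) :=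
    QuotientGroup.lift M (sectionConj N M) fun g hg => sectionConj_eq_one_iff.2 fun m hm => hcomm g hg m hm
  have hα : Function.Injective α := by
    rw [injective_iff_map_eq_one]
    intro x hx
    obtain ⟨g, rfl⟩ := QuotientGroup.mk_surjective x
    exact (QuotientGroup.eq_one_iff g).2 (hcent g (sectionConj_eq_one_iff.1 hx))
  let ev : Additive ((M ⧸ N.subgroupOf M) →* ℂˣ) → Γ → ℂ := fun v m =>
    if h : m ∈ M then (v.toMul ((⟨m, h⟩ : M) : M ⧸ N.subgroupOf M) : ℂ) else 1
  have hev : ∀ v m (h : m ∈ M),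
      ev v m = (v.toMul ((⟨m, h⟩ : M) : M ⧸ N.subgroupOf M) : ℂ) := fun v m h => dif_pos h
  have hntA : Nontrivial (M ⧸ N.subgroupOf M) := by
    obtain ⟨m, hm, hmN⟩ := Set.exists_of_ssubset hNM
    refine ⟨((⟨m, hm⟩ : M) : M ⧸ N.subgroupOf M), 1, fun h => hmN ?_⟩
    exact (QuotientGroup.eq_one_iff (N := N.subgroupOf M) _).1 h
  have hnt : Nontrivial (Additive ((M ⧸ N.subgroupOf M) →* ℂˣ)) := by
    obtain ⟨a, ha⟩ := exists_ne (1 : M ⧸ N.subgroupOf M)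
    obtain ⟨v, hv⟩ := exists_character_ne_one ha
    refine ⟨Additive.ofMul v, 0, fun h => hv ?_⟩
    have h1 : v = 1 := h
    rw [h1]
    rfl
  have hfin : Finite (Additive ((M ⧸ N.subgroupOf M) →* ℂˣ)) :=
    inferInstanceAs (Finite ((M ⧸ N.subgroupOf M) →* ℂˣ))
  refine ⟨Additive ((M ⧸ N.subgroupOf M) →* ℂˣ), inferInstance, hfin, hnt, dualAction α,
    dualAction_faithful α hα, ev, ?_, ?_, ?_, ?_, ?_⟩
  · refine dualAction_irreducible α fun B hB => ?_
    let M' : Subgroup Γ := (B.comap (QuotientGroup.mk' (N.subgroupOf M))).map M.subtype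
    have hM' : ∀ m : M, (m : Γ) ∈ M' ↔ (m : M ⧸ N.subgroupOf M) ∈ B := fun m => by
      constructor
      · rintro ⟨x, hx, hxm⟩
        obtain rfl : x = m := Subtype.ext hxm
        exact hx
      · exact fun h => ⟨m, h, rfl⟩
    have hle : M' ≤ M := by
      rintro _ ⟨x, -, rfl⟩
      exact x.2
    have hnormal : M'.Normal := ⟨fun m hm g =>
      (hM' ⟨_, hM.conj_mem m (hle hm) g⟩).2 (hB g _ ((hM' ⟨m, hle hm⟩).1 hm))⟩
    have hNM' : N ≤ M' := fun n hn => by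
      refine (hM' ⟨n, hNM.le hn⟩).2 ?_
      rw [(QuotientGroup.eq_one_iff (N := N.subgroupOf M) ⟨n, hNM.le hn⟩).2 hn]
      exact one_mem _
    rcases hmin M' hnormal hNM' hle with h | h
    · left
      refine eq_bot_iff.2 fun x hx => ?_
      obtain ⟨m, rfl⟩ := QuotientGroup.mk_surjective x
      rw [← hM', h] at hx
      exact (QuotientGroup.eq_one_iff (N := N.subgroupOf M) m).2 hx
    · right
      refine eq_top_iff.2 fun x _ => ?_
      obtain ⟨m, rfl⟩ := QuotientGroup.mk_surjective x
      rw [← hM', h]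
      exact m.2
  · refine fun v => Additive.toMul.injective (MonoidHom.ext fun x => ?_)
    obtain ⟨m, rfl⟩ := QuotientGroup.mk_surjective x
    change v.toMul (m : M ⧸ N.subgroupOf M) ^ p = 1
    rw [← map_pow, ← QuotientGroup.mk_pow,
      (QuotientGroup.eq_one_iff (N := N.subgroupOf M) (m ^ p)).2 (hMp m m.2), map_one]
  · intro v
    refine ⟨?_, fun a ha b hb => ?_⟩
    · rw [hev v 1 (one_mem M)]
      exact congrArg Units.val (map_one v.toMul)
    · rw [hev v a ha, hev v b hb, hev v _ (mul_mem ha hb), ← Units.val_mul, ← map_mul]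
      rfl
  · intro v n hn
    rw [hev v n (hNM.le hn),
      (QuotientGroup.eq_one_iff (N := N.subgroupOf M) ⟨n, hNM.le hn⟩).2 hn, map_one, Units.val_one]
  · intro g v w
    refine (dualAction_eq_iff α g v w).trans ⟨fun h m hm => ?_, fun h x => ?_⟩
    · rw [hev v m hm, hev w _ (hM.conj_mem m hm g), ← h]
      rfl
    · obtain ⟨m, rfl⟩ := QuotientGroup.mk_surjective x
      have h1 := h m m.2
      rw [hev v m m.2, hev w _ (hM.conj_mem m m.2 g)] at h1
      exact Units.ext h1

end DualModule

/-- The kernel of a linear character of `M`. -/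
def LinChar.ker {Γ : Type} [Group Γ] {M : Subgroup Γ} {μ : Γ → ℂ} (hμ : LinChar M μ) :
    Subgroup Γ where
  carrier := {m | m ∈ M ∧ μ m = 1}
  one_mem' := ⟨one_mem M, hμ.one⟩
  mul_mem' {a b} ha hb := ⟨mul_mem ha.1 hb.1, by rw [hμ.mul a ha.1 b hb.1, ha.2, hb.2, one_mul]⟩
  inv_mem' {a} ha := ⟨inv_mem ha.1, by rw [hμ.inv ha.1, ha.2, inv_one]⟩

theorem InvChar.normal_ker {Γ : Type} [Group Γ] {M : Subgroup Γ} [hM : M.Normal] {μ : Γ → ℂ}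
    (hμ : InvChar M μ) : hμ.toLinChar.ker.Normal :=
  ⟨fun m hm g => ⟨hM.conj_mem m hm.1 g, by rw [hμ.conj g m hm.1, hm.2]⟩⟩

/-- Lifts of elements of `Γ ⧸ M` that commute modulo the kernel of an invariant character. -/
theorem commRelation_of_invChar {Γ : Type} [Group Γ] {M : Subgroup Γ} [hM : M.Normal] {μ : Γ → ℂ}
    (hμ : InvChar M μ) :
    CommRelation (fun x y : Γ ⧸ M => ∀ g h : Γ, (g : Γ ⧸ M) = x → (h : Γ ⧸ M) = y →
      g * h * g⁻¹ * h⁻¹ ∈ hμ.toLinChar.ker) := by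
  have := hμ.normal_ker
  let f : Γ ⧸ hμ.toLinChar.ker →* Γ ⧸ M := QuotientGroup.lift _ (QuotientGroup.mk' M)
    fun m hm => (QuotientGroup.eq_one_iff m).2 hm.1
  have h := commRelation_of_central f
    (fun x => by
      obtain ⟨g, rfl⟩ := QuotientGroup.mk_surjective x
      exact ⟨(g : Γ ⧸ hμ.toLinChar.ker), rfl⟩)
    (fun z hz g => by
      obtain ⟨m, rfl⟩ := QuotientGroup.mk_surjective z
      obtain ⟨g, rfl⟩ := QuotientGroup.mk_surjective g
      have hm : m ∈ M := (QuotientGroup.eq_one_iff m).1 hz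
      refine coe_commute_of_commutator_mem ⟨?_, hμ.commutator_eq_one hm⟩
      rw [mul_assoc, mul_assoc, ← mul_assoc g]
      exact mul_mem hm (hM.conj_mem _ (inv_mem hm) g))
    (fun z w hz hw hzz hww hz1 hw1 => by
      obtain ⟨m, rfl⟩ := QuotientGroup.mk_surjective z
      obtain ⟨n, rfl⟩ := QuotientGroup.mk_surjective w
      have hm : m ∈ M := (QuotientGroup.eq_one_iff m).1 hz
      have hn : n ∈ M := (QuotientGroup.eq_one_iff n).1 hw
      have key : ∀ x ∈ M, (x : Γ ⧸ hμ.toLinChar.ker) * x = 1 →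
          (x : Γ ⧸ hμ.toLinChar.ker) ≠ 1 → μ x = -1 := by
        intro x hx hxx hx1
        have h1 : μ (x * x) = 1 := ((QuotientGroup.eq_one_iff _).1 hxx).2
        rw [hμ.mul x hx x hx] at h1
        refine (mul_self_eq_one_iff.1 h1).resolve_left fun h => hx1 ?_
        exact (QuotientGroup.eq_one_iff _).2 ⟨hx, h⟩
      rw [← mul_inv_eq_one, ← QuotientGroup.mk_inv, ← QuotientGroup.mk_mul]
      refine (QuotientGroup.eq_one_iff _).2 ⟨mul_mem hm (inv_mem hn), ?_⟩
      rw [hμ.mul m hm _ (inv_mem hn), hμ.inv hn, key m hm hzz hz1, key n hn hww hw1]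
      norm_num)
  convert h using 3 with x y
  constructor
  · intro hxy g h hg hh
    obtain ⟨g, rfl⟩ := QuotientGroup.mk_surjective g
    obtain ⟨h, rfl⟩ := QuotientGroup.mk_surjective h
    exact coe_commute_of_commutator_mem (hxy g h hg hh)
  · intro hxy g h hg hh
    have h1 := hxy g h hg hh
    rw [← QuotientGroup.eq_one_iff]
    simp only [QuotientGroup.mk_mul, QuotientGroup.mk_inv]
    rw [h1.eq]
    group

theorem exists_normal_of_coprime_minimal {r k p : ℕ} (hr : r.Prime) (hp : p.Prime) (hpr : p ≠ r)
    {Γ : Type} [Group Γ] [Finite Γ] (hsol : Group.IsSolvable Γ) {N M : Subgroup Γ}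
    [hN : N.Normal] [hM : M.Normal] {μ : Γ → ℂ}
    (hμ : InvChar N μ) (hval : ValuesOrder N μ (r ^ k)) (hD : DegreesDistinct Γ N μ)
    (hNM : N < M) (hMp : ∀ m ∈ M, m ^ p ∈ N)
    (hcomm : ∀ a ∈ M, ∀ b ∈ M, a * b * a⁻¹ * b⁻¹ ∈ N)
    (hmin : ∀ M' : Subgroup Γ, M'.Normal → N ≤ M' → M' ≤ M → M' = N ∨ M' = M)
    (IH : ∀ (Δ : Type) [Group Δ] [Finite Δ] (L : Subgroup Δ), L.index < N.index →
      IndexClaim r Δ L) :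
    ∃ L : Subgroup Γ, L.Normal ∧ N < L ∧ ∀ x ∈ L, ∃ j, x ^ r ^ j ∈ N := by
  have hcop : ∀ i, p.Coprime (r ^ i) := fun i =>
    Nat.Coprime.pow_right i ((Nat.coprime_primes hp hr).2 hpr)
  obtain ⟨ν, hν, hνμ, hνval⟩ := exists_invariant_extension (hcop k) hμ hval hNM.le hMp hcomm
  obtain ⟨l, hl⟩ := IH Γ M (Subgroup.index_strictAnti hNM) hM hsol ν k hν hνval
    (hD.mono hNM.le hνμ)
  by_contra hH
  have hcent : ∀ g, (∀ m ∈ M, g * m * g⁻¹ * m⁻¹ ∈ N) → g ∈ M := by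
    intro g hg
    by_contra hgM
    have hMC : M ≤ (sectionConj N M).ker := fun m hm =>
      sectionConj_eq_one_iff.2 fun m' hm' => hcomm m hm m' hm'
    obtain ⟨i, -, hi⟩ := (Nat.dvd_prime_pow hr).1
      (hl ▸ Subgroup.relIndex_dvd_index_of_normal M (sectionConj N M).ker)
    exact hH (exists_normal_of_central hr (hNM.le.trans hMC) hMC
      (fun c hc => sectionConj_eq_one_iff.1 hc) hi
      (lt_of_le_of_ne hMC fun h => hgM (h ▸ sectionConj_eq_one_iff.2 hg)) hNM.le)
  obtain ⟨V, _, _, _, _, _, ev, hirr, hpV, hev, hevN, hact⟩ :=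
    exists_dual_module hNM hMp hcomm hmin hcent
  have hlin : ∀ v, LinChar M (fun m => ν m * ev v m) := fun v => hν.toLinChar.mul' (hev v)
  have hext : ∀ v, ∀ n ∈ N, ν n * ev v n = μ n := fun v n hn => by
    rw [hevN v n hn, mul_one, hνμ n hn]
  have hcancel : ∀ g v w, (∀ m ∈ M, ν (g * m * g⁻¹) * ev w (g * m * g⁻¹) = ν m * ev v m) ↔
      (g : Γ ⧸ M) • v = w := by
    intro g v w
    rw [hact]
    refine forall₂_congr fun m hm => ?_
    rw [hν.conj g m hm, mul_right_inj' (hν.ne_zero hm)]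
  have hstab : ∀ v, stab M (fun m => ν m * ev v m) =
      (MulAction.stabilizer (Γ ⧸ M) v).comap (QuotientGroup.mk' M) := fun v => by
    ext g
    exact hcancel g v v
  have hcard : ∀ B : Subgroup (Γ ⧸ M),
      Nat.card B = M.relIndex (B.comap (QuotientGroup.mk' M)) := fun B => by
    have h := Subgroup.relIndex_ker (B.comap (QuotientGroup.mk' M)) (QuotientGroup.mk' M)
    rw [Subgroup.map_comap_eq_self_of_surjective (QuotientGroup.mk'_surjective M),
      QuotientGroup.ker_mk'] at h
    exact h.symm
  refine not_distinctEvenOrbits (V := V) (commRelation_of_invChar hν) ?_ hr hp hpV hirr ⟨?_, ?_⟩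
  · intro v B hB hZ
    rw [hcard B, hcard, ← hstab]
    have hBle : B.comap (QuotientGroup.mk' M) ≤ stab M (fun m => ν m * ev v m) := by
      rw [hstab]
      exact Subgroup.comap_mono hB
    refine relIndex_sq_le hr hμ hD hNM.le hl (hlin v) (hext v)
      (fun m hm => ?_) hBle fun a ha b hb => ?_
    · rw [Subgroup.mem_comap, QuotientGroup.mk'_apply, (QuotientGroup.eq_one_iff m).2 hm]
      exact one_mem B
    · have hab := hZ _ ha _ hb a b rfl rfl
      have hinv : ∀ g ∈ B.comap (QuotientGroup.mk' M), ∀ m ∈ M, ev v (g * m * g⁻¹) = ev v m :=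
        fun g hg => (hact g v v).1 ((hcancel g v v).1 (hBle hg))
      refine ⟨hab.1, ?_⟩
      rw [hab.2, one_mul]
      refine eq_one_of_pow_eq_one_of_coprime (hcop l) ?_ ?_
      · rw [← (hev v).pow hab.1]
        exact hevN v _ (hMp _ hab.1)
      · have haM : a ^ r ^ l ∈ M := hl ▸ M.pow_index_mem a
        rw [← (hev v).commutator_pow_left hab.1 (hinv a ha), mul_assoc, mul_assoc, ← mul_assoc b,
          (hev v).mul _ haM _ (hM.conj_mem _ (inv_mem haM) b), hinv b hb _ (inv_mem haM),
          (hev v).inv haM, mul_inv_cancel₀ ((hev v).ne_zero haM)]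
  · intro v
    obtain ⟨c, hc, -⟩ := exists_irred_over_stab hr hμ hD hNM.le hl (hlin v) (hext v)
    exact ⟨c, by rw [hcard, ← hstab, hc]⟩
  · intro v w hvw
    have hidx : (MulAction.stabilizer (Γ ⧸ M) v).index =
        (MulAction.stabilizer (Γ ⧸ M) w).index := by
      rw [MulAction.index_stabilizer, MulAction.index_stabilizer]
      exact hvw
    have h1 := (MulAction.stabilizer (Γ ⧸ M) v).card_mul_index
    rw [← (MulAction.stabilizer (Γ ⧸ M) w).card_mul_index, hidx] at h1
    have h2 := Nat.eq_of_mul_eq_mul_right (Nat.pos_of_ne_zero Subgroup.index_ne_zero_of_finite) h1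
    rw [hcard, hcard, ← hstab, ← hstab] at h2
    obtain ⟨x, hx⟩ := exists_conj_of_relIndex_eq hr hμ hD hNM.le hl (hlin v) (hext v)
      (hlin w) (hext w) h2
    exact ⟨(x : Γ ⧸ M), (hcancel x v w).1 fun m hm => (hx m hm).symm⟩

/-- Over an invariant character of `r`-power order, irreducible representations determined by their
dimensions force an `r`-power index. -/
theorem index_eq_pow {r : ℕ} (hr : r.Prime) (Γ : Type) [Group Γ] [Finite Γ] (N : Subgroup Γ) :
    IndexClaim r Γ N := by
  suffices h : ∀ i, ∀ (Γ : Type) [Group Γ] [Finite Γ] (N : Subgroup Γ), N.index = i →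
      IndexClaim r Γ N from h _ Γ N rfl
  clear! Γ
  intro i
  induction i using Nat.strong_induction_on with
  | _ i ih =>
  rintro Γ _ _ N rfl hN hsol μ k hμ hval hD
  have IH : ∀ (Δ : Type) [Group Δ] [Finite Δ] (L : Subgroup Δ), L.index < N.index →
      IndexClaim r Δ L := fun Δ _ _ L h => ih _ h Δ L rfl
  by_cases hH : ∃ L : Subgroup Γ, L.Normal ∧ N < L ∧ ∀ x ∈ L, ∃ j, x ^ r ^ j ∈ N
  · obtain ⟨L, hL, hNL, hLr⟩ := hH
    obtain ⟨M, p, hM, hNM, hML, hp, hmin, hMp, hcomm⟩ := exists_minimal_normal hsol hL hNL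
    obtain rfl : p = r := by
      by_contra hpr
      refine hNM.not_ge fun m hm => ?_
      obtain ⟨j, hj⟩ := hLr m (hML hm)
      exact mem_of_pow_mem_of_pow_mem
        (Nat.Coprime.pow_right j ((Nat.coprime_primes hp hr).2 hpr)) (hMp m hm) hj
    exact index_eq_pow_of_minimal hr hsol hμ hval hD hNM hMp hcomm hmin IH
  · rcases eq_or_ne N ⊤ with rfl | hNtop
    · exact ⟨0, by simp⟩
    · obtain ⟨M, p, hM, hNM, -, hp, hmin, hMp, hcomm⟩ :=
        exists_minimal_normal hsol (L := ⊤) inferInstance hNtop.lt_top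
      rcases eq_or_ne p r with rfl | hpr
      · exact (hH ⟨M, hM, hNM, fun m hm => ⟨1, by simpa using hMp m hm⟩⟩).elim
      · exact (hH (exists_normal_of_coprime_minimal hr hp hpr hsol hμ hval hD hNM hMp hcomm hmin
          IH)).elim

section Codegree

variable {G : Type} [Group G] [Fintype G]

theorem Irred.character_mem_Irr {V : Type} [AddCommGroup V] [Module ℂ V] [FiniteDimensional ℂ V]
    {ρ : Representation ℂ G V} (hρ : Irred ρ) : ρ.character ∈ Irr G := by
  classical
  refine ⟨FDRep.of ρ, ?_, rfl⟩
  rw [FDRep.simple_iff_char_is_norm_one]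
  exact (hρ.char_orthonormal hρ).trans
    (if_pos (Irred.isom_of_character_eq hρ hρ rfl))

omit [Fintype G] in
theorem charDeg_character {V : Type} [AddCommGroup V] [Module ℂ V] [FiniteDimensional ℂ V]
    (ρ : Representation ℂ G V) : charDeg G ρ.character = finrank ℂ V := by
  rw [charDeg, Representation.char_one, Complex.natCast_re, Nat.floor_natCast]

/-- A subgroup contained in the kernel of a character acts trivially. -/
theorem apply_eq_self_of_subset_kerSet {K : Subgroup G} {V : Type} [AddCommGroup V] [Module ℂ V]
    [FiniteDimensional ℂ V] {ρ : Representation ℂ G V}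
    (h : (K : Set G) ⊆ kerSet G ρ.character) {x : G} (hx : x ∈ K) (v : V) : ρ x v = v := by
  classical
  have := Fintype.ofFinite K
  have hc : (Nat.card K : ℂ) ≠ 0 := by simp
  have : Invertible (Nat.card K : ℂ) := invertibleOfNonzero hc
  have h1 := FDRep.average_char_eq_finrank_invariants (FDRep.of (ρ.comp K.subtype))
  have h2 : ∀ y : K, (FDRep.of (ρ.comp K.subtype)).character y = finrank ℂ V := fun y =>
    (h y.2).trans (Representation.char_one ρ)
  simp only [h2] at h1
  rw [Finset.sum_const, Finset.card_univ, ← Nat.card_eq_fintype_card, nsmul_eq_mul,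
    inv_mul_cancel_left₀ hc, Nat.cast_inj] at h1
  have h3 : Representation.invariants (FDRep.of (ρ.comp K.subtype)).ρ = ⊤ :=
    Submodule.eq_top_of_finrank_eq h1.symm
  have h4 : v ∈ Representation.invariants (FDRep.of (ρ.comp K.subtype)).ρ := by
    rw [h3]; trivial
  exact h4 ⟨x, hx⟩

/-- Irreducible representations that are nontrivial on `K` are determined by their dimension. -/
theorem isom_of_codMult {K : Subgroup G} {n k : ℕ}
    (hfaith : ∀ χ ∈ Irr G, ¬ ((K : Set G) ⊆ kerSet G χ) → kerSet G χ = {1} ∧ cod G χ ≠ n)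
    (hmult : 1 < codMult G n) (htk : IsTk' G k) {V W : Type} [AddCommGroup V] [Module ℂ V]
    [FiniteDimensional ℂ V] [AddCommGroup W] [Module ℂ W] [FiniteDimensional ℂ W]
    {ρ : Representation ℂ G V} {σ : Representation ℂ G W} (hρ : Irred ρ) (hσ : Irred σ)
    (hρK : ∃ x ∈ K, ∃ v, ρ x v ≠ v) (hσK : ∃ x ∈ K, ∃ v, σ x v ≠ v)
    (hdim : finrank ℂ V = finrank ℂ W) : Isom ρ σ := by
  obtain ⟨d₀, -, -, hd₀⟩ := htk
  obtain rfl : n = d₀ := by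
    by_contra hne
    have hpos : {χ ∈ Irr G | cod G χ = n}.Nonempty :=
      Set.nonempty_of_ncard_ne_zero (Nat.ne_of_gt (Nat.zero_lt_of_lt hmult))
    exact hmult.ne' (hd₀ n hpos hne)
  obtain ⟨x, hx, v, hv⟩ := hρK
  obtain ⟨y, hy, w, hw⟩ := hσK
  obtain ⟨h1, h2⟩ := hfaith _ hρ.character_mem_Irr
    fun h => hv (apply_eq_self_of_subset_kerSet h hx v)
  obtain ⟨h3, -⟩ := hfaith _ hσ.character_mem_Irr
    fun h => hw (apply_eq_self_of_subset_kerSet h hy w)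
  have hcod : cod G σ.character = cod G ρ.character := by
    rw [cod, cod, h1, h3, charDeg_character, charDeg_character, hdim]
  obtain ⟨χ, hχ⟩ := Set.ncard_eq_one.1 (hd₀ _ ⟨_, hρ.character_mem_Irr, rfl⟩ h2)
  have e1 : ρ.character ∈ ({χ} : Set (G → ℂ)) := hχ ▸ ⟨hρ.character_mem_Irr, rfl⟩
  have e2 : σ.character ∈ ({χ} : Set (G → ℂ)) := hχ ▸ ⟨hσ.character_mem_Irr, hcod⟩
  exact hρ.isom_of_character_eq hσ (e1.trans e2.symm)

end Codegree

section Stabilizers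

variable {G : Type} [Group G] [Finite G] {K : Subgroup G} [hK : K.Normal] {μ : G → ℂ}

/-- The hypothesis that irreducible representations nontrivial on `K` are determined by their
dimensions. -/
def DistinctOver (K : Subgroup G) : Prop :=
  ∀ (V W : Type) [AddCommGroup V] [Module ℂ V] [FiniteDimensional ℂ V]
    [AddCommGroup W] [Module ℂ W] [FiniteDimensional ℂ W]
    (ρ : Representation ℂ G V) (σ : Representation ℂ G W), Irred ρ → Irred σ →
    (∃ x ∈ K, ∃ v, ρ x v ≠ v) → (∃ x ∈ K, ∃ v, σ x v ≠ v) → finrank ℂ V = finrank ℂ W → Isom ρ σ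

theorem DistinctOver.degreesDistinct_stab (hU : DistinctOver K) (hμ : LinChar K μ)
    (hne : ∃ x ∈ K, μ x ≠ 1) :
    DegreesDistinct (stab K μ) (K.subgroupOf (stab K μ)) (fun s => μ s) := by
  intro V W _ _ _ _ _ _ ρ σ hρ hσ hVρ hWσ hdim
  have key : ∀ {U : Type} [AddCommGroup U] [Module ℂ U] (τ : Representation ℂ (stab K μ) U),
      Irred τ → Over (K.subgroupOf (stab K μ)) (fun s => μ s) τ →
      ∃ x ∈ K, ∃ v, indRep τ x v ≠ v := by
    intro U _ _ τ hτ hτμ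
    obtain ⟨x, hx, hx1⟩ := hne
    have := hτ.1
    obtain ⟨u, hu⟩ := exists_ne (0 : U)
    refine ⟨x, hx, indDelta τ u, fun h => ?_⟩
    rw [indRep_indDelta (le_stab hμ) (fun s hs => hs) hτμ u hx] at h
    have h1 := congrArg (fun f => f.1 1) h
    have h2 : μ x • u = u := by simpa [indDelta_one] using h1
    rw [← sub_eq_zero, ← one_smul ℂ u, smul_smul, mul_one, ← sub_smul, smul_eq_zero] at h2
    exact h2.elim (fun h => hx1 (sub_eq_zero.1 h)) hu
  refine isom_of_isom_indRep (le_stab hμ) (fun _ => Iff.rfl) hρ hσ hVρ hWσ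
    (hU _ _ _ _ (irred_indRep hμ (le_stab hμ) (fun _ => Iff.rfl) hρ hVρ)
      (irred_indRep hμ (le_stab hμ) (fun _ => Iff.rfl) hσ hWσ) (key ρ hρ hVρ) (key σ hσ hWσ) ?_)
  rw [finrank_indSpace, finrank_indSpace, hdim]

theorem DistinctOver.relIndex_stab {r a : ℕ} (hU : DistinctOver K) (hsol : Group.IsSolvable G)
    (hr : r.Prime) (hcard : Nat.card K = r ^ a) (hμ : LinChar K μ) (hne : ∃ x ∈ K, μ x ≠ 1) :
    ∃ c, K.relIndex (stab K μ) = r ^ (2 * c) := by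
  have hD := hU.degreesDistinct_stab hμ hne
  have hsol' : Group.IsSolvable (stab K μ) := inferInstance
  obtain ⟨l, hl⟩ := index_eq_pow hr (stab K μ) (K.subgroupOf (stab K μ)) inferInstance hsol' _ a
    (invChar_stab hμ) (fun x hx => by
      have hx' : (x : G) ∈ K := hx
      have h1 : (x : G) ^ r ^ a = 1 := by
        rw [← hcard]
        exact congrArg Subtype.val (pow_card_eq_one' (x := (⟨x, hx'⟩ : K)))
      rw [← hμ.pow hx', h1, hμ.one]) hD
  obtain ⟨c, hc, -⟩ := DegreesDistinct.fully_ramified hr l (invChar_stab hμ) hD hl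
  exact ⟨c, hc⟩

end Stabilizers

open scoped Classical in
/-- The extension by `1` of a homomorphism to a function on the whole group. -/
noncomputable def extendOne {G : Type} [Group G] {K : Subgroup G} (v : K →* ℂˣ) (x : G) : ℂ :=
  if h : x ∈ K then v ⟨x, h⟩ else 1

section Extend

variable {G : Type} [Group G] {K : Subgroup G}

theorem extendOne_of_mem (v : K →* ℂˣ) {x : G} (hx : x ∈ K) : extendOne v x = v ⟨x, hx⟩ :=
  dif_pos hx

theorem linChar_extendOne (v : K →* ℂˣ) : LinChar K (extendOne v) where
  one := by
    rw [extendOne_of_mem v (one_mem K)]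
    exact congrArg Units.val (map_one v)
  mul a ha b hb := by
    rw [extendOne_of_mem v ha, extendOne_of_mem v hb, extendOne_of_mem v (mul_mem ha hb),
      ← Units.val_mul, ← map_mul]
    rfl

theorem exists_extendOne_ne_one {v : K →* ℂˣ} (hv : v ≠ 1) : ∃ x ∈ K, extendOne v x ≠ 1 := by
  by_contra! h
  refine hv (MonoidHom.ext fun x => Units.ext ?_)
  rw [← extendOne_of_mem v x.2]
  exact h x x.2

theorem mem_stab_extendOne [hK : K.Normal] {v : K →* ℂˣ} {g : G} :
    g ∈ stab K (extendOne v) ↔ ∀ x : K, v (MulAut.conjNormal g x) = v x := by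
  rw [mem_stab]
  refine ⟨fun h x => Units.ext ?_, fun h x hx => ?_⟩
  · have := h x x.2
    rwa [extendOne_of_mem v x.2, extendOne_of_mem v (hK.conj_mem x x.2 g)] at this
  · rw [extendOne_of_mem v hx, extendOne_of_mem v (hK.conj_mem x hx g), ← h ⟨x, hx⟩]
    rfl

end Extend

section Fixed

variable {G : Type} [Group G] [Finite G] {K : Subgroup G} [hK : K.Normal]

/-- A nontrivial linear character fixed by an `r`-subgroup. -/
theorem exists_le_stab_of_isPGroup {r a : ℕ} (hr : r.Prime)
    (hab : ∀ a ∈ K, ∀ b ∈ K, a * b = b * a) (ha : 1 ≤ a) (hcard : Nat.card K = r ^ a)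
    {P : Subgroup G} (hP : IsPGroup r P) :
    ∃ v : K →* ℂˣ, v ≠ 1 ∧ P ≤ stab K (extendOne v) := by
  have := Fact.mk hr
  let _ : CommGroup K :=
    { (inferInstance : Group K) with mul_comm := fun x y => Subtype.ext (hab x x.2 y y.2) }
  let α : P →* MulAut K := MulAut.conjNormal.comp P.subtype
  let _ : DistribMulAction P (Additive (K →* ℂˣ)) := dualAction α
  have hfin : Finite (Additive (K →* ℂˣ)) := inferInstanceAs (Finite (K →* ℂˣ))
  obtain ⟨v, hv, hv0⟩ := hP.exists_fixed_point_of_prime_dvd_card_of_fixed_point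
    (Additive (K →* ℂˣ)) (a := 0) (by
      have h : Nat.card (K →* ℂˣ) = Nat.card K :=
        CommGroup.card_monoidHom_of_hasEnoughRootsOfUnity K ℂ
      change r ∣ Nat.card (K →* ℂˣ)
      rw [h, hcard]
      exact dvd_pow_self r (by omega))
    (fun _ => rfl)
  refine ⟨v.toMul, fun h => hv0 h.symm, fun g hg => mem_stab_extendOne.2 ?_⟩
  exact (dualAction_eq_iff α ⟨g, hg⟩ v v).1 (hv ⟨g, hg⟩)

/-- An element fixing a nontrivial element of an abelian group fixes a nontrivial character. -/
theorem exists_mem_stab_of_fixed (hab : ∀ a ∈ K, ∀ b ∈ K, a * b = b * a) {g x : G} (hx : x ∈ K)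
    (hx1 : x ≠ 1) (hgx : g * x * g⁻¹ = x) :
    ∃ v : K →* ℂˣ, v ≠ 1 ∧ g ∈ stab K (extendOne v) := by
  let _ : CommGroup K :=
    { (inferInstance : Group K) with mul_comm := fun x y => Subtype.ext (hab x x.2 y y.2) }
  let α : K →* K := (MulAut.conjNormal g : MulAut K).toMonoidHom
  let φ : K →* K := α / MonoidHom.id K
  have hφ : ¬ Function.Surjective φ := by
    intro hs
    have hinj := Finite.injective_iff_surjective.2 hs
    refine hx1 (congrArg Subtype.val (hinj (a₁ := ⟨x, hx⟩) (a₂ := 1) ?_))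
    rw [map_one]
    change α ⟨x, hx⟩ / ⟨x, hx⟩ = 1
    rw [div_eq_one]
    exact Subtype.ext hgx
  obtain ⟨y, hy⟩ : ∃ y, y ∉ φ.range := by
    by_contra! h
    exact hφ h
  obtain ⟨w, hw⟩ := exists_character_ne_one (A := K ⧸ φ.range)
    (a := (y : K ⧸ φ.range)) fun h => hy ((QuotientGroup.eq_one_iff y).1 h)
  refine ⟨w.comp (QuotientGroup.mk' φ.range), fun h => hw (DFunLike.congr_fun h y),
    mem_stab_extendOne.2 fun z => ?_⟩
  have h1 : w (QuotientGroup.mk' φ.range (φ z)) = 1 := by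
    rw [QuotientGroup.mk'_apply, (QuotientGroup.eq_one_iff (N := φ.range) (φ z)).2
      (MonoidHom.mem_range.2 ⟨z, rfl⟩), map_one]
  have h2 : φ z = α z / z := rfl
  rw [h2, map_div, map_div, div_eq_one] at h1
  exact h1

end Fixed

end TwistedRep

open TwistedRep

/-- Lemma 2.8(b): under the stated hypotheses, Sylow `r`-subgroups of `G/K`
have order an even power of `r`, and Hall `r'`-subgroups of `G/K` act
Frobeniusly on `K`. -/
theorem sylow_even_power_and_frobenius (G : Type) [Group G] [Fintype G]
    (hsolv : IsSolvable G) (K : Subgroup G) (hn : K.Normal)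
    (hab : ∀ a ∈ K, ∀ b ∈ K, a * b = b * a) (r a : ℕ) (hr : r.Prime)
    (ha : 1 ≤ a) (hcard : Nat.card K = r ^ a) (n k : ℕ)
    (hfaith : ∀ χ ∈ Irr G, ¬ ((K : Set G) ⊆ kerSet G χ) →
      kerSet G χ = {1} ∧ cod G χ ≠ n)
    (hmult : 1 < codMult G n) (hk : 1 ≤ k) (htk : IsTk' G k) :
    (∀ P : Sylow r (G ⧸ K), ∃ c : ℕ,
      Nat.card ↥(P : Subgroup (G ⧸ K)) = r ^ (2 * c)) ∧
    (∀ H : Subgroup (G ⧸ K),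
      Nat.card ↥H =
        Nat.card (G ⧸ K) / r ^ (Nat.card (G ⧸ K)).factorization r →
      ∀ g : G, (QuotientGroup.mk g : G ⧸ K) ∈ H →
        (QuotientGroup.mk g : G ⧸ K) ≠ 1 →
        ∀ x ∈ K, x ≠ 1 → g * x * g⁻¹ ≠ x) := by
  have := Fact.mk hr
  have hU : DistinctOver K := fun V W _ _ _ _ _ _ ρ σ hρ hσ hρK hσK hdim =>
    isom_of_codMult hfaith hmult htk hρ hσ hρK hσK hdim
  constructor
  · intro P
    obtain ⟨Q⟩ : Nonempty (Sylow r G) := inferInstance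
    obtain ⟨v, hv, hQ⟩ := exists_le_stab_of_isPGroup hr hab ha hcard Q.isPGroup'
    obtain ⟨c, hc⟩ := hU.relIndex_stab hsolv hr hcard (linChar_extendOne v)
      (exists_extendOne_ne_one hv)
    refine ⟨c, ?_⟩
    have hidx := Subgroup.relIndex_mul_index (le_stab (linChar_extendOne v))
    have hndvd : ¬ r ∣ (stab K (extendOne v)).index := fun h =>
      Q.not_dvd_index (h.trans (Subgroup.index_dvd_of_le hQ))
    rw [P.card_eq_multiplicity]
    change r ^ K.index.factorization r = _
    rw [← hidx, hc, Nat.factorization_mul (pow_pos hr.pos _).ne' Subgroup.index_ne_zero_of_finite,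
      Finsupp.add_apply, Nat.factorization_eq_zero_of_not_dvd hndvd, add_zero,
      hr.factorization_pow, Finsupp.single_eq_same]
  · intro H hH g hgH hg1 x hx hx1 hgx
    obtain ⟨v, hv, hg⟩ := exists_mem_stab_of_fixed hab hx hx1 hgx
    obtain ⟨c, hc⟩ := hU.relIndex_stab hsolv hr hcard (linChar_extendOne v)
      (exists_extendOne_ne_one hv)
    refine hg1 ((QuotientGroup.eq_one_iff g).2 ?_)
    refine mem_of_pow_mem_of_pow_mem (a := r ^ (2 * c)) (b := Nat.card H) ?_
      (hc ▸ pow_relIndex_mem hg) ?_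
    · rw [hH]
      exact Nat.Coprime.pow_left _ (Nat.coprime_ordCompl hr Nat.card_pos.ne')
    · rw [← QuotientGroup.eq_one_iff, QuotientGroup.mk_pow]
      exact congrArg Subtype.val (pow_card_eq_one' (x := (⟨g, hgH⟩ : H)))
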